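/- arXiv:1707.01782 — 3 statements merged into one kernel-verified Lean document; each statement's English description precedes it below -/
import Mathlib

section
/- Let H be a separable infinite-dimensional complex Hilbert space, Q(H) = B(H)/K(H) the Calkin algebra, and π : B(H) → Q(H) the quotient map. Let A be a separable unital C*-algebra which is the closure of the union of an increasing sequence (A_n) of C*-subalgebras, and let θ : A → Q(H) be an injective unital *-homomorphism. If for every n the restriction θ|A_n is semisplit, i.e. there exists a completely positive contraction ψ_n : A_n → B(H) with π ∘ ψ_n = θ|A_n, then θ itself is semisplit: there exists a completely positive contraction ψ : A → B(H) with π ∘ ψ = θ. -/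
open Cardinal

/-- A linear map between *-algebras is completely positive if for every `n` and every
`n × n` matrix `y` with entries in the domain, the matrix with `(i,j)`-entry
`φ ((y* y)_{ij})` is a positive element (i.e. of the form `z* z`) of the algebra of
`n × n` matrices over the codomain. -/
def IsCompletelyPositive {A B : Type*} [NonUnitalRing A] [StarRing A] [Module ℂ A]
    [NonUnitalRing B] [StarRing B] [Module ℂ B] (φ : A →ₗ[ℂ] B) : Prop :=
  ∀ (n : ℕ) (y : Matrix (Fin n) (Fin n) A),
    ∃ z : Matrix (Fin n) (Fin n) B,
      (Matrix.of fun i j => φ ((star y * y) i j)) = star z * z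

section Helpers

set_option linter.all false
open scoped ComplexOrder InnerProductSpace Topology


/-- Kernel form of complete positivity. -/
def KCP {A H : Type*} [NonUnitalRing A] [StarRing A] [Module ℂ A]
    [NormedAddCommGroup H] [InnerProductSpace ℂ H] (φ : A →ₗ[ℂ] (H →L[ℂ] H)) : Prop :=
  ∀ (m : ℕ) (a : Fin m → A) (x : Fin m → H),
    0 ≤ ∑ i, ∑ j, ⟪x i, φ (star (a i) * a j) (x j)⟫_ℂ

theorem exists_sqrt_aux {L : Type*} [NormedAddCommGroup L] [InnerProductSpace ℂ L]
    [CompleteSpace L] (M : L →L[ℂ] L) (hM : ∀ x, 0 ≤ ⟪x, M x⟫_ℂ) :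
    ∃ Z : L →L[ℂ] L, M = star Z * Z := by
  have hM : 0 ≤ M := by
    rw [ContinuousLinearMap.nonneg_iff_isPositive, ContinuousLinearMap.isPositive_iff_complex]
    intro x
    have key : 0 ≤ ⟪M x, x⟫_ℂ := by
      rw [← inner_conj_symm]
      exact star_nonneg_iff.mpr (hM x)
    obtain ⟨h3, h4⟩ := Complex.le_def.mp key
    refine ⟨?_, h3⟩
    apply Complex.ext
    · simp
    · simpa using h4
  exact CStarAlgebra.nonneg_iff_eq_star_mul_self.mp hM

theorem KCP.isCompletelyPositive_aux {A H L : Type*} [NonUnitalRing A] [StarRing A] [Module ℂ A]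
    [NormedAddCommGroup H] [InnerProductSpace ℂ H] [CompleteSpace H] {φ : A →ₗ[ℂ] (H →L[ℂ] H)}
    [NormedAddCommGroup L] [InnerProductSpace ℂ L] [CompleteSpace L] (n : ℕ)
    (pr : Fin n → (L →L[ℂ] H))
    (hpp : ∀ i j, (pr i) ∘L (pr j).adjoint = if i = j then 1 else 0)
    (hsum : ∑ k, (pr k).adjoint ∘L (pr k) = 1)
    (h : KCP φ) (y : Matrix (Fin n) (Fin n) A) :
    ∃ z : Matrix (Fin n) (Fin n) (H →L[ℂ] H),
      (Matrix.of fun i j => φ ((star y * y) i j)) = star z * z := by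
  let M : L →L[ℂ] L := ∑ i, ∑ j, (pr i).adjoint ∘L (φ ((star y * y) i j)) ∘L (pr j)
  have hM : ∀ x, 0 ≤ ⟪x, M x⟫_ℂ := by
    intro x
    have h1 : ⟪x, M x⟫_ℂ = ∑ k, ∑ i, ∑ j, ⟪pr i x, φ (star (y k i) * y k j) (pr j x)⟫_ℂ := by
      simp only [M, sum_apply, inner_sum, ContinuousLinearMap.comp_apply,
        ContinuousLinearMap.adjoint_inner_right, Matrix.mul_apply, Matrix.star_apply, map_sum]
      rw [Finset.sum_comm_cycle]
    rw [h1]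
    exact Finset.sum_nonneg fun k _ => h n (y k) (fun i => pr i x)
  obtain ⟨Z, hZ⟩ := exists_sqrt_aux M hM
  refine ⟨Matrix.of fun i j => pr i ∘L Z ∘L (pr j).adjoint, ?_⟩
  ext1 i j
  have e1 : φ ((star y * y) i j) = pr i ∘L M ∘L (pr j).adjoint := by
    have : pr i ∘L M ∘L (pr j).adjoint = ∑ i', ∑ j', (pr i ∘L (pr i').adjoint) ∘L
        (φ ((star y * y) i' j')) ∘L (pr j' ∘L (pr j).adjoint) := by
      ext x
      simp [M]
    rw [this]
    simp only [hpp]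
    rw [Finset.sum_eq_single i, Finset.sum_eq_single j]
    · ext; simp
    · intro b _ hb; simp [hb]
    · simp
    · intro b _ hb; simp [Ne.symm hb]
    · simp
  rw [Matrix.mul_apply]
  simp only [Matrix.of_apply, Matrix.star_apply]
  rw [e1, hZ]
  have e2 : ∀ k, star (pr k ∘L Z ∘L (pr i).adjoint) * (pr k ∘L Z ∘L (pr j).adjoint) =
     pr i ∘L (star Z * ((pr k).adjoint ∘L (pr k)) * Z) ∘L (pr j).adjoint := by
    intro k
    rw [ContinuousLinearMap.star_eq_adjoint, ContinuousLinearMap.adjoint_comp,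
      ContinuousLinearMap.adjoint_comp, ContinuousLinearMap.adjoint_adjoint]
    rfl
  simp only [e2]
  have e3 : star Z * Z = ∑ k, star Z * ((pr k).adjoint ∘L (pr k)) * Z := by
    rw [← Finset.sum_mul, ← Finset.mul_sum, hsum, mul_one]
  rw [e3]
  ext x
  simp

theorem KCP.isCompletelyPositive {A H : Type*} [NonUnitalRing A] [StarRing A] [Module ℂ A]
    [NormedAddCommGroup H] [InnerProductSpace ℂ H] [CompleteSpace H] {φ : A →ₗ[ℂ] (H →L[ℂ] H)}
    (h : KCP φ) : IsCompletelyPositive φ := by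
  intro n y
  refine KCP.isCompletelyPositive_aux (L := PiLp 2 (fun _ : Fin n => H)) n
    (fun i => PiLp.proj (𝕜 := ℂ) 2 (fun _ : Fin n => H) i) ?_ ?_ h y
  · intro i j
    ext x
    refine ext_inner_left ℂ fun v => ?_
    have : ∀ w : PiLp 2 (fun _ : Fin n => H),
        ⟪w, (PiLp.proj (𝕜 := ℂ) 2 (fun _ : Fin n => H) j).adjoint x⟫_ℂ = ⟪w j, x⟫_ℂ := fun w =>
      ContinuousLinearMap.adjoint_inner_right _ _ _
    have h2 := this (WithLp.toLp 2 (Pi.single i v))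
    rw [PiLp.inner_apply] at h2
    rw [Finset.sum_eq_single i] at h2
    · simp only [Pi.single_eq_same] at h2
      change ⟪v, ((PiLp.proj (𝕜 := ℂ) 2 (fun _ : Fin n => H) j).adjoint x) i⟫_ℂ = _
      rw [h2]
      by_cases hij : i = j
      · subst hij; simp
      · simp [hij, Pi.single_apply, Ne.symm hij]
    · intro b _ hb
      simp [Pi.single_apply, hb]
    · simp
  · ext1 x
    refine ext_inner_left ℂ fun v => ?_
    rw [sum_apply, inner_sum]
    simp only [ContinuousLinearMap.comp_apply, ContinuousLinearMap.adjoint_inner_right]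
    rw [ContinuousLinearMap.one_apply, PiLp.inner_apply]
    rfl

theorem KCP.nonneg {A H : Type*} [NonUnitalRing A] [StarRing A] [Module ℂ A]
    [NormedAddCommGroup H] [InnerProductSpace ℂ H] {φ : A →ₗ[ℂ] (H →L[ℂ] H)}
    (h : KCP φ) (a : A) (x : H) : 0 ≤ ⟪x, φ (star a * a) x⟫_ℂ := by
  simpa using h 1 (fun _ => a) (fun _ => x)

theorem KCP.norm_le {A H : Type*} [CStarAlgebra A]
    [NormedAddCommGroup H] [InnerProductSpace ℂ H] {φ : A →ₗ[ℂ] (H →L[ℂ] H)}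
    (h : KCP φ) (h1 : ∀ x, (⟪x, φ 1 x⟫_ℂ).re ≤ ‖x‖ ^ 2) (a : A) : ‖φ a‖ ≤ ‖a‖ := by
  let _ := CStarAlgebra.spectralOrder A
  let _ := CStarAlgebra.spectralOrderedRing A
  have hpos : ∀ y, (⟪y, φ (star a * a) y⟫_ℂ).re ≤ (‖a‖ * ‖y‖) ^ 2 := by
    intro y
    have h2 : 0 ≤ algebraMap ℝ A (‖a‖ ^ 2) - star a * a := by
      rw [sub_nonneg]
      have := CStarAlgebra.star_mul_le_algebraMap_norm_sq (a := a)
      simpa using this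
    obtain ⟨b, hb⟩ := CStarAlgebra.nonneg_iff_eq_star_mul_self.mp h2
    have h3 := h.nonneg b y
    rw [← hb] at h3
    have h4 := (Complex.le_def.mp h3).1
    rw [map_sub, Algebra.algebraMap_eq_smul_one, ← Complex.coe_smul, map_smul] at h4
    simp only [sub_apply, inner_sub_right, smul_apply,
      inner_smul_right, Complex.sub_re, Complex.re_ofReal_mul, Complex.zero_re] at h4
    have h5 := mul_le_mul_of_nonneg_left (h1 y) (sq_nonneg ‖a‖)
    rw [mul_pow]; linarith
  -- the quadratic inequality
  have hq : ∀ (x y : H) (α : ℂ), 0 ≤ (starRingEnd ℂ α * α) * ⟪x, φ 1 x⟫_ℂ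
      + starRingEnd ℂ α * ⟪x, φ a y⟫_ℂ + α * ⟪y, φ (star a) x⟫_ℂ + ⟪y, φ (star a * a) y⟫_ℂ := by
    intro x y α
    have := h 2 ![1, a] ![α • x, y]
    simp [Fin.sum_univ_two, inner_smul_left, inner_smul_right] at this
    refine this.trans (le_of_eq ?_)
    ring
  have hp : ∀ x, (⟪x, φ 1 x⟫_ℂ).im = 0 := fun x => by
    have := h.nonneg 1 x
    simp only [star_one, mul_one] at this
    exact (Complex.le_def.mp this).2.symm
  have ht : ∀ y, (⟪y, φ (star a * a) y⟫_ℂ).im = 0 := fun y =>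
    (Complex.le_def.mp (h.nonneg a y)).2.symm
  have hr : ∀ x y, ⟪y, φ (star a) x⟫_ℂ = starRingEnd ℂ ⟪x, φ a y⟫_ℂ := by
    intro x y
    have a1 := (Complex.le_def.mp (hq x y 1)).2
    have a2 := (Complex.le_def.mp (hq x y Complex.I)).2
    simp [hp, ht] at a1 a2
    apply Complex.ext
    · rw [Complex.conj_re]; linarith
    · rw [Complex.conj_im]; linarith
  have hfin : ∀ x y, ‖⟪x, φ a y⟫_ℂ‖ ≤ ‖x‖ * (‖a‖ * ‖y‖) := by
    intro x y
    set q := ⟪x, φ a y⟫_ℂ with hqdef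
    have h3 : ∀ s : ℝ, 0 ≤ (‖q‖ ^ 2 * ‖x‖ ^ 2) * (s * s) + (-2 * ‖q‖ ^ 2) * s + (‖a‖ * ‖y‖) ^ 2 := by
      intro s
      have h4 := (Complex.le_def.mp (hq x y (-(s : ℂ) * q))).1
      rw [hr x y, ← hqdef] at h4
      have e1 : starRingEnd ℂ (-(s : ℂ) * q) * (-(s : ℂ) * q) = ((s * s * ‖q‖ ^ 2 : ℝ) : ℂ) := by
        have := Complex.conj_mul' q
        rw [map_mul, map_neg, Complex.conj_ofReal]
        push_cast
        rw [← this]; ring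
      have e2 : starRingEnd ℂ (-(s : ℂ) * q) * q = ((-s * ‖q‖ ^ 2 : ℝ) : ℂ) := by
        have := Complex.conj_mul' q
        rw [map_mul, map_neg, Complex.conj_ofReal]
        push_cast
        rw [← this]; ring
      have e3 : (-(s : ℂ) * q) * starRingEnd ℂ q = ((-s * ‖q‖ ^ 2 : ℝ) : ℂ) := by
        have := Complex.conj_mul' q
        push_cast
        rw [← this]; ring
      rw [e1, e2, e3] at h4
      simp only [Complex.add_re, Complex.re_ofReal_mul, Complex.ofReal_re, Complex.zero_re] at h4
      have h5 := mul_le_mul_of_nonneg_left (h1 x) (mul_nonneg (mul_self_nonneg s) (sq_nonneg ‖q‖))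
      have h6 := hpos y
      nlinarith
    have h7 := discrim_le_zero h3
    unfold discrim at h7
    by_cases hq0 : ‖q‖ = 0
    · rw [hq0]; positivity
    · have h8 : 0 < ‖q‖ ^ 2 := by positivity
      have : ‖q‖ ^ 2 ≤ (‖x‖ * (‖a‖ * ‖y‖)) ^ 2 := by
        by_contra hcon
        push Not at hcon
        nlinarith [mul_lt_mul_of_pos_left hcon h8]
      exact (sq_le_sq₀ (norm_nonneg _) (by positivity)).mp this
  refine ContinuousLinearMap.opNorm_le_bound _ (norm_nonneg _) fun y => ?_
  have := hfin (φ a y) y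
  rw [inner_self_eq_norm_sq_to_K] at this
  by_cases h0 : ‖φ a y‖ = 0
  · rw [h0]; positivity
  · have h8 : 0 < ‖φ a y‖ := lt_of_le_of_ne (norm_nonneg _) (Ne.symm h0)
    simp at this
    rw [pow_two] at this
    exact le_of_mul_le_mul_left this h8



theorem krein_ext {E : Type*} [CStarAlgebra E] [PartialOrder E] [StarOrderedRing E]
    (D : Submodule ℂ E) (F : D →ₗ[ℂ] ℂ) (h1 : (1 : E) ∈ D)
    (hs : ∀ a : D, ∃ h : star (a : E) ∈ D, F ⟨star (a : E), h⟩ = star (F a))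
    (hp : ∀ a : D, 0 ≤ (a : E) → 0 ≤ (F a).re) :
    ∃ s : E →ₗ[ℂ] ℂ, (∀ a : D, s a = F a) ∧ ∀ w : E, 0 ≤ s (star w * w) := by
  let C : PointedCone ℝ E :=
    { carrier := {a | 0 ≤ a + star a}
      add_mem' := by
        intro a b ha hb
        simp only [Set.mem_setOf_eq] at *
        have := add_nonneg ha hb
        rw [star_add]
        convert this using 1
        abel
      zero_mem' := by simp
      smul_mem' := by
        intro c a ha
        simp only [Set.mem_setOf_eq] at *
        have h2 : c • a + star (c • a) = (c : ℝ) • (a + star a) := by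
          change (c : ℝ) • a + star ((c : ℝ) • a) = _
          rw [smul_add, star_smul, star_trivial]
        rw [h2]
        exact smul_nonneg c.2 ha }
  have hC : ∀ a, a ∈ C ↔ 0 ≤ a + star a := fun a => Iff.rfl
  let f : E →ₗ.[ℝ] ℝ := ⟨D.restrictScalars ℝ,
    { toFun := fun a => (F ⟨a.1, a.2⟩).re
      map_add' := by
        intro a b
        have := F.map_add ⟨a.1, a.2⟩ ⟨b.1, b.2⟩
        rw [← Complex.add_re, ← this]; rfl
      map_smul' := by
        intro c a
        have := F.map_smul (c : ℂ) ⟨a.1, a.2⟩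
        have h3 : (F ⟨(c • a).1, (c • a).2⟩) = (c : ℂ) • F ⟨a.1, a.2⟩ := by
          rw [← this]; congr 1
        rw [h3]; simp }⟩
  obtain ⟨g, hg1, hg2⟩ := riesz_extension C f (by
      rintro ⟨a, ha⟩ hC'
      obtain ⟨h, hh⟩ := hs ⟨a, ha⟩
      have := hp ⟨a + star a, D.add_mem ha h⟩ hC'
      have h4 : F ⟨a + star a, D.add_mem ha h⟩ = F ⟨a, ha⟩ + F ⟨star a, h⟩ := by
        rw [← map_add]; rfl
      rw [h4, hh] at this
      simp at this
      change 0 ≤ (F ⟨a, ha⟩).re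
      exact this) (by
      intro y
      refine ⟨⟨(‖y + star y‖ : ℂ) • (1:E), D.smul_mem _ h1⟩, ?_⟩
      change 0 ≤ _ + star _
      have hsa : IsSelfAdjoint (y + star y) := by
        rw [IsSelfAdjoint, star_add, star_star, add_comm]
      have h5 := hsa.neg_algebraMap_norm_le_self
      have h6 : (0:E) ≤ (algebraMap ℝ E) ‖y + star y‖ := by
        rw [Algebra.algebraMap_eq_smul_one]
        exact smul_nonneg (norm_nonneg _) zero_le_one
      have h7 : (‖y + star y‖ : ℂ) • (1:E) = (algebraMap ℝ E) ‖y + star y‖ := by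
        rw [Algebra.algebraMap_eq_smul_one]; simp
      have h8 := add_nonneg (neg_le_iff_add_nonneg.mp h5) h6
      simp only [star_add, h7]
      convert h8 using 1
      have : star ((algebraMap ℝ E) ‖y + star y‖) = (algebraMap ℝ E) ‖y + star y‖ := by
        rw [Algebra.algebraMap_eq_smul_one]; simp
      rw [this]
      abel)
  have hre : ∀ a : D, g a = (F a).re := fun a => hg1 ⟨a.1, a.2⟩
  let s : E →ₗ[ℂ] ℂ :=
    { toFun := fun a => (g a : ℂ) - Complex.I * (g (Complex.I • a) : ℂ)
      map_add' := by intro a b; simp [smul_add, map_add]; ring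
      map_smul' := by
        intro c a
        have e1 : ∀ (c : ℂ) (a : E), g (c • a) = c.re * g a + c.im * g (Complex.I • a) := by
          intro c a
          have : c • a = c.re • a + c.im • (Complex.I • a) := by
            have h9 : ∀ r : ℝ, ∀ b : E, r • b = (r : ℂ) • b := fun r b => by simp
            rw [h9, h9, smul_smul, ← add_smul, Complex.re_add_im]
          rw [this, map_add, map_smul, map_smul]; simp
        rw [e1 c a, smul_smul, e1 (Complex.I * c) a]
        apply Complex.ext <;> simp <;> ring }
  have hsd : ∀ a, s a = (g a : ℂ) - Complex.I * (g (Complex.I • a) : ℂ) := fun a => rfl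
  refine ⟨s, ?_, ?_⟩
  · intro a
    rw [hsd]
    have e2 := hre (Complex.I • a)
    rw [map_smul] at e2
    have e3 : g (Complex.I • (a : E)) = (Complex.I • F a).re := e2
    rw [hre, e3]
    apply Complex.ext <;> simp
  · intro w
    have hw := star_mul_self_nonneg w
    have e1 : 0 ≤ g (star w * w) := hg2 _ ((hC _).2 (by simpa using add_nonneg hw hw))
    have e2 : 0 ≤ g (Complex.I • (star w * w)) := hg2 _ ((hC _).2 (by simp))
    have e3 : 0 ≤ g (-(Complex.I • (star w * w))) := hg2 _ ((hC _).2 (by simp))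
    rw [map_neg] at e3
    have e4 : g (Complex.I • (star w * w)) = 0 := by linarith
    rw [hsd, e4]
    simpa using e1

theorem IsCompletelyPositive.map_nonneg_aux {A H : Type*} [NonUnitalRing A] [StarRing A] [Module ℂ A]
    [NormedAddCommGroup H] [InnerProductSpace ℂ H] [CompleteSpace H] {φ : A →ₗ[ℂ] (H →L[ℂ] H)}
    (h : IsCompletelyPositive φ) (a : A) : ∃ z, φ (star a * a) = star z * z := by
  obtain ⟨z, hz⟩ := h 1 (Matrix.of fun _ _ => a)
  have := congrFun (congrFun hz 0) 0
  refine ⟨z 0 0, ?_⟩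
  simpa [Matrix.mul_apply] using this

theorem IsCompletelyPositive.map_star' {A H : Type*} [NonUnitalCStarAlgebra A]
    [NormedAddCommGroup H] [InnerProductSpace ℂ H] [CompleteSpace H] {φ : A →ₗ[ℂ] (H →L[ℂ] H)}
    (h : IsCompletelyPositive φ) (a : A) : φ (star a) = star (φ a) := by
  let _ := CStarAlgebra.spectralOrder A
  let _ := CStarAlgebra.spectralOrderedRing A
  obtain ⟨x, hx, hx2, rfl⟩ := CStarAlgebra.exists_sum_four_nonneg a
  have h1 : ∀ i, φ (star (x i)) = star (φ (x i)) := by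
    intro i
    obtain ⟨y, hy⟩ := CStarAlgebra.nonneg_iff_eq_star_mul_self.mp (hx i)
    obtain ⟨z, hz⟩ := h.map_nonneg_aux y
    rw [hy, star_mul, star_star, hz, star_mul, star_star]
  simp [star_sum, map_sum, h1]



theorem approx_unit_aux {A : Type*} [NonUnitalCStarAlgebra A] (F : Finset A) (ε : ℝ) (hε : 0 < ε) :
    ∃ u : A, star u = u ∧ ‖u‖ ≤ 1 ∧ ∀ b ∈ F, ‖u * b * u - b‖ ≤ ε := by
  let _ := CStarAlgebra.spectralOrder A
  let _ := CStarAlgebra.spectralOrderedRing A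
  have hl := CStarAlgebra.increasingApproximateUnit A
  have hne := hl.neBot
  have h1 : ∀ᶠ u in CStarAlgebra.approximateUnit A, ∀ b ∈ F, ‖u * b - b‖ ≤ ε / 2 := by
    rw [Filter.eventually_all_finset]
    intro b hb
    have := hl.tendsto_mul_right b
    rw [Metric.tendsto_nhds] at this
    filter_upwards [this (ε / 2) (by positivity)] with u hu
    rw [← dist_eq_norm]; exact hu.le
  have h2 : ∀ᶠ u in CStarAlgebra.approximateUnit A, ∀ b ∈ F, ‖b * u - b‖ ≤ ε / 2 := by
    rw [Filter.eventually_all_finset]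
    intro b hb
    have := hl.tendsto_mul_left b
    rw [Metric.tendsto_nhds] at this
    filter_upwards [this (ε / 2) (by positivity)] with u hu
    rw [← dist_eq_norm]; exact hu.le
  obtain ⟨u, a1, a2, a3, a4⟩ := (h1.and (h2.and (hl.eventually_norm.and hl.eventually_star_eq))).exists
  refine ⟨u, a4, a3, fun b hb => ?_⟩
  have e : u * b * u - b = (u * b - b) * u + (b * u - b) := by
    rw [sub_mul]; abel
  rw [e]
  have := norm_add_le ((u * b - b) * u) (b * u - b)
  have h5 := norm_mul_le (u * b - b) u
  have h6 := a1 b hb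
  have h7 := a2 b hb
  have : ‖u * b - b‖ * ‖u‖ ≤ ε / 2 * 1 := by gcongr
  linarith

theorem sqrt_mem_aux {E : Type*} [CStarAlgebra E] [PartialOrder E] [StarOrderedRing E]
    (M : NonUnitalStarSubalgebra ℂ E) (hM : IsClosed (M : Set E)) (x : E) (hx : 0 ≤ x)
    (hxM : x ∈ M) : ∃ y ∈ M, x = star y * y := by
  refine ⟨CFC.sqrt x, ?_, ?_⟩
  · have : cfcₙ Real.sqrt x ∈ M := cfcₙ_mem (𝕜' := ℂ) Real.sqrt hxM
    rw [CFC.sqrt_eq_real_sqrt x]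
    exact this
  · rw [(IsSelfAdjoint.of_nonneg (CFC.sqrt_nonneg x)).star_eq, CFC.sqrt_mul_sqrt_self x]

theorem sqrt_entries {A : Type*} [CStarAlgebra A] [PartialOrder A] [StarOrderedRing A]
    (S : NonUnitalStarSubalgebra ℂ A) (hS : IsClosed (S : Set A)) (k : ℕ)
    (x : CStarMatrix (Fin k) (Fin k) A) (hx : 0 ≤ x) (hxS : ∀ i j, x i j ∈ S) :
    ∃ y : CStarMatrix (Fin k) (Fin k) A, (∀ i j, y i j ∈ S) ∧ x = star y * y := by
  let M : NonUnitalStarSubalgebra ℂ (CStarMatrix (Fin k) (Fin k) A) :=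
    { carrier := {y | ∀ i j, y i j ∈ S}
      add_mem' := fun ha hb i j => S.add_mem (ha i j) (hb i j)
      zero_mem' := fun i j => S.zero_mem
      mul_mem' := by
        intro a b ha hb i j
        rw [CStarMatrix.mul_apply]
        exact sum_mem fun l _ => S.mul_mem (ha i l) (hb l j)
      smul_mem' := fun c a ha i j => S.smul_mem c (ha i j)
      star_mem' := by
        intro a ha i j
        rw [CStarMatrix.star_apply]
        exact star_mem (ha j i) }
  have hM : IsClosed (M : Set (CStarMatrix (Fin k) (Fin k) A)) := by
    have : (M : Set (CStarMatrix (Fin k) (Fin k) A)) = ⋂ i, ⋂ j, (fun y => y i j) ⁻¹' (S : Set A) := by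
      ext y
      simp only [Set.mem_iInter, Set.mem_preimage]
      exact Iff.rfl
    rw [this]
    refine isClosed_iInter fun i => isClosed_iInter fun j => hS.preimage ?_
    exact (continuous_apply j).comp (continuous_apply (A := fun _ : Fin k => Fin k → A) i)
  obtain ⟨y, hy, e⟩ := sqrt_mem_aux M hM x hx hxS
  exact ⟨y, hy, e⟩

theorem matrix_ext {A H : Type*} [CStarAlgebra A] [NormedAddCommGroup H] [InnerProductSpace ℂ H]
    [CompleteSpace H]
    (S : NonUnitalStarSubalgebra ℂ A) (hS : IsClosed (S : Set A)) (ψ : S →ₗ[ℂ] (H →L[ℂ] H))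
    (hψ : IsCompletelyPositive ψ) (k : ℕ) (e : Fin k → H) (u : A) (huS : u ∈ S) (hu : star u = u) :
    ∃ s : Matrix (Fin k) (Fin k) A →ₗ[ℂ] ℂ,
      (∀ (a : Matrix (Fin k) (Fin k) A) (h : ∀ i j, u * a i j * u ∈ S),
        s a = ∑ i, ∑ j, ⟪e i, ψ ⟨u * a i j * u, h i j⟩ (e j)⟫_ℂ) ∧
      ∀ w : Matrix (Fin k) (Fin k) A, 0 ≤ s (star w * w) := by
  let _ := CStarAlgebra.spectralOrder A
  let _ := CStarAlgebra.spectralOrderedRing A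
  have _ : IsClosed (S : Set A) := hS
  have hstar : ∀ a : S, ψ (star a) = star (ψ a) := fun a => IsCompletelyPositive.map_star' hψ a
  let D : Submodule ℂ (CStarMatrix (Fin k) (Fin k) A) :=
    { carrier := {a | ∀ i j, u * a i j * u ∈ S}
      add_mem' := by
        intro a b ha hb i j
        rw [CStarMatrix.add_apply, mul_add, add_mul]
        exact S.add_mem (ha i j) (hb i j)
      zero_mem' := by
        intro i j; simp
      smul_mem' := by
        intro c a ha i j
        rw [CStarMatrix.smul_apply, mul_smul_comm, smul_mul_assoc]
        exact S.smul_mem c (ha i j) }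
  let F : D →ₗ[ℂ] ℂ :=
    { toFun := fun a => ∑ i, ∑ j, ⟪e i, ψ ⟨u * a.1 i j * u, a.2 i j⟩ (e j)⟫_ℂ
      map_add' := by
        intro a b
        simp only [← Finset.sum_add_distrib, ← inner_add_right, ← add_apply, ← map_add]
        congr! 8
        change u * (a.1 _ _ + b.1 _ _) * u = _
        simp [mul_add, add_mul]
      map_smul' := by
        intro c a
        simp only [RingHom.id_apply, Finset.smul_sum, ← inner_smul_right_eq_smul, ← smul_apply, ← map_smul]
        congr! 8
        change u * (c • a.1 _ _) * u = _
        simp }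
  have hF : ∀ a : D, F a = ∑ i, ∑ j, ⟪e i, ψ ⟨u * a.1 i j * u, a.2 i j⟩ (e j)⟫_ℂ := fun a => rfl
  have key : ∀ (x : CStarMatrix (Fin k) (Fin k) A) (hxS : ∀ i j, x i j ∈ S), 0 ≤ x →
      0 ≤ ∑ i, ∑ j, ⟪e i, ψ ⟨x i j, hxS i j⟩ (e j)⟫_ℂ := by
    intro x hxS hx
    obtain ⟨y, hyS, rfl⟩ := sqrt_entries S hS k x hx hxS
    obtain ⟨z, hz⟩ := hψ k (Matrix.of fun i j => ⟨y i j, hyS i j⟩)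
    have h3 : ∀ i j, ψ ⟨(star y * y) i j, hxS i j⟩ = (star z * z) i j := by
      intro i j
      rw [← congrFun (congrFun hz i) j, Matrix.of_apply]
      congr 1
      apply Subtype.ext
      rw [Matrix.mul_apply, AddSubmonoidClass.coe_finset_sum]
      exact CStarMatrix.mul_apply
    simp only [h3, Matrix.mul_apply, Matrix.star_apply, sum_apply, inner_sum]
    have h4 : ∀ i j l, ⟪e i, (star (z l i) * z l j) (e j)⟫_ℂ = ⟪z l i (e i), z l j (e j)⟫_ℂ := by
      intro i j l
      rw [ContinuousLinearMap.mul_apply, ContinuousLinearMap.star_eq_adjoint,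
        ContinuousLinearMap.adjoint_inner_right]
    simp only [h4]
    rw [Finset.sum_comm_cycle]
    refine Finset.sum_nonneg fun l _ => ?_
    simp only [← inner_sum, ← sum_inner]
    rw [inner_self_eq_norm_sq_to_K]
    have h5 : (0:ℝ) ≤ ‖∑ i, (z l i) (e i)‖ ^ 2 := sq_nonneg _
    convert Complex.zero_le_real.mpr h5 using 1
    simp
  obtain ⟨s, hs1, hs2⟩ := krein_ext D F (by
      intro i j
      rw [CStarMatrix.one_apply]
      split_ifs
      · simpa using S.mul_mem huS huS
      · simp) (by
      intro a
      have hm : star (a : CStarMatrix (Fin k) (Fin k) A) ∈ D := by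
        intro i j
        have := star_mem (S := NonUnitalStarSubalgebra ℂ A) (a.2 j i)
        simpa [hu, mul_assoc, CStarMatrix.star_apply] using this
      refine ⟨hm, ?_⟩
      rw [hF, hF, star_sum, Finset.sum_comm]
      refine Finset.sum_congr rfl fun i _ => ?_
      rw [star_sum]
      refine Finset.sum_congr rfl fun j _ => ?_
      have h3 : (⟨u * (star (a : CStarMatrix (Fin k) (Fin k) A)) j i * u, hm j i⟩ : S) =
          star ⟨u * a.1 i j * u, a.2 i j⟩ := by
        apply Subtype.ext
        simp [hu, mul_assoc, CStarMatrix.star_apply]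
      change ⟪e j, ψ ⟨u * (star (a : CStarMatrix (Fin k) (Fin k) A)) j i * u, hm j i⟩ (e i)⟫_ℂ = _
      rw [h3, hstar, ContinuousLinearMap.star_eq_adjoint, ContinuousLinearMap.adjoint_inner_right]
      exact (inner_conj_symm _ _).symm) (by
      intro a ha
      rw [hF]
      let U : CStarMatrix (Fin k) (Fin k) A := CStarMatrix.ofMatrix (Matrix.diagonal fun _ => u)
      have e1 : ∀ i j, (star U * a.1 * U) i j = u * a.1 i j * u := by
        intro i j
        have : star U = U := by
          ext i j
          rw [CStarMatrix.star_apply]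
          simp only [U, CStarMatrix.ofMatrix_apply, Matrix.diagonal_apply]
          by_cases h : i = j
          · simp [h, hu]
          · simp [h, Ne.symm h]
        rw [this]
        have h9 : ∀ b : Matrix (Fin k) (Fin k) A,
            ((Matrix.diagonal (fun _ => u) * b * Matrix.diagonal (fun _ => u) :
              Matrix (Fin k) (Fin k) A)) i j = u * b i j * u := by
          intro b
          rw [Matrix.mul_diagonal, Matrix.diagonal_mul]
        exact h9 _
      have h2 : 0 ≤ star U * a.1 * U := star_left_conjugate_nonneg ha U
      have h3 := key (star U * a.1 * U) (fun i j => by rw [e1]; exact a.2 i j) h2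
      simp only [e1] at h3
      exact (Complex.le_def.mp h3).1)
  refine ⟨s, fun a h => hs1 ⟨a, h⟩, hs2⟩


theorem cp_ext {A H : Type*} [CStarAlgebra A] [NormedAddCommGroup H] [InnerProductSpace ℂ H]
    [CompleteSpace H]
    (S : NonUnitalStarSubalgebra ℂ A) (hS : IsClosed (S : Set A)) (ψ : S →ₗ[ℂ] (H →L[ℂ] H))
    (hψ : IsCompletelyPositive ψ) (hψ1 : ∀ a : S, ‖ψ a‖ ≤ ‖(a : A)‖)
    (P : H →L[ℂ] H) (hP : ‖P‖ ≤ 1) (k : ℕ) (b e : Fin k → H)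
    (hPe : ∀ x, P x = ∑ p, ⟪b p, x⟫_ℂ • e p) (F : Finset S) (ε : ℝ) (hε : 0 < ε) :
    ∃ Φ : A →ₗ[ℂ] (H →L[ℂ] H), KCP Φ ∧ (∀ x, (⟪x, Φ 1 x⟫_ℂ).re ≤ ‖x‖ ^ 2) ∧
      ∀ c ∈ F, ‖Φ (c : A) - star P * ψ c * P‖ ≤ ε := by
  have _ : IsClosed (S : Set A) := hS
  obtain ⟨⟨u, huS⟩, hu1, hu2, hu3⟩ := approx_unit_aux (A := S) F ε hε
  have hu : star u = u := congrArg Subtype.val hu1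
  have hu2 : ‖u‖ ≤ 1 := hu2
  obtain ⟨s, hs1, hs2⟩ := matrix_ext S hS ψ hψ k e u huS hu
  have hsing : ∀ (c : A) (h : u * c * u ∈ S) p q, s (Matrix.single p q c) =
      ⟪e p, ψ ⟨u * c * u, h⟩ (e q)⟫_ℂ := by
    intro c h p q
    have hm : ∀ i j, u * (Matrix.single p q c) i j * u ∈ S := by
      intro i j
      rw [Matrix.single_apply]
      split_ifs
      · exact h
      · simp
    rw [hs1 _ hm, Finset.sum_eq_single p, Finset.sum_eq_single q]
    · simp
    · intro j _ hj
      have : (⟨u * (Matrix.single p q c) p j * u, hm p j⟩ : S) = 0 := by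
        apply Subtype.ext; simp [Matrix.single_apply, Ne.symm hj]
      rw [this]; simp
    · simp
    · intro i _ hi
      refine Finset.sum_eq_zero fun j _ => ?_
      have : (⟨u * (Matrix.single p q c) i j * u, hm i j⟩ : S) = 0 := by
        apply Subtype.ext; simp [Matrix.single_apply, Ne.symm hi]
      rw [this]; simp
    · simp
  have hrow : ∀ w : Fin k → A, 0 ≤ s (Matrix.of fun p q => star (w p) * w q) := by
    intro w
    cases k with
    | zero => rw [Subsingleton.elim (Matrix.of fun p q => star (w p) * w q) 0]; simp
    | succ k =>
      have h := hs2 (Matrix.of fun l q => if l = 0 then w q else 0)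
      convert h using 2
      ext p q
      simp [Matrix.mul_apply, Matrix.star_apply]
  let Φ : A →ₗ[ℂ] (H →L[ℂ] H) := ∑ p, ∑ q,
    (s ∘ₗ Matrix.singleLinearMap ℂ p q).smulRight (InnerProductSpace.rankOne ℂ (b p) (b q))
  have hΦ : ∀ a x y, ⟪x, Φ a y⟫_ℂ = ∑ p, ∑ q, s (Matrix.single p q a) * (⟪b q, y⟫_ℂ * ⟪x, b p⟫_ℂ) := by
    intro a x y
    simp [Φ, inner_sum, inner_smul_right]
  have hΦ2 : ∀ (c : A) (h : u * c * u ∈ S), Φ c = star P * ψ ⟨u * c * u, h⟩ * P := by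
    intro c h
    ext y
    refine ext_inner_left ℂ fun x => ?_
    rw [hΦ, mul_apply_eq_comp, mul_apply_eq_comp, ContinuousLinearMap.star_eq_adjoint,
        ContinuousLinearMap.adjoint_inner_right, hPe, hPe]
    simp only [map_sum, sum_inner, inner_sum, map_smul, inner_smul_left, inner_smul_right, hsing c h,
      inner_conj_symm, Finset.mul_sum]
    rw [Finset.sum_comm]
    refine Finset.sum_congr rfl fun p _ => Finset.sum_congr rfl fun q _ => ?_
    ring
  have hstarP : ‖star P‖ ≤ 1 := by rwa [norm_star]
  have hPP : ∀ T : H →L[ℂ] H, ‖star P * T * P‖ ≤ ‖T‖ := by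
    intro T
    calc ‖star P * T * P‖ ≤ ‖star P * T‖ * ‖P‖ := norm_mul_le _ _
      _ ≤ (‖star P‖ * ‖T‖) * ‖P‖ := by gcongr; exact norm_mul_le _ _
      _ ≤ (1 * ‖T‖) * 1 := by gcongr
      _ = ‖T‖ := by ring
  refine ⟨Φ, ?_, ?_, ?_⟩
  · intro m a x
    have h := hrow (fun q => ∑ j, ⟪b q, x j⟫_ℂ • a j)
    rw [Matrix.matrix_eq_sum_single (Matrix.of _)] at h
    simp only [Matrix.of_apply, star_sum, star_smul, Finset.sum_mul, Finset.mul_sum, smul_mul_smul_comm] at h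
    have hlin : ∀ p q c, s (Matrix.single p q c) = (s ∘ₗ Matrix.singleLinearMap ℂ p q) c := fun _ _ _ => rfl
    simp only [map_sum, hlin, map_smul] at h
    simp only [hΦ, hlin]
    convert h using 1
    rw [Finset.sum_comm_cycle]
    refine Finset.sum_congr rfl fun p _ => ?_
    rw [Finset.sum_comm_cycle]
    refine Finset.sum_congr rfl fun q _ => ?_
    rw [Finset.sum_comm]
    refine Finset.sum_congr rfl fun j _ => Finset.sum_congr rfl fun i _ => ?_
    have h4 : star ⟪b p, x i⟫_ℂ = ⟪x i, b p⟫_ℂ := inner_conj_symm _ _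
    rw [h4, smul_eq_mul]
    ring
  · intro x
    have h11 : u * 1 * u ∈ S := by simpa using S.mul_mem huS huS
    rw [hΦ2 1 h11, mul_apply_eq_comp, mul_apply_eq_comp, ContinuousLinearMap.star_eq_adjoint,
        ContinuousLinearMap.adjoint_inner_right]
    have h2 : ‖ψ ⟨u * 1 * u, h11⟩‖ ≤ 1 := by
      refine (hψ1 _).trans ?_
      simp only [mul_one]
      exact (norm_mul_le _ _).trans (mul_le_one₀ hu2 (norm_nonneg _) hu2)
    have h3 : ‖P x‖ ≤ ‖x‖ := (P.le_of_opNorm_le hP x).trans (by simp)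
    calc (⟪P x, ψ ⟨u * 1 * u, h11⟩ (P x)⟫_ℂ).re ≤ ‖⟪P x, ψ ⟨u * 1 * u, h11⟩ (P x)⟫_ℂ‖ := Complex.re_le_norm _
      _ ≤ ‖P x‖ * ‖ψ ⟨u * 1 * u, h11⟩ (P x)‖ := norm_inner_le_norm _ _
      _ ≤ ‖P x‖ * (1 * ‖P x‖) := by gcongr; exact ContinuousLinearMap.le_of_opNorm_le _ h2 _
      _ ≤ ‖x‖ * (1 * ‖x‖) := by gcongr
      _ = ‖x‖ ^ 2 := by ring
  · intro c hc
    have h : u * (c : A) * u ∈ S := S.mul_mem (S.mul_mem huS c.2) huS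
    rw [hΦ2 _ h, ← sub_mul, ← mul_sub, ← map_sub]
    exact (hPP _).trans ((hψ1 _).trans (hu3 c hc))


/-- An increasing sequence of finite rank projections converging strongly to one. -/
structure ProjSeq {H : Type*} [NormedAddCommGroup H] [InnerProductSpace ℂ H] [CompleteSpace H]
    (P : ℕ → H →L[ℂ] H) : Prop where
  mul_of_le : ∀ {m n : ℕ}, m ≤ n → P m * P n = P m
  sa : ∀ n, star (P n) = P n
  norm_le : ∀ n, ‖P n‖ ≤ 1
  norm_le' : ∀ n, ‖1 - P n‖ ≤ 1
  tendsto : ∀ x, Filter.Tendsto (fun n => P n x) Filter.atTop (𝓝 x)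
  compact : ∀ n, IsCompactOperator (P n)
  rank : ∀ n, ∃ (k : ℕ) (b e : Fin k → H), ∀ x, P n x = ∑ p, ⟪b p, x⟫_ℂ • e p

theorem exists_projSeq (H : Type*) [NormedAddCommGroup H] [InnerProductSpace ℂ H] [CompleteSpace H]
    [TopologicalSpace.SeparableSpace H] : ∃ P : ℕ → H →L[ℂ] H, ProjSeq P := by
  let V : ℕ → Submodule ℂ H := fun n => Submodule.span ℂ
    (Set.image (TopologicalSpace.denseSeq H) (Set.Iio n))
  have hfd : ∀ n, FiniteDimensional ℂ (V n) := fun n =>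
    FiniteDimensional.span_of_finite ℂ ((Set.finite_Iio n).image _)
  have hmono : Monotone V := fun m n h => Submodule.span_mono
    (Set.image_mono (Set.Iio_subset_Iio h))
  refine ⟨fun n => (V n).starProjection, ?_, ?_, ?_, ?_, ?_, ?_, ?_⟩
  · intro m n h
    exact Submodule.starProjection_comp_starProjection_of_le (hmono h)
  · exact fun n => isSelfAdjoint_starProjection (V n)
  · exact fun n => (V n).starProjection_norm_le
  · intro n
    have : 1 - (V n).starProjection = (V n)ᗮ.starProjection := by
      rw [Submodule.starProjection_orthogonal]; rfl
    rw [this]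
    exact Submodule.starProjection_norm_le _
  · intro x
    refine Submodule.starProjection_tendsto_self V hmono x ?_
    intro y _
    have h1 := TopologicalSpace.denseRange_denseSeq H y
    refine closure_mono ?_ h1
    rintro _ ⟨i, rfl⟩
    refine Submodule.mem_iSup_of_mem (i + 1) (Submodule.subset_span ⟨i, by simp, rfl⟩)
  · intro n
    have hpr : ProperSpace (V n) := FiniteDimensional.proper ℂ (V n)
    have h1 : IsCompactOperator (V n).orthogonalProjectionOnto :=
      isCompactOperator_of_locallyCompactSpace_dom _
    exact h1.clm_comp (V n).subtypeL
  · intro n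
    let β := stdOrthonormalBasis ℂ (V n)
    refine ⟨_, fun i => (β i : H), fun i => (β i : H), fun x => ?_⟩
    have := β.sum_repr' ((V n).orthogonalProjectionOnto x)
    have h2 := congrArg (Subtype.val) this
    change ((V n).orthogonalProjectionOnto x : H) = _
    rw [← h2]
    simp only [Submodule.coe_sum, Submodule.coe_smul]
    refine Finset.sum_congr rfl fun i _ => ?_
    congr 1
    exact Submodule.inner_orthogonalProjectionOnto_eq_of_mem_left (β i) x

namespace ProjSeq
variable {H : Type*} [NormedAddCommGroup H] [InnerProductSpace ℂ H] [CompleteSpace H]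
    {P : ℕ → H →L[ℂ] H}

theorem mul_of_le' (hP : ProjSeq P) {m n : ℕ} (h : m ≤ n) : P n * P m = P m := by
  have := congrArg star (hP.mul_of_le h)
  rwa [star_mul, hP.sa, hP.sa] at this

theorem idem (hP : ProjSeq P) (n : ℕ) : P n * P n = P n := hP.mul_of_le le_rfl

theorem tendsto_compact (hP : ProjSeq P) (K : H →L[ℂ] H) (hK : IsCompactOperator K) (ε : ℝ) (hε : 0 < ε) :
    ∃ N, ∀ n ≥ N, ‖(1 - P n) * K‖ ≤ ε := by
  have hc := IsCompactOperator.isCompact_closure_image_closedBall (f := (K : H →ₗ[ℂ] H)) hK 1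
  have hb := hc.totallyBounded
  rw [Metric.totallyBounded_iff] at hb
  obtain ⟨t, ht, hcov⟩ := hb (ε / 2) (by positivity)
  have h1 : ∀ᶠ n in Filter.atTop, ∀ y ∈ t, ‖(1 - P n) y‖ < ε / 2 := by
    rw [Filter.eventually_all_finite ht]
    intro y _
    have := (hP.tendsto y)
    rw [Metric.tendsto_nhds] at this
    filter_upwards [this (ε / 2) (by positivity)] with n hn
    rw [dist_eq_norm, norm_sub_rev] at hn
    exact hn
  obtain ⟨N, hN⟩ := Filter.eventually_atTop.mp h1
  refine ⟨N, fun n hn => ?_⟩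
  refine ContinuousLinearMap.opNorm_le_of_unit_norm hε.le fun x hx => ?_
  have hmem : K x ∈ ⋃ y ∈ t, Metric.ball y (ε / 2) :=
    hcov (subset_closure ⟨x, by simp [hx], rfl⟩)
  simp only [Set.mem_iUnion, Metric.mem_ball, dist_eq_norm] at hmem
  obtain ⟨y, hy, hxy⟩ := hmem
  have e1 : ((1 - P n) * K) x = (1 - P n) y + (1 - P n) (K x - y) := by
    rw [← map_add]; simp
  rw [e1]
  have h2 := ContinuousLinearMap.le_of_opNorm_le _ (hP.norm_le' n) (K x - y)
  have h3 := hN n hn y hy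
  have h4 := norm_add_le ((1 - P n) y) ((1 - P n) (K x - y))
  linarith

theorem tendsto_corner (hP : ProjSeq P) (m : ℕ) (T : H →L[ℂ] H) (ε : ℝ) (hε : 0 < ε) :
    ∃ N, ∀ n ≥ N, ‖P m * T * (1 - P n)‖ ≤ ε := by
  obtain ⟨N, hN⟩ := hP.tendsto_compact (star T * P m) ((hP.compact m).clm_comp (star T)) ε hε
  refine ⟨N, fun n hn => ?_⟩
  have := hN n hn
  rw [← norm_star] at this
  simpa [hP.sa, mul_assoc] using this

end ProjSeq


section
variable {H : Type*} [NormedAddCommGroup H] [InnerProductSpace ℂ H] [CompleteSpace H]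
    {P : ℕ → H →L[ℂ] H}

/-- Averages of two-sided multiplications. -/
noncomputable def avg (R : ℕ → H →L[ℂ] H) (J : Finset ℕ) : (H →L[ℂ] H) →ₗ[ℂ] (H →L[ℂ] H) :=
  ((J.card : ℂ)⁻¹) • ∑ j ∈ J, (LinearMap.mulLeft ℂ (R j)) ∘ₗ (LinearMap.mulRight ℂ (R j))

theorem avg_apply (R : ℕ → H →L[ℂ] H) (J : Finset ℕ) (X : H →L[ℂ] H) :
    avg R J X = ((J.card : ℂ)⁻¹) • ∑ j ∈ J, R j * X * R j := by
  simp [avg, mul_assoc]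

theorem avg_congr_const (R : ℕ → H →L[ℂ] H) (J : Finset ℕ) (hJ : J.Nonempty) (X Y : H →L[ℂ] H)
    (h : ∀ j ∈ J, R j * X * R j = Y) : avg R J X = Y := by
  rw [avg_apply, Finset.sum_congr rfl h, Finset.sum_const, ← Nat.cast_smul_eq_nsmul ℂ, smul_smul,
    inv_mul_cancel₀, one_smul]
  exact_mod_cast hJ.card_pos.ne'

theorem norm_avg_le_of (R : ℕ → H →L[ℂ] H) (J : Finset ℕ) (X : H →L[ℂ] H) (c : ℝ) (hc : 0 ≤ c)
    (h : ∀ j ∈ J, ‖R j * X * R j‖ ≤ c) : ‖avg R J X‖ ≤ c := by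
  rw [avg_apply, norm_smul, norm_inv, Complex.norm_natCast]
  have h1 : ‖∑ j ∈ J, R j * X * R j‖ ≤ J.card * c := by
    refine (norm_sum_le _ _).trans ((Finset.sum_le_sum h).trans ?_)
    simp
  rcases J.eq_empty_or_nonempty with rfl | hJ
  · simpa using hc
  · have h2 : (0:ℝ) < J.card := by exact_mod_cast hJ.card_pos
    rw [inv_mul_le_iff₀ h2]
    exact h1

theorem norm_mul3_le {a b c : H →L[ℂ] H} (ha : ‖a‖ ≤ 1) (hc : ‖c‖ ≤ 1) : ‖a * b * c‖ ≤ ‖b‖ :=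
  calc ‖a * b * c‖ ≤ ‖a * b‖ * ‖c‖ := norm_mul_le _ _
      _ ≤ (‖a‖ * ‖b‖) * ‖c‖ := by gcongr; exact norm_mul_le _ _
      _ ≤ (1 * ‖b‖) * 1 := by gcongr
      _ = ‖b‖ := by ring

theorem norm_avg_le (R : ℕ → H →L[ℂ] H) (hR : ∀ j, ‖R j‖ ≤ 1) (J : Finset ℕ) (X : H →L[ℂ] H) :
    ‖avg R J X‖ ≤ ‖X‖ :=
  norm_avg_le_of R J X _ (norm_nonneg _) fun j _ => norm_mul3_le (hR j) (hR j)

theorem norm_avg_apply_le_of (R : ℕ → H →L[ℂ] H) (J : Finset ℕ) (X : H →L[ℂ] H) (x : H) (c : ℝ) (hc : 0 ≤ c)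
    (h : ∀ j ∈ J, ‖(R j * X * R j) x‖ ≤ c) : ‖avg R J X x‖ ≤ c := by
  rw [avg_apply, smul_apply, norm_smul, norm_inv, Complex.norm_natCast, sum_apply]
  have h1 : ‖∑ j ∈ J, (R j * X * R j) x‖ ≤ J.card * c := by
    refine (norm_sum_le _ _).trans ((Finset.sum_le_sum h).trans ?_)
    simp
  rcases J.eq_empty_or_nonempty with rfl | hJ
  · simpa using hc
  · have h2 : (0:ℝ) < J.card := by exact_mod_cast hJ.card_pos
    rw [inv_mul_le_iff₀ h2]
    exact h1

theorem KCP.avg_comp {A : Type*} [NonUnitalRing A] [StarRing A] [Module ℂ A]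
    {φ : A →ₗ[ℂ] (H →L[ℂ] H)} (h : KCP φ) (R : ℕ → H →L[ℂ] H) (hR : ∀ j, star (R j) = R j)
    (J : Finset ℕ) : KCP (avg R J ∘ₗ φ) := by
  intro m a x
  have e : ∑ i, ∑ j, ⟪x i, (avg R J ∘ₗ φ) (star (a i) * a j) (x j)⟫_ℂ =
      ((J.card : ℂ)⁻¹) * ∑ l ∈ J, ∑ i, ∑ j, ⟪R l (x i), φ (star (a i) * a j) (R l (x j))⟫_ℂ := by
    simp only [LinearMap.comp_apply, avg_apply, smul_apply, sum_apply, inner_smul_right, inner_sum,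
      mul_apply_eq_comp, ← Finset.mul_sum]
    congr 1
    rw [Finset.sum_comm_cycle]
    refine Finset.sum_congr rfl fun l _ => Finset.sum_congr rfl fun i _ =>
      Finset.sum_congr rfl fun j _ => ?_
    nth_rw 1 [← hR l]
    rw [ContinuousLinearMap.star_eq_adjoint, ContinuousLinearMap.adjoint_inner_right]
  rw [e]
  refine mul_nonneg ?_ (Finset.sum_nonneg fun l _ => h m a _)
  have : (0:ℝ) ≤ (J.card : ℝ)⁻¹ := by positivity
  have h2 := Complex.zero_le_real.mpr this
  simpa using h2

namespace ProjSeq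

theorem sum_sq_le (hP : ProjSeq P) (ν : ℕ → ℕ) (hν : StrictMono ν) (N : ℕ) (x : H) :
    ∑ j ∈ Finset.range N, ‖(P (ν (j + 1)) - P (ν j)) x‖ ^ 2 ≤ ‖x‖ ^ 2 := by
  have hin : ∀ m n, m ≤ n → ⟪P n x, P m x⟫_ℂ = ⟪x, P m x⟫_ℂ := by
    intro m n h
    nth_rw 1 [← hP.sa n]
    rw [ContinuousLinearMap.star_eq_adjoint, ContinuousLinearMap.adjoint_inner_left,
      ← mul_apply_eq_comp, hP.mul_of_le' h]
  have h1 : ∀ j, ‖(P (ν (j + 1)) - P (ν j)) x‖ ^ 2 = ‖P (ν (j + 1)) x‖ ^ 2 - ‖P (ν j) x‖ ^ 2 := by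
    intro j
    rw [sub_apply, norm_sub_sq (𝕜 := ℂ), hin _ _ (hν (Nat.lt_succ_self j)).le, ← hin _ _ le_rfl,
      inner_self_eq_norm_sq]
    ring
  simp only [h1]
  rw [Finset.sum_range_sub (fun j => ‖P (ν j) x‖ ^ 2)]
  have h2 : ‖P (ν N) x‖ ≤ ‖x‖ := by
    simpa using ContinuousLinearMap.le_of_opNorm_le _ (hP.norm_le (ν N)) x
  have : ‖P (ν N) x‖ ^ 2 ≤ ‖x‖ ^ 2 := by gcongr
  linarith [sq_nonneg ‖P (ν 0) x‖]

theorem corner_sum_le (hP : ProjSeq P) (ν : ℕ → ℕ) (hν : StrictMono ν) (N : ℕ) (T : H →L[ℂ] H)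
    (η : ℝ) (hη : 0 ≤ η) (h : ∀ j, ‖P (ν j) * T * (1 - P (ν (j + 1)))‖ ≤ η) :
    ‖∑ j ∈ Finset.range N, P (ν j) * T * (1 - P (ν j))‖ ≤ N * η + ‖T‖ * √N := by
  refine ContinuousLinearMap.opNorm_le_of_unit_norm (by positivity) fun x hx => ?_
  have h1 : ∀ j, ‖(P (ν j) * T * (1 - P (ν j))) x‖ ≤ η + ‖T‖ * ‖(P (ν (j + 1)) - P (ν j)) x‖ := by
    intro j
    have e : P (ν j) * T * (1 - P (ν j)) = P (ν j) * T * (1 - P (ν (j + 1))) +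
      (P (ν j) * T) * (P (ν (j + 1)) - P (ν j)) := by noncomm_ring
    rw [e, add_apply]
    refine (norm_add_le _ _).trans (add_le_add ?_ ?_)
    · simpa [hx] using ContinuousLinearMap.le_of_opNorm_le _ (h j) x
    · rw [mul_apply_eq_comp]
      refine ContinuousLinearMap.le_of_opNorm_le _ ?_ _
      refine (norm_mul_le _ _).trans ?_
      have := mul_le_mul_of_nonneg_right (hP.norm_le (ν j)) (norm_nonneg T)
      simpa using this
  rw [sum_apply]
  refine (norm_sum_le _ _).trans ((Finset.sum_le_sum fun j _ => h1 j).trans ?_)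
  rw [Finset.sum_add_distrib, ← Finset.mul_sum]
  have h2 : ∑ j ∈ Finset.range N, ‖(P (ν (j + 1)) - P (ν j)) x‖ ≤ √N := by
    apply Real.le_sqrt_of_sq_le
    refine sq_sum_le_card_mul_sum_sq.trans ?_
    have := hP.sum_sq_le ν hν N x
    rw [hx] at this
    rw [Finset.card_range]
    have h3 : (0:ℝ) ≤ N := Nat.cast_nonneg _
    nlinarith
  simp only [Finset.sum_const, Finset.card_range, nsmul_eq_mul]
  gcongr

theorem exists_subseq (hP : ProjSeq P) (𝒯 : Finset (H →L[ℂ] H)) (n0 : ℕ) (η : ℝ) (hη : 0 < η) :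
    ∃ ν : ℕ → ℕ, StrictMono ν ∧ n0 ≤ ν 0 ∧
      ∀ T ∈ 𝒯, ∀ j, ‖P (ν j) * T * (1 - P (ν (j + 1)))‖ ≤ η := by
  have h1 : ∀ m, ∃ n, m < n ∧ ∀ T ∈ 𝒯, ‖P m * T * (1 - P n)‖ ≤ η := by
    intro m
    have : ∀ᶠ n in Filter.atTop, ∀ T ∈ 𝒯, ‖P m * T * (1 - P n)‖ ≤ η := by
      rw [Filter.eventually_all_finset]
      intro T _
      obtain ⟨N, hN⟩ := hP.tendsto_corner m T η hη
      exact Filter.eventually_atTop.mpr ⟨N, hN⟩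
    obtain ⟨n, h2, h3⟩ := (this.and (Filter.eventually_gt_atTop m)).exists
    exact ⟨n, h3, h2⟩
  choose f hf1 hf2 using h1
  refine ⟨fun j => f^[j] n0, strictMono_nat_of_lt_succ fun j => ?_, le_rfl, fun T hT j => ?_⟩
  · rw [Function.iterate_succ_apply']; exact hf1 _
  · simp only [Function.iterate_succ_apply']; exact hf2 _ T hT

theorem exists_avg (hP : ProjSeq P) (𝒯 : Finset (H →L[ℂ] H)) (n0 : ℕ) (ε : ℝ) (hε : 0 < ε) :
    ∃ J : Finset ℕ, J.Nonempty ∧ (∀ j ∈ J, n0 ≤ j) ∧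
      ∀ T ∈ 𝒯, ‖avg P J T + avg (fun j => 1 - P j) J T - T‖ ≤ ε := by
  classical
  obtain ⟨ν, hν, hν0, hνT⟩ := hP.exists_subseq (𝒯 ∪ 𝒯.image star) n0 (ε / 4) (by positivity)
  let C : ℝ := ∑ T ∈ 𝒯, ‖T‖
  have hC : ∀ T ∈ 𝒯, ‖T‖ ≤ C := fun T hT =>
    Finset.single_le_sum (f := fun T : H →L[ℂ] H => ‖T‖) (fun _ _ => norm_nonneg _) hT
  have hC0 : 0 ≤ C := Finset.sum_nonneg fun _ _ => norm_nonneg _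
  obtain ⟨N, hN⟩ := exists_nat_gt ((4 * C / ε) ^ 2)
  have hNpos : (0:ℝ) < N := lt_of_le_of_lt (sq_nonneg _) hN
  have hN1 : 0 < N := by exact_mod_cast hNpos
  have hN2 : 4 * C / ε ≤ √N := Real.le_sqrt_of_sq_le hN.le
  have hN3 : C * √N ≤ ε / 4 * N := by
    have h4 : C ≤ ε / 4 * √N := by
      rw [div_le_iff₀ hε] at hN2
      linarith
    calc C * √N ≤ (ε / 4 * √N) * √N := by gcongr
      _ = ε / 4 * N := by rw [mul_assoc, Real.mul_self_sqrt hNpos.le]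
  refine ⟨(Finset.range N).map ⟨ν, hν.injective⟩, ?_, ?_, ?_⟩
  · simpa using hN1.ne'
  · intro j hj
    simp only [Finset.mem_map, Function.Embedding.coeFn_mk] at hj
    obtain ⟨i, _, rfl⟩ := hj
    exact hν0.trans (hν.monotone (Nat.zero_le i))
  · intro T hT
    have a1 := hP.corner_sum_le ν hν N T (ε / 4) (by positivity)
      (hνT T (Finset.mem_union_left _ hT))
    have a2 := hP.corner_sum_le ν hν N (star T) (ε / 4) (by positivity)
      (hνT (star T) (Finset.mem_union_right _ (Finset.mem_image_of_mem _ hT)))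
    rw [← norm_star, star_sum] at a2
    rw [norm_star] at a2
    simp only [star_mul, star_star, star_sub, star_one, hP.sa] at a2
    have hNC : (N : ℂ) ≠ 0 := by exact_mod_cast hN1.ne'
    have e : avg P ((Finset.range N).map ⟨ν, hν.injective⟩) T +
        avg (fun j => 1 - P j) ((Finset.range N).map ⟨ν, hν.injective⟩) T - T =
        -((N : ℂ)⁻¹ • (∑ j ∈ Finset.range N, P (ν j) * T * (1 - P (ν j)) +
          ∑ j ∈ Finset.range N, (1 - P (ν j)) * (T * P (ν j)))) := by
      have h5 : T = (N : ℂ)⁻¹ • ∑ j ∈ Finset.range N, T := by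
        rw [Finset.sum_const, Finset.card_range, ← Nat.cast_smul_eq_nsmul ℂ, smul_smul,
          inv_mul_cancel₀ hNC, one_smul]
      conv_lhs => arg 2; rw [h5]
      simp only [avg_apply, Finset.sum_map, Finset.card_map, Finset.card_range, Function.Embedding.coeFn_mk]
      rw [← smul_add, ← smul_sub, ← smul_neg, ← Finset.sum_add_distrib, ← Finset.sum_sub_distrib,
        ← Finset.sum_add_distrib, ← Finset.sum_neg_distrib]
      congr 1
      refine Finset.sum_congr rfl fun j _ => ?_
      noncomm_ring
    rw [e, norm_neg, norm_smul, norm_inv, Complex.norm_natCast, inv_mul_le_iff₀ hNpos]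
    refine (norm_add_le _ _).trans ?_
    have h6 : ‖T‖ * √N ≤ C * √N := by gcongr; exact hC T hT
    linarith

theorem avg_one (hP : ProjSeq P) (J : Finset ℕ) (hJ : J.Nonempty) :
    avg P J 1 + avg (fun j => 1 - P j) J 1 = 1 := by
  rw [avg_apply, avg_apply, ← smul_add, ← Finset.sum_add_distrib]
  have : ∀ j ∈ J, P j * 1 * P j + (1 - P j) * 1 * (1 - P j) = 1 := by
    intro j _
    have h := hP.idem j
    have : P j * 1 * P j + (1 - P j) * 1 * (1 - P j) = P j * P j + (1 - P j - P j + P j * P j) := by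
      noncomm_ring
    rw [this, h]
    abel
  rw [Finset.sum_congr rfl this, Finset.sum_const, ← Nat.cast_smul_eq_nsmul ℂ, smul_smul,
    inv_mul_cancel₀, one_smul]
  exact_mod_cast hJ.card_pos.ne'

theorem avg_avg (hP : ProjSeq P) (J J' : Finset ℕ) (hJ : J.Nonempty)
    (h : ∀ j ∈ J, ∀ j' ∈ J', j ≤ j') (X : H →L[ℂ] H) :
    avg (fun j => 1 - P j) J (avg (fun j => 1 - P j) J' X) = avg (fun j => 1 - P j) J' X := by
  refine avg_congr_const _ J hJ _ _ fun j hj => ?_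
  rw [avg_apply, mul_smul_comm, smul_mul_assoc, Finset.mul_sum, Finset.sum_mul]
  congr 1
  refine Finset.sum_congr rfl fun l hl => ?_
  have e1 : (1 - P j) * (1 - P l) = 1 - P l := by
    have : (1 - P j) * (1 - P l) = 1 - P j - P l + P j * P l := by noncomm_ring
    rw [this, hP.mul_of_le (h j hj l hl)]; abel
  have e2 : (1 - P l) * (1 - P j) = 1 - P l := by
    have : (1 - P l) * (1 - P j) = 1 - P j - P l + P l * P j := by noncomm_ring
    rw [this, hP.mul_of_le' (h j hj l hl)]; abel
  calc (1 - P j) * ((1 - P l) * X * (1 - P l)) * (1 - P j)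
      = ((1 - P j) * (1 - P l)) * X * ((1 - P l) * (1 - P j)) := by simp only [mul_assoc]
    _ = _ := by rw [e1, e2]

theorem avg_tendsto (hP : ProjSeq P) (X : H →L[ℂ] H) (J : ℕ → Finset ℕ) (hJ : ∀ n, ∀ j ∈ J n, n ≤ j) (x : H) :
    Filter.Tendsto (fun n => avg (fun j => 1 - P j) (J n) X x) Filter.atTop (𝓝 0) := by
  rw [Metric.tendsto_nhds]
  intro ε hε
  have h1 := hP.tendsto x
  rw [Metric.tendsto_nhds] at h1
  obtain ⟨N, hN⟩ := Filter.eventually_atTop.mp (h1 (ε / (2 * (‖X‖ + 1))) (by positivity))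
  refine Filter.eventually_atTop.mpr ⟨N, fun n hn => ?_⟩
  rw [dist_zero_right]
  refine lt_of_le_of_lt (norm_avg_apply_le_of _ _ _ _ (ε / 2) (by positivity) fun j hj => ?_)
    (by linarith)
  have h2 := hN j (hn.trans (hJ n j hj))
  rw [dist_eq_norm, norm_sub_rev] at h2
  have h3 : ‖(1 - P j) * X‖ ≤ ‖X‖ := by
    refine (norm_mul_le _ _).trans ?_
    have := mul_le_mul_of_nonneg_right (hP.norm_le' j) (norm_nonneg X)
    simpa using this
  rw [mul_apply_eq_comp]
  refine (ContinuousLinearMap.le_of_opNorm_le _ h3 _).trans ?_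
  have h4 : ‖(1 - P j) x‖ ≤ ε / (2 * (‖X‖ + 1)) := h2.le
  calc ‖X‖ * ‖(1 - P j) x‖ ≤ (‖X‖ + 1) * (ε / (2 * (‖X‖ + 1))) := by gcongr; linarith
    _ = ε / 2 := by field_simp

end ProjSeq
end


theorem exists_limit {A H : Type*} [CStarAlgebra A] [NormedAddCommGroup H] [InnerProductSpace ℂ H]
    [CompleteSpace H] (φ : ℕ → A →ₗ[ℂ] (H →L[ℂ] H)) (hk : ∀ N, KCP (φ N))
    (hn : ∀ N a, ‖φ N a‖ ≤ ‖a‖) :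
    ∃ ψ : A →ₗ[ℂ] (H →L[ℂ] H), KCP ψ ∧ (∀ a, ‖ψ a‖ ≤ ‖a‖) ∧
      ∀ a (Y : H →L[ℂ] H), (∀ x y, Filter.Tendsto (fun N => ⟪x, φ N a y⟫_ℂ) Filter.atTop
        (𝓝 ⟪x, Y y⟫_ℂ)) → ψ a = Y := by
  let U : Filter ℕ := (Filter.hyperfilter ℕ : Filter ℕ)
  have hb : ∀ N a x y, ‖⟪x, φ N a y⟫_ℂ‖ ≤ ‖a‖ * ‖x‖ * ‖y‖ := by
    intro N a x y
    refine (norm_inner_le_norm _ _).trans ?_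
    have := ContinuousLinearMap.le_of_opNorm_le _ (hn N a) y
    calc ‖x‖ * ‖φ N a y‖ ≤ ‖x‖ * (‖a‖ * ‖y‖) := by gcongr
      _ = _ := by ring
  have hex : ∀ a x y, ∃ l : ℂ, Filter.Tendsto (fun N => ⟪x, φ N a y⟫_ℂ) U (𝓝 l) := by
    intro a x y
    have hc := isCompact_closedBall (0 : ℂ) (‖a‖ * ‖x‖ * ‖y‖)
    obtain ⟨l, _, hl⟩ := hc.ultrafilter_le_nhds ((Filter.hyperfilter ℕ).map (fun N => ⟪x, φ N a y⟫_ℂ)) (by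
      rw [Filter.le_principal_iff]
      refine Filter.mem_map.mpr (Filter.univ_mem' fun N => ?_)
      simpa using hb N a x y)
    exact ⟨l, hl⟩
  choose L hL using hex
  have hLb : ∀ a x y, ‖L a x y‖ ≤ ‖a‖ * ‖x‖ * ‖y‖ := fun a x y =>
    le_of_tendsto (hL a x y).norm (Filter.univ_mem' fun N => hb N a x y)
  have hT : ∀ a, ∃ T : H →L[ℂ] H, ∀ x y, ⟪x, T y⟫_ℂ = L a x y := by
    intro a
    let B := LinearMap.mk₂'ₛₗ (starRingEnd ℂ) (RingHom.id ℂ) (L a) (by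
        intro x x' y
        refine tendsto_nhds_unique (hL a _ y) ?_
        simpa [inner_add_left] using (hL a x y).add (hL a x' y)) (by
        intro c x y
        refine tendsto_nhds_unique (hL a _ y) ?_
        simpa [inner_smul_left, mul_comm] using (hL a x y).const_mul (starRingEnd ℂ c)) (by
        intro x y y'
        refine tendsto_nhds_unique (hL a x _) ?_
        simpa [inner_add_right] using (hL a x y).add (hL a x y')) (by
        intro c x y
        refine tendsto_nhds_unique (hL a x _) ?_
        simpa [inner_smul_right] using (hL a x y).const_mul c)
    let B' := B.mkContinuous₂ ‖a‖ (fun x y => hLb a x y)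
    refine ⟨ContinuousLinearMap.adjoint (InnerProductSpace.continuousLinearMapOfBilin B'), fun x y => ?_⟩
    rw [ContinuousLinearMap.adjoint_inner_right, InnerProductSpace.continuousLinearMapOfBilin_apply]
    rfl
  choose T hT using hT
  have hTt : ∀ a x y, Filter.Tendsto (fun N => ⟪x, φ N a y⟫_ℂ) U (𝓝 ⟪x, T a y⟫_ℂ) := by
    intro a x y; rw [hT]; exact hL a x y
  let ψ : A →ₗ[ℂ] (H →L[ℂ] H) :=
    { toFun := T
      map_add' := by
        intro a b
        ext y
        refine ext_inner_left ℂ fun x => ?_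
        refine tendsto_nhds_unique (hTt (a + b) x y) ?_
        simpa [inner_add_right] using (hTt a x y).add (hTt b x y)
      map_smul' := by
        intro c a
        ext y
        refine ext_inner_left ℂ fun x => ?_
        refine tendsto_nhds_unique (hTt (c • a) x y) ?_
        simpa [inner_smul_right] using (hTt a x y).const_mul c }
  refine ⟨ψ, ?_, ?_, ?_⟩
  · intro m a x
    have h1 : Filter.Tendsto (fun N => ∑ i, ∑ j, ⟪x i, φ N (star (a i) * a j) (x j)⟫_ℂ) U
      (𝓝 (∑ i, ∑ j, ⟪x i, ψ (star (a i) * a j) (x j)⟫_ℂ)) :=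
      tendsto_finset_sum _ fun i _ => tendsto_finset_sum _ fun j _ => hTt _ _ _
    exact ge_of_tendsto h1 (Filter.univ_mem' fun N => hk N m a x)
  · intro a
    refine ContinuousLinearMap.opNorm_le_bound _ (norm_nonneg _) fun y => ?_
    change ‖T a y‖ ≤ _
    have h1 := hLb a (T a y) y
    rw [← hT, inner_self_eq_norm_sq_to_K] at h1
    rw [norm_pow] at h1
    simp at h1
    rcases (norm_nonneg (T a y)).eq_or_lt with h0 | h0
    · rw [← h0]; positivity
    · nlinarith
  · intro a Y hY
    change T a = Y
    ext y
    refine ext_inner_left ℂ fun x => ?_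
    exact tendsto_nhds_unique (hTt a x y) ((hY x y).mono_left Nat.hyperfilter_le_atTop)


theorem exists_chain (Pr : ℕ → Finset ℕ → Prop)
    (h : ∀ n b, ∃ J : Finset ℕ, J.Nonempty ∧ (∀ j ∈ J, b ≤ j) ∧ Pr n J) :
    ∃ J : ℕ → Finset ℕ, (∀ n, (J n).Nonempty) ∧ (∀ n, ∀ j ∈ J n, n ≤ j) ∧
      (∀ n, ∀ j ∈ J n, ∀ j' ∈ J (n + 1), j ≤ j') ∧ ∀ n, Pr n (J n) := by
  choose f h1 h2 h3 using h
  let J : ℕ → Finset ℕ := fun n =>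
    Nat.rec (f 0 0) (fun n Jn => f (n + 1) (max (n + 1) (Jn.sup id))) n
  have hs : ∀ n, J (n + 1) = f (n + 1) (max (n + 1) ((J n).sup id)) := fun n => rfl
  have hf : ∀ n, ∃ b, n ≤ b ∧ J n = f n b := by
    intro n
    cases n with
    | zero => exact ⟨0, le_rfl, rfl⟩
    | succ n => exact ⟨_, le_max_left _ _, hs n⟩
  refine ⟨J, ?_, ?_, ?_, ?_⟩
  · intro n; obtain ⟨b, _, hb⟩ := hf n; rw [hb]; exact h1 _ _
  · intro n j hj
    obtain ⟨b, hnb, hb⟩ := hf n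
    rw [hb] at hj
    exact hnb.trans (h2 _ _ j hj)
  · intro n j hj j' hj'
    rw [hs] at hj'
    exact (Finset.le_sup (f := id) hj).trans ((le_max_right _ _).trans (h2 _ _ j' hj'))
  · intro n; obtain ⟨b, _, hb⟩ := hf n; rw [hb]; exact h3 _ _

section
variable {H : Type*} [NormedAddCommGroup H] [InnerProductSpace ℂ H] [CompleteSpace H]
    {P : ℕ → H →L[ℂ] H}

theorem KCP.sum {A : Type*} [NonUnitalRing A] [StarRing A] [Module ℂ A] {ι : Type*} (s : Finset ι)
    (φ : ι → A →ₗ[ℂ] (H →L[ℂ] H)) (h : ∀ i ∈ s, KCP (φ i)) : KCP (∑ i ∈ s, φ i) := by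
  intro m a x
  simp only [LinearMap.sum_apply, sum_apply, inner_sum]
  rw [Finset.sum_comm_cycle]
  exact Finset.sum_nonneg fun i hi => h i hi m a x

theorem avg_mono (R : ℕ → H →L[ℂ] H) (hR : ∀ j, star (R j) = R j) (J : Finset ℕ) (X Y : H →L[ℂ] H)
    (h : ∀ x, (⟪x, X x⟫_ℂ).re ≤ (⟪x, Y x⟫_ℂ).re) (x : H) :
    (⟪x, avg R J X x⟫_ℂ).re ≤ (⟪x, avg R J Y x⟫_ℂ).re := by
  have key : ∀ Z : H →L[ℂ] H, (⟪x, avg R J Z x⟫_ℂ).re = (J.card : ℝ)⁻¹ * ∑ j ∈ J, (⟪R j x, Z (R j x)⟫_ℂ).re := by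
    intro Z
    have : ⟪x, avg R J Z x⟫_ℂ = (((J.card : ℝ)⁻¹ : ℝ) : ℂ) * ∑ j ∈ J, ⟪R j x, Z (R j x)⟫_ℂ := by
      rw [avg_apply, smul_apply, sum_apply, inner_smul_right, inner_sum]
      push_cast
      congr 1
      refine Finset.sum_congr rfl fun j _ => ?_
      change ⟪x, R j (Z (R j x))⟫_ℂ = _
      nth_rw 1 [← hR j]
      rw [ContinuousLinearMap.star_eq_adjoint, ContinuousLinearMap.adjoint_inner_right]
    rw [this, Complex.re_ofReal_mul, Complex.re_sum]
  rw [key, key]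
  exact mul_le_mul_of_nonneg_left (Finset.sum_le_sum fun j _ => h _) (by positivity)

namespace ProjSeq

theorem conj_avg (hP : ProjSeq P) (J : Finset ℕ) (j : ℕ) (h : ∀ l ∈ J, j ≤ l) (K : H →L[ℂ] H) :
    (1 - P j) * avg P J K * (1 - P j) = avg P J ((1 - P j) * K * (1 - P j)) := by
  rw [avg_apply, avg_apply, mul_smul_comm, smul_mul_assoc, Finset.mul_sum, Finset.sum_mul]
  congr 1
  refine Finset.sum_congr rfl fun l hl => ?_
  have e1 : (1 - P j) * P l = P l * (1 - P j) := by
    rw [sub_mul, mul_sub, one_mul, mul_one, hP.mul_of_le (h l hl), hP.mul_of_le' (h l hl)]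
  calc (1 - P j) * (P l * K * P l) * (1 - P j) = ((1 - P j) * P l) * K * (P l * (1 - P j)) := by
        simp only [mul_assoc]
    _ = (P l * (1 - P j)) * K * ((1 - P j) * P l) := by rw [e1]
    _ = _ := by simp only [mul_assoc]

theorem avg_compress (hP : ProjSeq P) (J : Finset ℕ) (t : ℕ) (h : ∀ l ∈ J, l ≤ t) (X : H →L[ℂ] H) :
    avg P J (P t * X * P t) = avg P J X := by
  rw [avg_apply, avg_apply]
  congr 1
  refine Finset.sum_congr rfl fun l hl => ?_
  calc P l * (P t * X * P t) * P l = (P l * P t) * X * (P t * P l) := by simp only [mul_assoc]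
    _ = _ := by rw [hP.mul_of_le (h l hl), hP.mul_of_le' (h l hl)]

theorem norm_avg_avg_le (hP : ProjSeq P) (J J' : Finset ℕ) (h : ∀ j ∈ J, ∀ l ∈ J', j ≤ l)
    (K : H →L[ℂ] H) (ε : ℝ) (hε : 0 ≤ ε) (hK : ∀ j ∈ J, ‖(1 - P j) * K‖ ≤ ε) :
    ‖avg (fun j => 1 - P j) J (avg P J' K)‖ ≤ ε := by
  refine norm_avg_le_of _ _ _ _ hε fun j hj => ?_
  rw [hP.conj_avg J' j (h j hj) K]
  refine (norm_avg_le P hP.norm_le J' _).trans ?_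
  refine (norm_mul_le _ _).trans ?_
  have := mul_le_mul (hK j hj) (hP.norm_le' j) (norm_nonneg _) hε
  simpa using this

end ProjSeq

theorem map_avg_zero {Q : Type*} [CStarAlgebra Q] (π : (H →L[ℂ] H) →⋆ₐ[ℂ] Q) (R : ℕ → H →L[ℂ] H)
    (hR : ∀ j, π (R j) = 0) (J : Finset ℕ) (X : H →L[ℂ] H) : π (avg R J X) = 0 := by
  rw [avg_apply, map_smul, map_sum]
  simp [hR]

theorem map_avg_one {Q : Type*} [CStarAlgebra Q] (π : (H →L[ℂ] H) →⋆ₐ[ℂ] Q) (R : ℕ → H →L[ℂ] H)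
    (hR : ∀ j, π (R j) = 1) (J : Finset ℕ) (hJ : J.Nonempty) (X : H →L[ℂ] H) : π (avg R J X) = π X := by
  rw [avg_apply, map_smul, map_sum]
  simp only [map_mul, hR, one_mul, mul_one]
  rw [Finset.sum_const, ← Nat.cast_smul_eq_nsmul ℂ, smul_smul,
    inv_mul_cancel₀, one_smul]
  exact_mod_cast hJ.card_pos.ne'

end


section
variable {H : Type*} [NormedAddCommGroup H] [InnerProductSpace ℂ H] [CompleteSpace H]
    {P : ℕ → H →L[ℂ] H}

theorem star_hom_continuous {Q : Type*} [CStarAlgebra Q] (π : (H →L[ℂ] H) →⋆ₐ[ℂ] Q) :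
    Continuous π := by
  exact AddMonoidHomClass.continuous_of_bound π 1 (fun x => by
    rw [one_mul]; exact NonUnitalStarAlgHom.norm_apply_le (A := H →L[ℂ] H) (B := Q) π x)

theorem telescope_limit {Q : Type*} [CStarAlgebra Q] (π : (H →L[ℂ] H) →⋆ₐ[ℂ] Q)
    (g B : ℕ → H →L[ℂ] H) (q : Q) (n0 : ℕ) (hg : ∀ n, π (g n) = 0) (hB : ∀ n, π (B n) = q)
    (hBt : ∀ x, Filter.Tendsto (fun n => B n x) Filter.atTop (𝓝 0))
    (he : ∀ n ≥ n0, ‖g n - (B n - B (n + 1))‖ ≤ 3 * (1 / 2) ^ n) :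
    ∃ Y : H →L[ℂ] H, π Y = q ∧ ∀ x y, Filter.Tendsto
      (fun N => ⟪x, (∑ n ∈ Finset.range N, g n) y⟫_ℂ) Filter.atTop (𝓝 ⟪x, Y y⟫_ℂ) := by
  let err : ℕ → H →L[ℂ] H := fun k => g (n0 + k) - (B (n0 + k) - B (n0 + k + 1))
  have hs : Summable err := by
    refine Summable.of_norm_bounded (g := fun k : ℕ => 3 * (1 / 2 : ℝ) ^ k)
      ((summable_geometric_of_lt_one (by norm_num) (by norm_num)).mul_left _) fun k => ?_
    refine (he (n0 + k) (by omega)).trans ?_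
    have : (1 / 2 : ℝ) ^ (n0 + k) ≤ (1 / 2) ^ k :=
      pow_le_pow_of_le_one (by norm_num) (by norm_num) (by omega)
    linarith
  have hpe : ∀ k, π (err k) = 0 := by
    intro k
    simp only [err, map_sub, hg, hB, sub_self]
  have hps : π (∑' k, err k) = 0 := by
    have h1 := hs.hasSum.map π (star_hom_continuous π)
    have h2 : (π ∘ err) = fun _ => 0 := by ext k; exact hpe k
    rw [h2] at h1
    exact h1.unique hasSum_zero
  refine ⟨(∑ n ∈ Finset.range n0, g n) + B n0 + ∑' k, err k, ?_, ?_⟩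
  · rw [map_add, map_add, map_sum, hps, hB]
    simp [hg]
  · intro x y
    rw [← Filter.tendsto_add_atTop_iff_nat n0]
    have key : ∀ M, (∑ n ∈ Finset.range (M + n0), g n) =
        (∑ n ∈ Finset.range n0, g n) + B n0 + ∑ k ∈ Finset.range M, err k - B (M + n0) := by
      intro M
      induction M with
      | zero => simp
      | succ M ih =>
        have e : M + 1 + n0 = (M + n0) + 1 := by omega
        rw [e, Finset.sum_range_succ, ih, Finset.sum_range_succ]
        simp only [err]
        rw [add_comm n0 M]
        abel
    have h1 : Filter.Tendsto (fun M => (∑ k ∈ Finset.range M, err k) y) Filter.atTop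
        (𝓝 ((∑' k, err k) y)) :=
      ((ContinuousLinearMap.apply ℂ H y).continuous.tendsto _).comp hs.hasSum.tendsto_sum_nat
    have h2 : Filter.Tendsto (fun M => B (M + n0) y) Filter.atTop (𝓝 0) :=
      (Filter.tendsto_add_atTop_iff_nat n0).mpr (hBt y)
    have h3 := ((tendsto_const_nhds (x := ((∑ n ∈ Finset.range n0, g n) + B n0) y)).add h1).sub h2
    rw [sub_zero] at h3
    have h4 := (tendsto_const_nhds (x := x)).inner (𝕜 := ℂ) h3
    refine h4.congr fun M => ?_
    rw [key]
    rfl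

theorem ProjSeq.split (hP : ProjSeq P) (J J' : Finset ℕ) (hJ : J.Nonempty)
    (h : ∀ j ∈ J, ∀ j' ∈ J', j ≤ j') (X : H →L[ℂ] H) :
    avg (fun j => 1 - P j) J (avg P J' X) = avg (fun j => 1 - P j) J X - avg (fun j => 1 - P j) J' X
      + avg (fun j => 1 - P j) J (avg P J' X + avg (fun j => 1 - P j) J' X - X) := by
  rw [map_sub, map_add, hP.avg_avg J J' hJ h]
  abel

theorem ProjSeq.sa' (hP : ProjSeq P) (n : ℕ) : star (1 - P n) = 1 - P n := by
  rw [star_sub, star_one, hP.sa]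

theorem ProjSeq.partial_bound (hP : ProjSeq P) {A : Type*} [CStarAlgebra A]
    (J : ℕ → Finset ℕ) (hJ : ∀ n, (J n).Nonempty)
    (hJJ : ∀ n, ∀ j ∈ J n, ∀ j' ∈ J (n + 1), j ≤ j')
    (Φ : ℕ → A →ₗ[ℂ] (H →L[ℂ] H)) (hΦ : ∀ n, KCP (Φ n))
    (hΦ1 : ∀ n x, (⟪x, Φ n 1 x⟫_ℂ).re ≤ ‖x‖ ^ 2) (N : ℕ) :
    KCP (∑ n ∈ Finset.range N, avg (fun j => 1 - P j) (J n) ∘ₗ (avg P (J (n + 1)) ∘ₗ Φ n)) ∧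
    ∀ a, ‖(∑ n ∈ Finset.range N, avg (fun j => 1 - P j) (J n) ∘ₗ (avg P (J (n + 1)) ∘ₗ Φ n)) a‖ ≤ ‖a‖ := by
  have hk : KCP (∑ n ∈ Finset.range N, avg (fun j => 1 - P j) (J n) ∘ₗ (avg P (J (n + 1)) ∘ₗ Φ n)) :=
    KCP.sum _ _ fun n _ => ((hΦ n).avg_comp P hP.sa _).avg_comp _ hP.sa' _
  refine ⟨hk, hk.norm_le fun x => ?_⟩
  have hx : ∀ x : H, (⟪x, (1 : H →L[ℂ] H) x⟫_ℂ).re = ‖x‖ ^ 2 := by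
    intro x
    rw [ContinuousLinearMap.one_apply]
    exact inner_self_eq_norm_sq (𝕜 := ℂ) x
  have h1 : ∀ n, (⟪x, (avg (fun j => 1 - P j) (J n) ∘ₗ (avg P (J (n + 1)) ∘ₗ Φ n)) 1 x⟫_ℂ).re ≤
      (⟪x, avg (fun j => 1 - P j) (J n) 1 x⟫_ℂ).re - (⟪x, avg (fun j => 1 - P j) (J (n + 1)) 1 x⟫_ℂ).re := by
    intro n
    have h2 := avg_mono (fun j => 1 - P j) hP.sa' (J n) _ _
      (avg_mono P hP.sa (J (n + 1)) (Φ n 1) 1 (fun y => (hΦ1 n y).trans (hx y).ge)) x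
    rw [hP.split (J n) (J (n + 1)) (hJ n) (hJJ n) 1, hP.avg_one _ (hJ _), sub_self, map_zero, add_zero,
      sub_apply, inner_sub_right, Complex.sub_re] at h2
    exact h2
  rw [LinearMap.sum_apply, sum_apply, inner_sum, Complex.re_sum]
  refine (Finset.sum_le_sum fun n _ => h1 n).trans ?_
  rw [Finset.sum_range_sub']
  have h3 : 0 ≤ (⟪x, avg (fun j => 1 - P j) (J N) 1 x⟫_ℂ).re := by
    have := avg_mono (fun j => 1 - P j) hP.sa' (J N) 0 1 (fun y => by
      rw [hx]; simp; ) x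
    simpa using this
  have h4 : (⟪x, avg (fun j => 1 - P j) (J 0) 1 x⟫_ℂ).re ≤ ‖x‖ ^ 2 := by
    refine (Complex.re_le_norm _).trans ((norm_inner_le_norm _ _).trans ?_)
    have h5 := (avg (fun j => 1 - P j) (J 0) 1).le_opNorm x
    have h6 : ‖avg (fun j => 1 - P j) (J 0) 1‖ ≤ 1 :=
      (norm_avg_le _ hP.norm_le' _ _).trans ContinuousLinearMap.norm_id_le
    have h7 : ‖avg (fun j => 1 - P j) (J 0) 1 x‖ ≤ ‖x‖ :=
      h5.trans (mul_le_of_le_one_left (norm_nonneg _) h6)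
    rw [sq]
    exact mul_le_mul_of_nonneg_left h7 (norm_nonneg _)
  linarith

theorem exists_dense_seq_mem {A : Type*} [CStarAlgebra A] [TopologicalSpace.SeparableSpace A]
    (S : ℕ → NonUnitalStarSubalgebra ℂ A) (hdense : Dense (⋃ n, (S n : Set A))) :
    ∃ (a : ℕ → A) (m : ℕ → ℕ), DenseRange a ∧ ∀ i, a i ∈ S (m i) := by
  have := UniformSpace.secondCountable_of_separable A
  obtain ⟨t, hts, htc, htd⟩ := hdense.exists_countable_dense_subset
  obtain ⟨a, ha⟩ := htc.exists_eq_range htd.nonempty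
  have hm : ∀ i, ∃ n, a i ∈ S n := by
    intro i
    have : a i ∈ ⋃ n, (S n : Set A) := hts (ha ▸ Set.mem_range_self i)
    simpa using this
  choose m hm using hm
  exact ⟨a, m, by rw [DenseRange, ← ha]; exact htd, hm⟩
end


theorem main_aux
    (H : Type) [NormedAddCommGroup H] [InnerProductSpace ℂ H] [CompleteSpace H]
    [TopologicalSpace.SeparableSpace H]
    (Q : Type) [CStarAlgebra Q] (π : (H →L[ℂ] H) →⋆ₐ[ℂ] Q)
    (hker : ∀ T : H →L[ℂ] H, π T = 0 ↔ IsCompactOperator T)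
    (A : Type) [CStarAlgebra A] [TopologicalSpace.SeparableSpace A]
    (S : ℕ → NonUnitalStarSubalgebra ℂ A) (hmono : Monotone S)
    (hclosed : ∀ n, IsClosed (S n : Set A))
    (hdense : Dense (⋃ n, (S n : Set A)))
    (θ : A →⋆ₐ[ℂ] Q)
    (hsemisplit : ∀ n, ∃ ψ : ↥(S n) →ₗ[ℂ] (H →L[ℂ] H),
        IsCompletelyPositive ψ ∧ (∀ a : ↥(S n), ‖ψ a‖ ≤ ‖(a : A)‖) ∧
        ∀ a : ↥(S n), π (ψ a) = θ (a : A)) :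
    ∃ ψ : A →ₗ[ℂ] (H →L[ℂ] H), IsCompletelyPositive ψ ∧ (∀ a : A, ‖ψ a‖ ≤ ‖a‖) ∧
      ∀ a : A, π (ψ a) = θ a := by
  classical
  choose ψ hψcp hψn hψπ using hsemisplit
  obtain ⟨P, hP⟩ := exists_projSeq H
  obtain ⟨a, m, had, ham⟩ := exists_dense_seq_mem S hdense
  let c : ∀ n, ℕ → S n := fun n i => if h : a i ∈ S n then ⟨a i, h⟩ else 0
  have hc : ∀ n i, m i ≤ n → ((c n i : S n) : A) = a i := by
    intro n i h
    have : a i ∈ S n := hmono h (ham i)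
    simp only [c, dif_pos this]
  let T : ℕ → H →L[ℂ] H := fun i => ψ (m i) (c (m i) i)
  have hTπ : ∀ i, π (T i) = θ (a i) := by
    intro i
    rw [hψπ, hc _ _ le_rfl]
  let K : ℕ → ℕ → H →L[ℂ] H := fun n i => if m i ≤ n then ψ n (c n i) - T i else 0
  have hK : ∀ n i, IsCompactOperator (K n i) := by
    intro n i
    rw [← hker]
    by_cases h : m i ≤ n
    · simp only [K, if_pos h, map_sub]
      rw [hTπ, hψπ, hc _ _ h, sub_self]
    · simp only [K, if_neg h, map_zero]
  let Pr : ℕ → Finset ℕ → Prop := fun n J =>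
    (∀ i ≤ n, ‖avg P J (T i) + avg (fun j => 1 - P j) J (T i) - T i‖ ≤ (1 / 2) ^ n) ∧
      ∀ j ∈ J, ∀ i ≤ n, ‖(1 - P j) * K n i‖ ≤ (1 / 2) ^ n
  have hPr : ∀ n b, ∃ J : Finset ℕ, J.Nonempty ∧ (∀ j ∈ J, b ≤ j) ∧ Pr n J := by
    intro n b
    have hτ : ∀ i, ∃ N, ∀ l ≥ N, ‖(1 - P l) * K n i‖ ≤ (1 / 2) ^ n := fun i =>
      hP.tendsto_compact (K n i) (hK n i) _ (by positivity)
    choose τ hτ using hτ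
    obtain ⟨J, h1, h2, h3⟩ := hP.exists_avg ((Finset.range (n + 1)).image T)
      (max b ((Finset.range (n + 1)).sup τ)) ((1 / 2) ^ n) (by positivity)
    refine ⟨J, h1, fun j hj => (le_max_left _ _).trans (h2 j hj), ?_, ?_⟩
    · intro i hi
      exact h3 _ (Finset.mem_image_of_mem _ (Finset.mem_range.mpr (by omega)))
    · intro j hj i hi
      refine hτ i j ?_
      have h4 : τ i ≤ (Finset.range (n + 1)).sup τ :=
        Finset.le_sup (Finset.mem_range.mpr (by omega))
      exact h4.trans ((le_max_right _ _).trans (h2 j hj))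
  obtain ⟨J, hJ, hJn, hJJ, hJPr⟩ := exists_chain Pr hPr
  let t : ℕ → ℕ := fun n => (J (n + 1)).sup id
  have ht : ∀ n, ∀ j ∈ J (n + 1), j ≤ t n := fun n j hj => Finset.le_sup (f := id) hj
  have hΦ : ∀ n, ∃ Φ : A →ₗ[ℂ] (H →L[ℂ] H), KCP Φ ∧ (∀ x, (⟪x, Φ 1 x⟫_ℂ).re ≤ ‖x‖ ^ 2) ∧
      ∀ d ∈ (Finset.range (n + 1)).image (c n),
        ‖Φ (d : A) - star (P (t n)) * ψ n d * P (t n)‖ ≤ (1 / 2) ^ n := by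
    intro n
    obtain ⟨k, b, e, hbe⟩ := hP.rank (t n)
    exact cp_ext (S n) (hclosed n) (ψ n) (hψcp n) (hψn n) (P (t n)) (hP.norm_le _) k b e hbe _ _
      (by positivity)
  choose Φ hΦk hΦ1 hΦa using hΦ
  have hpb := hP.partial_bound J hJ hJJ Φ hΦk hΦ1
  obtain ⟨ψ', h1, h2, h3⟩ := exists_limit _ (fun N => (hpb N).1) (fun N => (hpb N).2)
  refine ⟨ψ', h1.isCompletelyPositive, h2, ?_⟩
  have hπP : ∀ j, π (P j) = 0 := fun j => (hker _).mpr (hP.compact j)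
  have hπQ : ∀ j, π (1 - P j) = 1 := fun j => by rw [map_sub, map_one, hπP, sub_zero]
  have hai : ∀ i, π (ψ' (a i)) = θ (a i) := by
    intro i
    obtain ⟨Y, hY1, hY2⟩ := telescope_limit π
      (fun n => avg (fun j => 1 - P j) (J n) (avg P (J (n + 1)) (Φ n (a i))))
      (fun n => avg (fun j => 1 - P j) (J n) (T i)) (θ (a i)) (max i (m i))
      (fun n => by
        rw [map_avg_one π _ hπQ _ (hJ n), map_avg_zero π _ hπP])
      (fun n => by rw [map_avg_one π _ hπQ _ (hJ n), hTπ])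
      (fun x => hP.avg_tendsto (T i) J hJn x)
      (fun n hn => by
        have hin : i ≤ n := (le_max_left _ _).trans hn
        have hmn : m i ≤ n := (le_max_right _ _).trans hn
        have e1 : Φ n (a i) = (Φ n (a i) - P (t n) * ψ n (c n i) * P (t n)) +
            P (t n) * ψ n (c n i) * P (t n) := by abel
        have e2 : ψ n (c n i) = K n i + T i := by
          simp only [K, if_pos hmn]; abel
        have b1 : ‖Φ n (a i) - P (t n) * ψ n (c n i) * P (t n)‖ ≤ (1 / 2) ^ n := by
          have := hΦa n (c n i) (Finset.mem_image_of_mem _ (Finset.mem_range.mpr (by omega)))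
          rwa [hc n i hmn, hP.sa] at this
        have b1' : ‖avg (fun j => 1 - P j) (J n) (avg P (J (n + 1))
            (Φ n (a i) - P (t n) * ψ n (c n i) * P (t n)))‖ ≤ (1 / 2) ^ n :=
          (norm_avg_le _ hP.norm_le' _ _).trans ((norm_avg_le _ hP.norm_le _ _).trans b1)
        have b2 : ‖avg (fun j => 1 - P j) (J n) (avg P (J (n + 1)) (K n i))‖ ≤ (1 / 2) ^ n :=
          hP.norm_avg_avg_le (J n) (J (n + 1)) (hJJ n) (K n i) _ (by positivity)
            (fun j hj => (hJPr n).2 j hj i hin)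
        have b3 : ‖avg (fun j => 1 - P j) (J n) (avg P (J (n + 1)) (T i) +
            avg (fun j => 1 - P j) (J (n + 1)) (T i) - T i)‖ ≤ (1 / 2) ^ n := by
          refine (norm_avg_le _ hP.norm_le' _ _).trans (((hJPr (n + 1)).1 i (by omega)).trans ?_)
          exact pow_le_pow_of_le_one (by norm_num) (by norm_num) (by omega)
        have e3 : avg (fun j => 1 - P j) (J n) (avg P (J (n + 1)) (Φ n (a i))) -
            (avg (fun j => 1 - P j) (J n) (T i) - avg (fun j => 1 - P j) (J (n + 1)) (T i)) =
            avg (fun j => 1 - P j) (J n) (avg P (J (n + 1))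
              (Φ n (a i) - P (t n) * ψ n (c n i) * P (t n))) +
            avg (fun j => 1 - P j) (J n) (avg P (J (n + 1)) (K n i)) +
            avg (fun j => 1 - P j) (J n) (avg P (J (n + 1)) (T i) +
              avg (fun j => 1 - P j) (J (n + 1)) (T i) - T i) := by
          conv_lhs => rw [e1]
          rw [map_add, map_add, hP.avg_compress (J (n + 1)) (t n) (ht n)]
          conv_lhs =>
            lhs
            rhs
            rw [e2, map_add, map_add, hP.split (J n) (J (n + 1)) (hJ n) (hJJ n) (T i)]
          abel
        rw [e3]
        refine (norm_add₃_le).trans ?_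
        linarith)
    have : ψ' (a i) = Y := h3 (a i) Y fun x y => by
      refine (hY2 x y).congr fun N => ?_
      rw [LinearMap.sum_apply]
      rfl
    rw [this, hY1]
  have hψ'c : Continuous ψ' :=
    AddMonoidHomClass.continuous_of_bound ψ' 1 (fun x => by rw [one_mul]; exact h2 x)
  have hθc : Continuous θ := AddMonoidHomClass.continuous_of_bound θ 1 (fun x => by
    rw [one_mul]; exact NonUnitalStarAlgHom.norm_apply_le (A := A) (B := Q) θ x)
  have := had.equalizer ((star_hom_continuous π).comp hψ'c) hθc (by ext i; exact hai i)
  exact fun x => congrFun this x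


end Helpers

/-- If a unital extension `θ : A → Q(H)` of a separable unital C*-algebra `A`, which is the
closure of the union of an increasing sequence of C*-subalgebras `A_n`, is semisplit on
every `A_n`, then it is semisplit.  Here `Q` plays the role of the Calkin algebra
`Q(H) = B(H)/K(H)`: it is a C*-algebra equipped with a surjective unital *-homomorphism
`π : B(H) → Q` whose kernel is exactly the ideal of compact operators. -/
theorem semisplit_of_semisplit_on_chain
    (H : Type) [NormedAddCommGroup H] [InnerProductSpace ℂ H] [CompleteSpace H]
    [TopologicalSpace.SeparableSpace H] (hH : ¬ FiniteDimensional ℂ H)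
    (Q : Type) [CStarAlgebra Q] (π : (H →L[ℂ] H) →⋆ₐ[ℂ] Q)
    (hsurj : Function.Surjective π)
    (hker : ∀ T : H →L[ℂ] H, π T = 0 ↔ IsCompactOperator T)
    (A : Type) [CStarAlgebra A] [TopologicalSpace.SeparableSpace A]
    (S : ℕ → NonUnitalStarSubalgebra ℂ A) (hmono : Monotone S)
    (hclosed : ∀ n, IsClosed (S n : Set A))
    (hdense : Dense (⋃ n, (S n : Set A)))
    (θ : A →⋆ₐ[ℂ] Q) (hθ : Function.Injective θ)
    (hsemisplit : ∀ n, ∃ ψ : ↥(S n) →ₗ[ℂ] (H →L[ℂ] H),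
        IsCompletelyPositive ψ ∧ (∀ a : ↥(S n), ‖ψ a‖ ≤ ‖(a : A)‖) ∧
        ∀ a : ↥(S n), π (ψ a) = θ (a : A)) :
    ∃ ψ : A →ₗ[ℂ] (H →L[ℂ] H), IsCompletelyPositive ψ ∧ (∀ a : A, ‖ψ a‖ ≤ ‖a‖) ∧
      ∀ a : A, π (ψ a) = θ a := by
  exact main_aux H Q π hker A S hmono hclosed hdense θ hsemisplit
end

section
/- For every infinite cardinal κ with κ < 2^ℵ₀, there is no κ-universal C*-algebra; that is, there is no C*-algebra A of density character κ such that every C*-algebra of density character at most κ admits an injective *-homomorphism into A. -/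
open Cardinal

/-- The density character of a metric (topological) space: the smallest cardinality of a
dense subset. -/
noncomputable def densityCharacter (X : Type*) [TopologicalSpace X] : Cardinal :=
  sInf {c : Cardinal | ∃ s : Set X, Dense s ∧ #s = c}


namespace NoUniv

noncomputable abbrev L2 (J : Type) := lp (fun _ : J => ℂ) 2

lemma L2.hasSum {J : Type} (f : L2 J) : HasSum (fun j => ‖f j‖ ^ 2) (‖f‖ ^ 2) := by
  have := lp.hasSum_norm (p := 2) (by norm_num) f
  simpa using this

lemma L2.mem {J : Type} {f : J → ℂ} (h : Summable fun j => ‖f j‖ ^ 2) : Memℓp f 2 := by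
  apply memℓp_gen
  simpa using h

lemma mon_aux {J : Type} (g : J ≃ J) (χ : J → Circle) (f : L2 J) :
    HasSum (fun j => ‖(χ j : ℂ) * f (g.symm j)‖ ^ 2) (‖f‖ ^ 2) := by
  have h2 := (g.symm.hasSum_iff).2 (L2.hasSum f)
  have : ∀ j, ‖(χ j : ℂ) * f (g.symm j)‖ ^ 2 = ((fun j => ‖f j‖ ^ 2) ∘ g.symm) j := by
    intro j
    rw [norm_mul, Circle.norm_coe, one_mul]; rfl
  simpa only [this] using h2

/-- The monomial operator `(W f) j = χ j * f (g⁻¹ j)`. -/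
noncomputable def mon {J : Type} (g : J ≃ J) (χ : J → Circle) : L2 J →ₗᵢ[ℂ] L2 J where
  toFun f := ⟨fun j => (χ j : ℂ) * f (g.symm j), L2.mem (mon_aux g χ f).summable⟩
  map_add' f f' := by
    ext j
    exact mul_add (χ j : ℂ) (f (g.symm j)) (f' (g.symm j))
  map_smul' c f := by
    ext j
    exact mul_left_comm (χ j : ℂ) c (f (g.symm j))
  norm_map' f := by
    have h := L2.hasSum (J := J) ⟨fun j => (χ j : ℂ) * f (g.symm j),
      L2.mem (mon_aux g χ f).summable⟩
    exact (sq_eq_sq₀ (norm_nonneg _) (norm_nonneg _)).1 (h.unique (mon_aux g χ f))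

@[simp] lemma mon_apply {J : Type} (g : J ≃ J) (χ : J → Circle) (f : L2 J) (j : J) :
    mon g χ f j = (χ j : ℂ) * f (g.symm j) := rfl

/-- inclusion along an injection -/
noncomputable def inc {I J : Type} (e : I → J) (he : e.Injective) : L2 I →ₗᵢ[ℂ] L2 J where
  toFun f := ⟨Function.extend e f 0, L2.mem (by
    have : (fun j => ‖Function.extend e (f : I → ℂ) 0 j‖ ^ 2)
        = Function.extend e (fun i => ‖f i‖ ^ 2) 0 := by
      funext j
      by_cases h : ∃ i, e i = j
      · obtain ⟨i, rfl⟩ := h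
        simp [he.extend_apply]
      · simp [Function.extend_apply' _ _ _ h]
    rw [this]
    exact ((hasSum_extend_zero he).2 (L2.hasSum f)).summable)⟩
  map_add' f f' := by
    ext j
    change Function.extend e ((f : I → ℂ) + (f' : I → ℂ)) 0 j
      = Function.extend e (f : I → ℂ) 0 j + Function.extend e (f' : I → ℂ) 0 j
    by_cases h : ∃ i, e i = j
    · obtain ⟨i, rfl⟩ := h
      simp [he.extend_apply]
    · simp [Function.extend_apply' _ _ _ h]
  map_smul' c f := by
    ext j
    by_cases h : ∃ i, e i = j
    · obtain ⟨i, rfl⟩ := h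
      simp [he.extend_apply]
    · simp [Function.extend_apply' _ _ _ h]
  norm_map' f := by
    have h1 := (hasSum_extend_zero he).2 (L2.hasSum f)
    have : (fun j => ‖Function.extend e (f : I → ℂ) 0 j‖ ^ 2)
        = Function.extend e (fun i => ‖f i‖ ^ 2) 0 := by
      funext j
      by_cases h : ∃ i, e i = j
      · obtain ⟨i, rfl⟩ := h
        simp [he.extend_apply]
      · simp [Function.extend_apply' _ _ _ h]
    have h := L2.hasSum (J := J) ⟨Function.extend e f 0, L2.mem (this ▸ h1.summable)⟩
    simp only [this] at h
    exact (sq_eq_sq₀ (norm_nonneg _) (norm_nonneg _)).1 (h.unique h1)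

lemma inc_apply {I J : Type} (e : I → J) (he : e.Injective) (f : L2 I) (i : I) :
    inc e he f (e i) = f i := he.extend_apply _ _ _

lemma inc_apply' {I J : Type} (e : I → J) (he : e.Injective) (f : L2 I) (j : J)
    (h : ¬ ∃ i, e i = j) : inc e he f j = 0 := Function.extend_apply' _ _ _ h

noncomputable def incL {I J : Type} (e : I → J) (he : e.Injective) : L2 I →L[ℂ] L2 J :=
  (inc e he).toContinuousLinearMap

lemma adj_inc_apply {I J : Type} (e : I → J) (he : e.Injective) (f : L2 J) (i : I) :
    ContinuousLinearMap.adjoint (incL e he) f i = f (e i) := by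
  classical
  have h1 := lp.inner_single_left (𝕜 := ℂ) i (1 : ℂ) (ContinuousLinearMap.adjoint (incL e he) f)
  rw [ContinuousLinearMap.adjoint_inner_right] at h1
  have h2 : incL e he (lp.single 2 i (1 : ℂ)) = lp.single 2 (e i) (1 : ℂ) := by
    ext j
    change inc e he _ j = _
    by_cases h : ∃ i, e i = j
    · obtain ⟨i', rfl⟩ := h
      rw [inc_apply]
      simp [lp.single_apply, Pi.single_apply, he.eq_iff]
    · rw [inc_apply' _ _ _ _ h, lp.single_apply_ne]
      rintro rfl; exact h ⟨i, rfl⟩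
  rw [h2, lp.inner_single_left] at h1
  simpa using h1.symm


noncomputable def mass {J : Type} (f : L2 J) (E : Set J) : ℝ := ∑' j, E.indicator (fun j => ‖f j‖ ^ 2) j

lemma mass_summable {J : Type} (f : L2 J) (E : Set J) :
    Summable (E.indicator (fun j => ‖f j‖ ^ 2)) := (L2.hasSum f).summable.indicator E

lemma mass_nonneg {J : Type} (f : L2 J) (E : Set J) : 0 ≤ mass f E :=
  tsum_nonneg fun j => Set.indicator_nonneg (fun _ _ => by positivity) j

lemma mass_univ {J : Type} (f : L2 J) : mass f Set.univ = ‖f‖ ^ 2 := by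
  simpa [mass] using (L2.hasSum f).tsum_eq

lemma mass_union_le {J : Type} (f : L2 J) {E F G : Set J} (h : E ⊆ F ∪ G) :
    mass f E ≤ mass f F + mass f G := by
  unfold mass
  rw [← (mass_summable f F).tsum_add (mass_summable f G)]
  refine (mass_summable f E).tsum_le_tsum (fun j => ?_) ((mass_summable f F).add (mass_summable f G))
  have hn : 0 ≤ ‖f j‖ ^ 2 := by positivity
  have := @h j
  by_cases h1 : j ∈ E <;> by_cases h2 : j ∈ F <;> by_cases h3 : j ∈ G <;>
    simp_all [Set.indicator]

lemma mass_disj_le {J : Type} (f : L2 J) {E F G : Set J} (h : Disjoint F G) (hF : F ⊆ E)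
    (hG : G ⊆ E) : mass f F + mass f G ≤ mass f E := by
  unfold mass
  rw [← (mass_summable f F).tsum_add (mass_summable f G)]
  refine ((mass_summable f F).add (mass_summable f G)).tsum_le_tsum (fun j => ?_) (mass_summable f E)
  have hn : 0 ≤ ‖f j‖ ^ 2 := by positivity
  have h1 := @hF j
  have h2 := @hG j
  have h3 : j ∈ F → j ∉ G := fun h' => Set.disjoint_left.1 h h'
  by_cases h1 : j ∈ E <;> by_cases h2 : j ∈ F <;> by_cases h3 : j ∈ G <;>
    simp_all [Set.indicator]

lemma aux_ineq (a b : ℂ) : ‖a‖ ^ 2 ≤ 11 / 10 * ‖b‖ ^ 2 + 11 * ‖b - a‖ ^ 2 := by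
  have h : ‖a‖ ≤ ‖b‖ + ‖b - a‖ := by
    have := norm_sub_le b (b - a)
    simpa using this
  have h2 : ‖a‖ ^ 2 ≤ (‖b‖ + ‖b - a‖) ^ 2 := by gcongr
  nlinarith [sq_nonneg (‖b‖ - 10 * ‖b - a‖)]

lemma mass_shift {J : Type} (f : L2 J) {E F : Set J} (σ : J ≃ J) (h : ∀ j ∈ E, σ j ∈ F) {ε : ℝ}
    (hε : HasSum (fun j => ‖f (σ j) - f j‖ ^ 2) ε) :
    mass f E ≤ 11 / 10 * mass f F + 11 * ε := by
  have hF : HasSum (fun j => F.indicator (fun j => ‖f j‖ ^ 2) (σ j)) (mass f F) :=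
    (σ.hasSum_iff).2 (mass_summable f F).hasSum
  refine hasSum_le (fun j => ?_) (mass_summable f E).hasSum
    ((hF.mul_left (11 / 10)).add (hε.mul_left 11))
  have := aux_ineq (f j) (f (σ j))
  by_cases h1 : j ∈ E
  · simpa [h1, h j h1] using this
  · rw [Set.indicator_of_notMem h1]
    have : 0 ≤ F.indicator (fun j => ‖f j‖ ^ 2) (σ j) :=
      Set.indicator_nonneg (fun _ _ => by positivity) _
    positivity

lemma mon_shift' {J : Type} (f : L2 J) (σ : J ≃ J) :
    HasSum (fun j => ‖f (σ.symm j) - f j‖ ^ 2) (‖mon σ (fun _ => 1) f - f‖ ^ 2) := by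
  simpa using L2.hasSum (mon σ (fun _ => 1) f - f)

lemma mon_shift {J : Type} (f : L2 J) (σ : J ≃ J) :
    HasSum (fun j => ‖f (σ j) - f j‖ ^ 2) (‖mon σ (fun _ => 1) f - f‖ ^ 2) := by
  have := (σ.hasSum_iff).2 (mon_shift' f σ)
  simpa [Function.comp_def, norm_sub_rev] using this

lemma mass_char {J : Type} (f : L2 J) (χ : J → Circle) {E : Set J}
    (hE : ∀ j ∈ E, 1 / 2 ≤ ‖(χ j : ℂ) - 1‖) :
    mass f E ≤ 4 * ‖mon (Equiv.refl J) χ f - f‖ ^ 2 := by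
  refine hasSum_le (fun j => ?_) (mass_summable f E).hasSum
    ((L2.hasSum (mon (Equiv.refl J) χ f - f)).mul_left 4)
  by_cases h1 : j ∈ E
  · have h2 := hE j h1
    have : (mon (Equiv.refl J) χ f - f : L2 J) j = ((χ j : ℂ) - 1) * f j := by
      simp [sub_mul]
    rw [this, Set.indicator_of_mem h1, norm_mul, mul_pow]
    have : (1 / 2) ^ 2 ≤ ‖(χ j : ℂ) - 1‖ ^ 2 := by gcongr
    nlinarith [sq_nonneg ‖f j‖]
  · rw [Set.indicator_of_notMem h1]
    positivity

lemma quad {J : Type} (f : L2 J) (σ τ : J ≃ J) {Q D F G : Set J}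
    (hF : F ⊆ Q) (hG : G ⊆ Q) (hFG : Disjoint F G)
    (hσ : ∀ j ∈ Q ∩ D, σ j ∈ F) (hτ : ∀ j ∈ Q ∩ D, τ j ∈ G) {ε ε' : ℝ}
    (hε : HasSum (fun j => ‖f (σ j) - f j‖ ^ 2) ε)
    (hε' : HasSum (fun j => ‖f (τ j) - f j‖ ^ 2) ε') :
    9 / 10 * mass f (Q ∩ D) ≤ 11 / 10 * mass f Dᶜ + 11 * (ε + ε') := by
  have h1 := mass_shift f σ hσ hε
  have h2 := mass_shift f τ hτ hε'
  have h3 := mass_disj_le f hFG hF hG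
  have h4 : mass f Q ≤ mass f (Q ∩ D) + mass f Dᶜ := mass_union_le f (by
    intro j hj
    by_cases h : j ∈ D
    · exact Or.inl ⟨hj, h⟩
    · exact Or.inr h)
  linarith

abbrev Tor := AddCircle (1 : ℝ)

noncomputable def rep (t : Tor) : ℝ := (AddCircle.equivIoc (1 : ℝ) (-1 / 2) t : ℝ)

lemma coe_rep (t : Tor) : ((rep t : ℝ) : Tor) = t := AddCircle.coe_equivIoc

lemma rep_mem (t : Tor) : -1 / 2 < rep t ∧ rep t ≤ 1 / 2 := by
  have := (AddCircle.equivIoc (1 : ℝ) (-1 / 2) t).2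
  refine ⟨this.1, this.2.trans (by norm_num)⟩

lemma rep_coe {x : ℝ} (h : |x| < 1 / 2) : rep (x : Tor) = x := by
  rw [abs_lt] at h
  exact AddCircle.equivIoc_coe_of_mem ⟨by linarith, by linarith⟩

lemma rep_add {s t : Tor} (h : |rep s + rep t| < 1 / 2) : rep (s + t) = rep s + rep t := by
  conv_lhs => rw [← coe_rep s, ← coe_rep t, ← AddCircle.coe_add, rep_coe h]

lemma rep_sub {s t : Tor} (h : |rep s - rep t| < 1 / 2) : rep (s - t) = rep s - rep t := by
  conv_lhs => rw [← coe_rep s, ← coe_rep t, ← AddCircle.coe_sub, rep_coe h]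

lemma rep_eq_zero {t : Tor} (h : rep t = 0) : t = 0 := by
  rw [← coe_rep t, h]; rfl

lemma char_lower {t : Tor} (h : 1 / 8 ≤ |rep t|) : 1 / 2 ≤ ‖(t.toCircle : ℂ) - 1‖ := by
  have hm := rep_mem t
  have e : (t.toCircle : ℂ) = Complex.exp (Complex.I * ((2 * Real.pi * rep t : ℝ) : ℂ)) := by
    conv_lhs => rw [← coe_rep t]
    rw [AddCircle.toCircle_apply_mk, Circle.coe_exp]
    push_cast
    ring_nf
  rw [e, Complex.norm_exp_I_mul_ofReal_sub_one, norm_mul, Real.norm_eq_abs, Real.norm_eq_abs]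
  have h2 : |Real.sin (2 * Real.pi * rep t / 2)| = Real.sin (Real.pi * |rep t|) := by
    have hp := Real.pi_pos
    have h0 : 0 ≤ Real.sin (Real.pi * |rep t|) := by
      apply Real.sin_nonneg_of_nonneg_of_le_pi (by positivity)
      have : |rep t| ≤ 1 := by rw [abs_le]; constructor <;> linarith
      nlinarith
    rw [← abs_of_nonneg h0]
    rcases abs_choice (rep t) with h | h <;> rw [h]
    · congr 2; ring
    · rw [mul_neg, Real.sin_neg, abs_neg]; congr 2; ring
  rw [h2]
  have := Real.mul_le_sin (x := Real.pi * |rep t|) (by positivity) (by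
    have : |rep t| ≤ 1 / 2 := by rw [abs_le]; constructor <;> linarith
    nlinarith [Real.pi_pos])
  have e2 : 2 / Real.pi * (Real.pi * |rep t|) = 2 * |rep t| := by field_simp
  rw [e2] at this
  rw [abs_of_pos (by norm_num : (0:ℝ) < 2)]
  linarith

lemma core {J : Type} (p q : J → Tor) (hne : ∀ j, ¬ (p j = 0 ∧ q j = 0)) (α β : J ≃ J)
    (hα : ∀ j, p (α j) = p j + q j ∧ q (α j) = q j)
    (hβ : ∀ j, p (β j) = p j ∧ q (β j) = q j + p j)
    (f : L2 J) {η : ℝ}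
    (h1 : ‖mon (Equiv.refl J) (fun j => (p j).toCircle) f - f‖ ^ 2 ≤ η)
    (h2 : ‖mon (Equiv.refl J) (fun j => (q j).toCircle) f - f‖ ^ 2 ≤ η)
    (h3 : ‖mon α (fun _ => 1) f - f‖ ^ 2 ≤ η)
    (h4 : ‖mon β (fun _ => 1) f - f‖ ^ 2 ≤ η) : ‖f‖ ^ 2 ≤ 80 * η := by
  set a : J → ℝ := fun j => rep (p j) with ha
  set b : J → ℝ := fun j => rep (q j) with hb
  have hab : ∀ j, ¬ (a j = 0 ∧ b j = 0) := fun j h => hne j ⟨rep_eq_zero h.1, rep_eq_zero h.2⟩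
  set D : Set J := {j | |a j| < 1 / 8 ∧ |b j| < 1 / 8} with hD
  have hα' : ∀ j, p (α.symm j) = p j - q j ∧ q (α.symm j) = q j := by
    intro j
    have := hα (α.symm j)
    rw [Equiv.apply_symm_apply] at this
    rw [this.1, this.2]; simp
  have hβ' : ∀ j, p (β.symm j) = p j ∧ q (β.symm j) = q j - p j := by
    intro j
    have := hβ (β.symm j)
    rw [Equiv.apply_symm_apply] at this
    rw [this.1, this.2]; simp
  have aα : ∀ j ∈ D, a (α j) = a j + b j ∧ b (α j) = b j := by
    intro j hj
    simp only [hD, Set.mem_ofPred_eq, abs_lt] at hj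
    refine ⟨?_, by simp only [hb, (hα j).2]⟩
    simp only [ha, (hα j).1]
    exact rep_add (by rw [abs_lt]; constructor <;> linarith [hj.1.1, hj.1.2, hj.2.1, hj.2.2])
  have aα' : ∀ j ∈ D, a (α.symm j) = a j - b j ∧ b (α.symm j) = b j := by
    intro j hj
    simp only [hD, Set.mem_ofPred_eq, abs_lt] at hj
    refine ⟨?_, by simp only [hb, (hα' j).2]⟩
    simp only [ha, (hα' j).1]
    exact rep_sub (by rw [abs_lt]; constructor <;> linarith [hj.1.1, hj.1.2, hj.2.1, hj.2.2])
  have aβ : ∀ j ∈ D, a (β j) = a j ∧ b (β j) = b j + a j := by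
    intro j hj
    simp only [hD, Set.mem_ofPred_eq, abs_lt] at hj
    refine ⟨by simp only [ha, (hβ j).1], ?_⟩
    simp only [hb, (hβ j).2]
    exact rep_add (by rw [abs_lt]; constructor <;> linarith [hj.1.1, hj.1.2, hj.2.1, hj.2.2])
  have aβ' : ∀ j ∈ D, a (β.symm j) = a j ∧ b (β.symm j) = b j - a j := by
    intro j hj
    simp only [hD, Set.mem_ofPred_eq, abs_lt] at hj
    refine ⟨by simp only [ha, (hβ' j).1], ?_⟩
    simp only [hb, (hβ' j).2]
    exact rep_sub (by rw [abs_lt]; constructor <;> linarith [hj.1.1, hj.1.2, hj.2.1, hj.2.2])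
  have mD : mass f Dᶜ ≤ 8 * η := by
    have e1 := mass_char f (fun j => (p j).toCircle) (E := {j | 1 / 8 ≤ |a j|})
      (fun j hj => char_lower hj)
    have e2 := mass_char f (fun j => (q j).toCircle) (E := {j | 1 / 8 ≤ |b j|})
      (fun j hj => char_lower hj)
    have e3 : mass f Dᶜ ≤ mass f {j | 1 / 8 ≤ |a j|} + mass f {j | 1 / 8 ≤ |b j|} :=
      mass_union_le f (by
        intro j hj
        by_contra hcon
        simp only [Set.mem_union, Set.mem_ofPred_eq, not_or, not_le] at hcon
        exact hj hcon)
    linarith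
  have q1 := quad f α β (Q := {j | (0 < a j ∧ 0 ≤ b j) ∨ (a j < 0 ∧ b j ≤ 0)}) (D := D)
    (F := {j | (0 ≤ b j ∧ b j < a j) ∨ (b j ≤ 0 ∧ a j < b j)})
    (G := {j | (0 < a j ∧ a j ≤ b j) ∨ (a j < 0 ∧ b j ≤ a j)})
    (by
      intro j hj
      simp only [Set.mem_ofPred_eq] at hj ⊢
      rcases hj with ⟨x, y⟩ | ⟨x, y⟩
      · left; constructor <;> linarith
      · right; constructor <;> linarith)
    (by
      intro j hj
      simp only [Set.mem_ofPred_eq] at hj ⊢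
      rcases hj with ⟨x, y⟩ | ⟨x, y⟩
      · left; constructor <;> linarith
      · right; constructor <;> linarith)
    (by
      rw [Set.disjoint_left]
      intro j hj hj'
      simp only [Set.mem_ofPred_eq] at hj hj'
      rcases hj with ⟨x, y⟩ | ⟨x, y⟩ <;> rcases hj' with ⟨z, w⟩ | ⟨z, w⟩ <;> linarith)
    (by
      intro j hj
      have := aα j hj.2
      have hj := hj.1
      simp only [Set.mem_ofPred_eq] at hj ⊢
      rw [this.1, this.2]
      rcases hj with ⟨x, y⟩ | ⟨x, y⟩
      · left; constructor <;> linarith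
      · right; constructor <;> linarith)
    (by
      intro j hj
      have := aβ j hj.2
      have hj := hj.1
      simp only [Set.mem_ofPred_eq] at hj ⊢
      rw [this.1, this.2]
      rcases hj with ⟨x, y⟩ | ⟨x, y⟩
      · left; constructor <;> linarith
      · right; constructor <;> linarith)
    (mon_shift f α) (mon_shift f β)
  have q2 := quad f α.symm β.symm (Q := {j | (0 < b j ∧ a j ≤ 0) ∨ (b j < 0 ∧ 0 ≤ a j)}) (D := D)
    (F := {j | (0 < b j ∧ a j ≤ - b j) ∨ (b j < 0 ∧ - b j ≤ a j)})
    (G := {j | (a j ≤ 0 ∧ - a j < b j) ∨ (0 ≤ a j ∧ b j < - a j)})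
    (by
      intro j hj
      simp only [Set.mem_ofPred_eq] at hj ⊢
      rcases hj with ⟨x, y⟩ | ⟨x, y⟩
      · left; constructor <;> linarith
      · right; constructor <;> linarith)
    (by
      intro j hj
      simp only [Set.mem_ofPred_eq] at hj ⊢
      rcases hj with ⟨x, y⟩ | ⟨x, y⟩
      · left; constructor <;> linarith
      · right; constructor <;> linarith)
    (by
      rw [Set.disjoint_left]
      intro j hj hj'
      simp only [Set.mem_ofPred_eq] at hj hj'
      rcases hj with ⟨x, y⟩ | ⟨x, y⟩ <;> rcases hj' with ⟨z, w⟩ | ⟨z, w⟩ <;> linarith)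
    (by
      intro j hj
      have := aα' j hj.2
      have hj := hj.1
      simp only [Set.mem_ofPred_eq] at hj ⊢
      rw [this.1, this.2]
      rcases hj with ⟨x, y⟩ | ⟨x, y⟩
      · left; constructor <;> linarith
      · right; constructor <;> linarith)
    (by
      intro j hj
      have := aβ' j hj.2
      have hj := hj.1
      simp only [Set.mem_ofPred_eq] at hj ⊢
      rw [this.1, this.2]
      rcases hj with ⟨x, y⟩ | ⟨x, y⟩
      · left; constructor <;> linarith
      · right; constructor <;> linarith)
    (mon_shift' f α) (mon_shift' f β)
  set Q1 : Set J := {j | (0 < a j ∧ 0 ≤ b j) ∨ (a j < 0 ∧ b j ≤ 0)}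
  set Q2 : Set J := {j | (0 < b j ∧ a j ≤ 0) ∨ (b j < 0 ∧ 0 ≤ a j)}
  have c1 : mass f Set.univ ≤ mass f (Q1 ∩ D) + mass f ((Q2 ∩ D) ∪ Dᶜ) := mass_union_le f (by
    intro j _
    by_cases hj : j ∈ D
    · have : j ∈ Q1 ∨ j ∈ Q2 := by
        have := hab j
        simp only [Q1, Q2, Set.mem_ofPred_eq]
        rcases lt_trichotomy (a j) 0 with x | x | x <;> rcases lt_trichotomy (b j) 0 with y | y | y
        · exact Or.inl (Or.inr ⟨x, y.le⟩)
        · exact Or.inl (Or.inr ⟨x, y.le⟩)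
        · exact Or.inr (Or.inl ⟨y, x.le⟩)
        · exact Or.inr (Or.inr ⟨y, x.ge⟩)
        · exact absurd ⟨x, y⟩ this
        · exact Or.inr (Or.inl ⟨y, x.le⟩)
        · exact Or.inr (Or.inr ⟨y, x.le⟩)
        · exact Or.inl (Or.inl ⟨x, y.ge⟩)
        · exact Or.inl (Or.inl ⟨x, y.le⟩)
      simp only [Set.mem_union, Set.mem_inter_iff]
      tauto
    · exact Or.inr (Or.inr hj))
  have c2 := mass_union_le f (le_refl ((Q2 ∩ D) ∪ Dᶜ))
  rw [mass_univ] at c1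
  have hη : 0 ≤ η := le_trans (by positivity) h1
  linarith

end NoUniv

namespace NoUniv

section matrices

set_option linter.unusedSectionVars false

variable {X : Type} [Fintype X] [DecidableEq X]

/-- The monomial matrix with entries multiples of `a`. -/
noncomputable def monM {A : Type} [NonUnitalCStarAlgebra A] (g : X ≃ X) (c : X → Circle) (a : A) :
    CStarMatrix X X A :=
  CStarMatrix.ofMatrix fun x x' => if g.symm x = x' then (c x : ℂ) • a else 0

lemma monM_apply {A : Type} [NonUnitalCStarAlgebra A] (g : X ≃ X) (c : X → Circle) (a : A)
    (x x' : X) : monM g c a x x' = if g.symm x = x' then (c x : ℂ) • a else 0 := rfl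

lemma monM_sub {A : Type} [NonUnitalCStarAlgebra A] (g : X ≃ X) (c : X → Circle) (a b : A) :
    monM g c (a - b) = monM g c a - monM g c b := by
  ext x x'
  simp only [monM_apply, CStarMatrix.sub_apply]
  split_ifs <;> simp [smul_sub]

noncomputable def diagM (X : Type) [DecidableEq X] {A : Type}
    [NonUnitalCStarAlgebra A] (a : A) : CStarMatrix X X A :=
  CStarMatrix.ofMatrix fun x x' => if x = x' then a else 0

lemma diagM_apply {A : Type} [NonUnitalCStarAlgebra A] (a : A) (x x' : X) :
    diagM X a x x' = if x = x' then a else 0 := rfl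

noncomputable def diagHom (X : Type) [Fintype X] [DecidableEq X] (A : Type)
    [NonUnitalCStarAlgebra A] :
    A →⋆ₙₐ[ℂ] CStarMatrix X X A where
  toFun a := diagM X a
  map_smul' c a := by
    ext x x'
    simp only [CStarMatrix.smul_apply, diagM_apply]
    split_ifs <;> simp
  map_zero' := by
    ext x x'
    simp [diagM_apply]
  map_add' a b := by
    ext x x'
    simp only [CStarMatrix.add_apply, diagM_apply]
    split_ifs <;> simp
  map_mul' a b := by
    ext x x'
    simp only [CStarMatrix.mul_apply, diagM_apply]
    by_cases h : x = x' <;> simp [h]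
  map_star' a := by
    ext x x'
    simp only [CStarMatrix.star_apply, diagM_apply]
    by_cases h : x = x'
    · simp [h]
    · simp [h, Ne.symm h]

lemma norm_monM_le {A : Type} [NonUnitalCStarAlgebra A] [PartialOrder A] [StarOrderedRing A]
    (g : X ≃ X) (c : X → Circle) (a : A) : ‖monM g c a‖ ≤ ‖a‖ := by
  have h1 : star (monM g c a) * monM g c a = diagHom X A (star a * a) := by
    ext x x'
    change _ = diagM X (star a * a) x x'
    rw [diagM_apply, CStarMatrix.mul_apply]
    simp only [CStarMatrix.star_apply, monM_apply]
    rw [Finset.sum_eq_single (g x)]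
    · by_cases h : x = x'
      · subst h
        have : (starRingEnd ℂ) (c (g x)) * (c (g x) : ℂ) = 1 := by
          rw [← Complex.normSq_eq_conj_mul_self]; simp
        simp [smul_smul, smul_mul_assoc, mul_smul_comm]
        rw [mul_comm, this, one_smul]
      · simp [h]
    · intro y _ hy
      have : g.symm y ≠ x := fun h => hy (by rw [← h]; simp)
      simp [this]
    · simp
  have h2 : ‖monM g c a‖ * ‖monM g c a‖ ≤ ‖a‖ * ‖a‖ := by
    rw [← CStarRing.norm_star_mul_self, ← CStarRing.norm_star_mul_self, h1]
    exact NonUnitalStarAlgHom.norm_apply_le _ _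
  exact (mul_self_le_mul_self_iff (norm_nonneg _) (norm_nonneg _)).2 h2

variable {I : Type}

noncomputable def io (I : Type) (x : X) : L2 I →L[ℂ] L2 (X × I) :=
  incL (fun y => (x, y)) (Prod.mk_right_injective x)

noncomputable def ro (I : Type) (x : X) : L2 (X × I) →L[ℂ] L2 I :=
  ContinuousLinearMap.adjoint (io I x)

lemma ro_apply (x : X) (f : L2 (X × I)) (y : I) : ro I x f y = f (x, y) :=
  adj_inc_apply _ _ f y

lemma io_apply (x x' : X) (f : L2 I) (y : I) : io I x f (x', y) = if x = x' then f y else 0 := by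
  split_ifs with h
  · subst h
    exact inc_apply (fun y => (x, y)) (Prod.mk_right_injective x) f y
  · apply inc_apply' (fun y => (x, y)) (Prod.mk_right_injective x)
    rintro ⟨i, hi⟩
    exact h (congrArg Prod.fst hi)

lemma ro_io (x x' : X) (f : L2 I) : ro I x (io I x' f) = if x' = x then f else 0 := by
  ext y
  rw [ro_apply, io_apply]
  split_ifs <;> rfl

noncomputable def repFun (M : CStarMatrix X X (L2 I →L[ℂ] L2 I)) :
    L2 (X × I) →L[ℂ] L2 (X × I) := ∑ x, ∑ x', io I x ∘L M x x' ∘L ro I x'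

lemma ro_repFun (M : CStarMatrix X X (L2 I →L[ℂ] L2 I)) (f : L2 (X × I)) (x : X) :
    ro I x (repFun M f) = ∑ x', M x x' (ro I x' f) := by
  unfold repFun
  simp only [sum_apply, ContinuousLinearMap.comp_apply, map_sum, ro_io]
  rw [Finset.sum_comm]
  simp

lemma ro_ext {f f' : L2 (X × I)} (h : ∀ x, ro I x f = ro I x f') : f = f' := by
  ext ⟨x, y⟩
  rw [← ro_apply, ← ro_apply, h]

/-- The canonical representation of matrices over operators. -/
noncomputable def repHom (X I : Type) [Fintype X] [DecidableEq X] :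
    CStarMatrix X X (L2 I →L[ℂ] L2 I) →⋆ₙₐ[ℂ] (L2 (X × I) →L[ℂ] L2 (X × I)) where
  toFun M := repFun M
  map_smul' c M := by
    simp [repFun, Finset.smul_sum]
  map_zero' := by simp [repFun]
  map_add' M N := by
    simp [repFun, Finset.sum_add_distrib]
  map_mul' M N := by
    ext1 f
    refine ro_ext fun x => ?_
    rw [mul_apply_eq_comp, ro_repFun, ro_repFun]
    simp only [CStarMatrix.mul_apply, sum_apply, mul_apply_eq_comp, ro_repFun, map_sum]
    rw [Finset.sum_comm]
  map_star' M := by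
    simp only [repFun, ContinuousLinearMap.star_eq_adjoint, map_sum,
      ContinuousLinearMap.adjoint_comp, ro,
      ContinuousLinearMap.adjoint_adjoint, CStarMatrix.star_apply]
    rw [Finset.sum_comm]
    rfl

lemma repHom_apply (M : CStarMatrix X X (L2 I →L[ℂ] L2 I)) (f : L2 (X × I)) (x : X) (y : I) :
    repHom X I M f (x, y) = ∑ x', M x x' (ro I x' f) y := by
  rw [← ro_apply]
  change ro I x (repFun M f) y = _
  rw [ro_repFun]
  rw [lp.coeFn_sum, Finset.sum_apply]

lemma repHom_injective : Function.Injective (repHom X I) := by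
  rw [injective_iff_map_eq_zero]
  intro M hM
  ext x x' f y
  have := repHom_apply M (io I x' f) x y
  rw [hM] at this
  simp only [ro_io] at this
  rw [Finset.sum_eq_single x'] at this
  · simpa using this.symm
  · intro z _ hz
    simp [hz.symm]
  · simp

lemma repHom_monM (g : X ≃ X) (c : X → Circle) (k : I ≃ I) (χ : I → Circle) :
    repHom X I (monM g c (mon k χ).toContinuousLinearMap)
      = (mon (g.prodCongr k) (fun j => c j.1 * χ j.2)).toContinuousLinearMap := by
  ext f ⟨x, y⟩
  rw [repHom_apply]
  simp only [monM_apply]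
  rw [Finset.sum_eq_single (g.symm x)]
  · simp [ro_apply, mul_assoc]
  · intro x' _ h
    simp [h.symm]
  · simp

end matrices

end NoUniv

namespace NoUniv

abbrev P := Tor × Tor

def shA : P ≃+ P where
  toFun t := (t.1 + t.2, t.2)
  invFun t := (t.1 - t.2, t.2)
  left_inv t := by simp
  right_inv t := by simp
  map_add' s t := by ext <;> simp; abel

def shB : P ≃+ P where
  toFun t := (t.1, t.2 + t.1)
  invFun t := (t.1, t.2 - t.1)
  left_inv t := by simp
  right_inv t := by simp
  map_add' s t := by ext <;> simp; abel

def gen : Fin 5 → (P ≃+ P) :=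
  ![AddEquiv.refl P, AddEquiv.refl P, AddEquiv.refl P, shA, shB]

noncomputable def chr : Fin 5 → P → Circle :=
  ![fun _ => 1, fun t => t.1.toCircle, fun t => t.2.toCircle, fun _ => 1, fun _ => 1]

lemma chr_sub (i : Fin 5) (s t : P) : chr i (s - t) = (chr i t)⁻¹ * chr i s := by
  fin_cases i <;> simp [chr, sub_eq_add_neg, AddCircle.toCircle_add, AddCircle.toCircle_neg, mul_comm]

lemma chr_zero (i : Fin 5) : chr i 0 = 1 := by
  fin_cases i <;> simp [chr]

def Orb (S : Set ℕ) : Type := {t : P // addOrderOf t ∈ S}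

def act (S : Set ℕ) (g : P ≃+ P) : Orb S ≃ Orb S :=
  g.toEquiv.subtypeEquiv (fun t => by
    have : addOrderOf (g t) = addOrderOf t := addOrderOf_injective g.toAddMonoidHom g.injective t
    change _ ↔ addOrderOf (g t) ∈ S
    rw [this])

lemma act_val (S : Set ℕ) (g : P ≃+ P) (t : Orb S) : (act S g t).1 = g t.1 := rfl

lemma act_symm_val (S : Set ℕ) (g : P ≃+ P) (t : Orb S) : ((act S g).symm t).1 = g.symm t.1 := rfl

noncomputable def uu (S : Set ℕ) (i : Fin 5) : L2 (Orb S) →L[ℂ] L2 (Orb S) :=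
  (mon (act S (gen i)) (fun t => chr i t.1)).toContinuousLinearMap

noncomputable def WW (R S : Set ℕ) (i : Fin 5) : L2 (Orb R × Orb S) →ₗᵢ[ℂ] L2 (Orb R × Orb S) :=
  mon ((act R (gen i)).prodCongr (act S (gen i))) (fun j => (chr i j.1.1)⁻¹ * chr i j.2.1)

lemma par {H : Type} [NormedAddCommGroup H] [InnerProductSpace ℂ H] {f g r : H} {N δ : ℝ}
    (hδ : 0 ≤ δ) (hδ1 : δ ≤ 2) (hf : ‖f‖ = N) (hg : ‖g‖ = N) (hr : ‖r‖ ≤ 3 * N)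
    (h : (5 - δ) * N ≤ ‖f + g + r‖) :
    ‖g - f‖ ^ 2 ≤ 4 * δ * N ^ 2 := by
  have hN : 0 ≤ N := hf ▸ norm_nonneg f
  have h1 : ‖f + g + r‖ ≤ ‖f + g‖ + 3 * N := (norm_add_le _ _).trans (by linarith)
  have h2 : (2 - δ) * N ≤ ‖f + g‖ := by linarith
  have h3 := parallelogram_law_with_norm ℂ g f
  rw [add_comm g f, hf, hg] at h3
  have h4 : ((2 - δ) * N) * ((2 - δ) * N) ≤ ‖f + g‖ * ‖f + g‖ :=
    mul_self_le_mul_self (mul_nonneg (by linarith) hN) h2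
  nlinarith [sq_nonneg (δ * N)]

lemma norm_upper (R S : Set ℕ) (h : Disjoint R S) :
    ‖∑ i, (WW R S i).toContinuousLinearMap‖ ≤ 5 - 1 / 400 := by
  refine ContinuousLinearMap.opNorm_le_bound _ (by norm_num) fun f => ?_
  by_contra! hc
  set N := ‖f‖ with hN
  have hW : ∀ i, ‖WW R S i f‖ = N := fun i => (WW R S i).norm_map f
  have hs : (∑ i, (WW R S i).toContinuousLinearMap) f = ∑ i, WW R S i f := by
    rw [sum_apply]; rfl
  rw [hs, Fin.sum_univ_five] at hc
  have W0 : WW R S 0 f = f := by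
    ext ⟨x, y⟩
    simp [WW, chr, gen]
    rfl
  rw [W0] at hc
  have t3 : ∀ a b c : L2 (Orb R × Orb S), ‖a‖ = N → ‖b‖ = N → ‖c‖ = N → ‖a + b + c‖ ≤ 3 * N := by
    intro a b c ha hb hc
    have := norm_add₃_le (a := a) (b := b) (c := c)
    linarith
  have k1 := par (δ := 1 / 400) (by norm_num) (by norm_num) hN.symm (hW 1)
    (t3 _ _ _ (hW 2) (hW 3) (hW 4)) (by
      refine hc.le.trans (le_of_eq ?_); congr 1; abel)
  have k2 := par (δ := 1 / 400) (by norm_num) (by norm_num) hN.symm (hW 2)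
    (t3 _ _ _ (hW 1) (hW 3) (hW 4)) (by
      refine hc.le.trans (le_of_eq ?_); congr 1; abel)
  have k3 := par (δ := 1 / 400) (by norm_num) (by norm_num) hN.symm (hW 3)
    (t3 _ _ _ (hW 1) (hW 2) (hW 4)) (by
      refine hc.le.trans (le_of_eq ?_); congr 1; abel)
  have k4 := par (δ := 1 / 400) (by norm_num) (by norm_num) hN.symm (hW 4)
    (t3 _ _ _ (hW 1) (hW 2) (hW 3)) (by
      refine hc.le.trans (le_of_eq ?_); congr 1; abel)
  have W1 : WW R S 1 f = mon (Equiv.refl _) (fun j => (j.2.1 - j.1.1).1.toCircle) f := by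
    ext ⟨x, y⟩
    rw [WW, mon_apply, mon_apply, ← chr_sub]
    rfl
  have W2 : WW R S 2 f = mon (Equiv.refl _) (fun j => (j.2.1 - j.1.1).2.toCircle) f := by
    ext ⟨x, y⟩
    rw [WW, mon_apply, mon_apply, ← chr_sub]
    rfl
  have W3 : WW R S 3 f = mon ((act R shA).prodCongr (act S shA)) (fun _ => 1) f := by
    ext ⟨x, y⟩
    rw [WW, mon_apply, mon_apply, ← chr_sub]
    rfl
  have W4 : WW R S 4 f = mon ((act R shB).prodCongr (act S shB)) (fun _ => 1) f := by
    ext ⟨x, y⟩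
    rw [WW, mon_apply, mon_apply, ← chr_sub]
    rfl
  rw [W1] at k1
  rw [W2] at k2
  rw [W3] at k3
  rw [W4] at k4
  have := core (J := Orb R × Orb S) (fun j => (j.2.1 - j.1.1).1) (fun j => (j.2.1 - j.1.1).2)
    (by
      rintro ⟨x, y⟩ ⟨h1, h2⟩
      have : y.1 - x.1 = 0 := Prod.ext h1 h2
      have e := sub_eq_zero.1 this
      exact Set.disjoint_left.1 h x.2 (e ▸ y.2))
    ((act R shA).prodCongr (act S shA)) ((act R shB).prodCongr (act S shB))
    (by
      rintro ⟨x, y⟩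
      refine ⟨?_, rfl⟩
      change (y.1.1 + y.1.2) - (x.1.1 + x.1.2) = (y.1.1 - x.1.1) + (y.1.2 - x.1.2)
      abel)
    (by
      rintro ⟨x, y⟩
      refine ⟨rfl, ?_⟩
      change (y.1.2 + y.1.1) - (x.1.2 + x.1.1) = (y.1.2 - x.1.2) + (y.1.1 - x.1.1)
      abel)
    f k1 k2 k3 k4
  rw [← hN] at this
  have hNp : 0 < N := by
    have h0 : 0 ≤ N := norm_nonneg f
    rcases h0.lt_or_eq with h | h
    · exact h
    · exfalso
      have hf : f = 0 := norm_eq_zero.1 (hN.symm.trans h.symm)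
      rw [hf, ← h] at hc
      simp at hc
  nlinarith [mul_pos hNp hNp]

lemma norm_lower (R S : Set ℕ) (h : R ⊆ S) [Fintype (Orb R)] [Nonempty (Orb R)] :
    5 ≤ ‖∑ i, (WW R S i).toContinuousLinearMap‖ := by
  classical
  set f : L2 (Orb R × Orb S) := ∑ x : Orb R, lp.single 2 (x, (⟨x.1, h x.2⟩ : Orb S)) (1 : ℂ) with hf
  have fa : ∀ x y, f (x, y) = if x.1 = y.1 then 1 else 0 := by
    intro x y
    rw [hf, lp.coeFn_sum, Finset.sum_apply, Finset.sum_eq_single x]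
    · rw [lp.single_apply, Pi.single_apply]
      congr 1
      rw [eq_iff_iff]
      constructor
      · intro e; exact (congrArg (fun z : Orb R × Orb S => z.2.1) e).symm
      · intro e; exact Prod.ext rfl (Subtype.ext e.symm)
    · intro x' _ hx
      apply lp.single_apply_ne
      intro e; exact hx (congrArg Prod.fst e).symm
    · simp
  have fW : ∀ i, WW R S i f = f := by
    intro i
    ext ⟨x, y⟩
    rw [WW, mon_apply, ← chr_sub]
    change _ * f ((act R (gen i)).symm x, (act S (gen i)).symm y) = _
    rw [fa, fa, act_symm_val, act_symm_val]
    by_cases e : x.1 = y.1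
    · simp [e, chr_zero]
    · have : ¬ ((gen i).symm x.1 = (gen i).symm y.1) := fun h => e ((gen i).symm.injective h)
      simp [e, this]
  have hn : 0 < ‖f‖ := by
    rw [norm_pos_iff]
    intro h0
    obtain ⟨x⟩ := (inferInstance : Nonempty (Orb R))
    have := fa x ⟨x.1, h x.2⟩
    rw [h0] at this
    simp at this
  have hs : (∑ i, (WW R S i).toContinuousLinearMap) f = (5 : ℂ) • f := by
    rw [sum_apply]
    change ∑ i, WW R S i f = _
    simp only [fW]
    ext j
    simp
  have := (∑ i, (WW R S i).toContinuousLinearMap).le_opNorm f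
  rw [hs, norm_smul] at this
  simp only [Complex.norm_ofNat] at this
  exact le_of_mul_le_mul_right this hn

lemma orb_finite (m : ℕ) : Finite (Orb {m + 1}) := by
  have h := AddCircle.finite_torsion (1 : ℝ) (Nat.succ_pos m)
  refine Set.Finite.subset (h.prod h) ?_
  intro t ht
  have h1 : addOrderOf t = m + 1 := ht
  have h2 : (m + 1) • t = 0 := by rw [← h1]; exact addOrderOf_nsmul_eq_zero t
  exact ⟨congrArg Prod.fst h2, congrArg Prod.snd h2⟩

lemma orb_nonempty (m : ℕ) : Nonempty (Orb {m + 1}) := by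
  haveI : Fact ((0 : ℝ) < 1) := ⟨one_pos⟩
  refine ⟨⟨(((1 / ((m + 1 : ℕ) : ℝ) : ℝ) : Tor), 0), ?_⟩⟩
  have := AddCircle.addOrderOf_period_div (p := (1 : ℝ)) (Nat.succ_pos m)
  rw [Set.mem_singleton_iff, Prod.addOrderOf]
  simpa using this

noncomputable abbrev BS (S : Set ℕ) : StarSubalgebra ℂ (L2 (Orb S) →L[ℂ] L2 (Orb S)) :=
  (StarAlgebra.adjoin ℂ (Set.range (uu S))).topologicalClosure

instance (S : Set ℕ) : IsClosed (BS S : Set (L2 (Orb S) →L[ℂ] L2 (Orb S))) :=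
  StarSubalgebra.isClosed_topologicalClosure _

noncomputable def uB (S : Set ℕ) (i : Fin 5) : BS S :=
  ⟨uu S i, StarSubalgebra.le_topologicalClosure _ (StarAlgebra.subset_adjoin ℂ _ ⟨i, rfl⟩)⟩

lemma BS_sep (S : Set ℕ) : TopologicalSpace.SeparableSpace (BS S) := by
  apply TopologicalSpace.IsSeparable.separableSpace
  rw [StarSubalgebra.topologicalClosure_coe]
  apply TopologicalSpace.IsSeparable.closure
  have h1 : ((StarAlgebra.adjoin ℂ (Set.range (uu S)) : StarSubalgebra ℂ _) : Set (L2 (Orb S) →L[ℂ] L2 (Orb S)))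
      = (Submodule.span ℂ (Submonoid.closure (Set.range (uu S) ∪ star (Set.range (uu S))) :
        Set (L2 (Orb S) →L[ℂ] L2 (Orb S))) : Set _) := by
    rw [← StarAlgebra.adjoin_eq_span]; rfl
  rw [h1]
  apply TopologicalSpace.IsSeparable.span
  apply Set.Countable.isSeparable
  have hc : (Set.range (uu S) ∪ star (Set.range (uu S))).Countable :=
    ((Set.finite_range _).union (Set.finite_range _).star).countable
  have := hc.to_subtype
  rw [Submonoid.closure_eq_image_prod]
  refine Set.Countable.image ?_ _
  refine (Set.countable_range (fun l : List ↥(Set.range (uu S) ∪ star (Set.range (uu S))) =>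
    l.map Subtype.val)).mono ?_
  intro l hl
  exact ⟨l.attach.map (fun z => ⟨z.1, hl z.1 z.2⟩), by simp⟩

set_option maxHeartbeats 2000000 in
lemma norm_eq (m : ℕ) [Fintype (Orb {m})] [DecidableEq (Orb {m})] (S : Set ℕ) {A : Type} [NonUnitalCStarAlgebra A]
    [PartialOrder A] [StarOrderedRing A] (φ : BS S →⋆ₙₐ[ℂ] A) (hφ : Function.Injective φ) :
    ‖∑ i, monM (act {m} (gen i)) (fun x => (chr i x.1)⁻¹) (φ (uB S i))‖
      = ‖∑ i, (WW {m} S i).toContinuousLinearMap‖ := by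
  letI : PartialOrder (BS S) := CStarAlgebra.spectralOrder _
  letI : StarOrderedRing (BS S) := CStarAlgebra.spectralOrderedRing _
  set M : CStarMatrix (Orb {m}) (Orb {m}) (BS S) :=
    ∑ i, monM (act {m} (gen i)) (fun x => (chr i x.1)⁻¹) (uB S i) with hM
  have e1 : CStarMatrix.mapₙₐ φ M
      = ∑ i, monM (act {m} (gen i)) (fun x => (chr i x.1)⁻¹) (φ (uB S i)) := by
    rw [hM, map_sum]
    refine Finset.sum_congr rfl fun i _ => ?_
    ext x x'
    change φ (monM _ _ _ x x') = _
    rw [monM_apply, monM_apply]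
    split_ifs <;> simp
  set ι : BS S →⋆ₙₐ[ℂ] (L2 (Orb S) →L[ℂ] L2 (Orb S)) :=
    StarAlgHom.toNonUnitalStarAlgHom (BS S).subtype
  have e2 : repHom (Orb {m}) (Orb S) (CStarMatrix.mapₙₐ ι M)
      = ∑ i, (WW {m} S i).toContinuousLinearMap := by
    rw [hM, map_sum, map_sum]
    refine Finset.sum_congr rfl fun i _ => ?_
    refine Eq.trans ?_ (repHom_monM (act {m} (gen i)) (fun x => (chr i x.1)⁻¹)
      (act S (gen i)) (fun t => chr i t.1))
    congr 1
    ext1 x x'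
    change ι (monM _ _ _ x x') = _
    rw [monM_apply, monM_apply]
    split_ifs
    · rw [map_smul]; rfl
    · simp
  have i1 : Function.Injective (CStarMatrix.mapₙₐ (n := Orb {m}) φ) :=
    fun M N h => CStarMatrix.map_injective hφ h
  have i2 : Function.Injective ((repHom (Orb {m}) (Orb S)).comp (CStarMatrix.mapₙₐ ι)) :=
    repHom_injective.comp (fun M N h => CStarMatrix.map_injective Subtype.val_injective h)
  rw [← e1, ← e2, NonUnitalStarAlgHom.norm_map _ i1]
  exact (NonUnitalStarAlgHom.norm_map _ i2 M).symm

end NoUniv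

namespace NoUniv

lemma sep_main {A : Type} [NonUnitalCStarAlgebra A] (S S' : Set ℕ) (m : ℕ) (hm : m + 1 ∈ S)
    (hm' : m + 1 ∉ S') (φ : BS S →⋆ₙₐ[ℂ] A) (hφ : Function.Injective φ)
    (φ' : BS S' →⋆ₙₐ[ℂ] A) (hφ' : Function.Injective φ') (d : Fin 5 → A)
    (h1 : ∀ i, ‖φ (uB S i) - d i‖ ≤ 1 / 10000) (h2 : ∀ i, ‖φ' (uB S' i) - d i‖ ≤ 1 / 10000) :
    False := by
  classical
  let _ : PartialOrder A := CStarAlgebra.spectralOrder _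
  have _ : StarOrderedRing A := CStarAlgebra.spectralOrderedRing _
  have := orb_finite m
  have := orb_nonempty m
  let _ : Fintype (Orb {m + 1}) := Fintype.ofFinite _
  have l := norm_lower {m + 1} S (by simpa using hm)
  have u := norm_upper {m + 1} S' (by simpa using hm')
  rw [← norm_eq (m + 1) S φ hφ] at l
  rw [← norm_eq (m + 1) S' φ' hφ'] at u
  have k : ‖(∑ i, monM (act {m + 1} (gen i)) (fun x => (chr i x.1)⁻¹) (φ (uB S i)))
      - ∑ i, monM (act {m + 1} (gen i)) (fun x => (chr i x.1)⁻¹) (φ' (uB S' i))‖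
        ≤ ∑ _i : Fin 5, (2 / 10000 : ℝ) := by
    rw [← Finset.sum_sub_distrib]
    refine norm_sum_le_of_le _ fun i _ => ?_
    rw [← monM_sub]
    refine (norm_monM_le _ _ _).trans ?_
    have := norm_sub_le_norm_sub_add_norm_sub (φ (uB S i)) (d i) (φ' (uB S' i))
    have h2' := h2 i
    rw [norm_sub_rev] at h2'
    linarith [h1 i]
  have k2 := norm_sub_norm_le (∑ i, monM (act {m + 1} (gen i)) (fun x => (chr i x.1)⁻¹) (φ (uB S i)))
      (∑ i, monM (act {m + 1} (gen i)) (fun x => (chr i x.1)⁻¹) (φ' (uB S' i)))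
  simp only [Finset.sum_const, Finset.card_univ, Fintype.card_fin, nsmul_eq_mul] at k
  norm_num at k u
  linarith

end NoUniv

/-- For every infinite cardinal `κ < 2^ℵ₀` there is no `κ`-universal C*-algebra. -/
theorem no_universal_CStarAlgebra_of_lt_continuum
    (κ : Cardinal) (hκ : Cardinal.aleph0 ≤ κ) (hlt : κ < (2 : Cardinal) ^ Cardinal.aleph0) :
    ¬ ∃ (A : Type) (_ : NonUnitalCStarAlgebra A), densityCharacter A = κ ∧
        ∀ (B : Type) (_ : NonUnitalCStarAlgebra B), densityCharacter B ≤ κ →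
          ∃ φ : B →⋆ₙₐ[ℂ] A, Function.Injective φ := by
  rintro ⟨A, _, hA, huniv⟩
  obtain ⟨D, hD, hDκ⟩ : ∃ s : Set A, Dense s ∧ #s = κ := by
    rw [← hA]
    exact csInf_mem (s := {c : Cardinal | ∃ s : Set A, Dense s ∧ #s = c})
      ⟨_, Set.univ, dense_univ, rfl⟩
  let T : Set ℕ → Set ℕ := fun S => Nat.succ '' S
  have hB : ∀ S, densityCharacter (NoUniv.BS S) ≤ κ := by
    intro S
    have := NoUniv.BS_sep S
    obtain ⟨s, hs, hd⟩ := TopologicalSpace.exists_countable_dense (NoUniv.BS S)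
    refine le_trans ?_ hκ
    have hmem : #s ∈ {c : Cardinal | ∃ s : Set (NoUniv.BS S), Dense s ∧ #s = c} := ⟨s, hd, rfl⟩
    refine (csInf_le' hmem).trans ?_
    exact Cardinal.le_aleph0_iff_set_countable.2 hs
  have hφ : ∀ S : Set ℕ, ∃ φ : NoUniv.BS (T S) →⋆ₙₐ[ℂ] A, Function.Injective φ :=
    fun S => huniv (NoUniv.BS (T S)) inferInstance (hB _)
  choose φ hφi using hφ
  have hd : ∀ (S : Set ℕ) (i : Fin 5), ∃ d : D, ‖φ S (NoUniv.uB (T S) i) - d‖ ≤ 1 / 10000 := by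
    intro S i
    obtain ⟨d, hdD, hd⟩ := hD.exists_dist_lt (φ S (NoUniv.uB (T S) i))
      (ε := 1 / 10000) (by norm_num)
    exact ⟨⟨d, hdD⟩, by rw [← dist_eq_norm]; exact hd.le⟩
  choose d hd using hd
  have key : ∀ S S' : Set ℕ, d S = d S' → S ⊆ S' := by
    intro S S' h m hm
    by_contra hm'
    refine NoUniv.sep_main (T S) (T S') m ⟨m, hm, rfl⟩ ?_ (φ S) (hφi S) (φ S') (hφi S')
      (fun i => d S i) (hd S) (fun i => by rw [h]; exact hd S' i)
    rintro ⟨k, hk, e⟩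
    exact hm' (Nat.succ_injective e ▸ hk)
  have inj : Function.Injective d := fun S S' h => (key S S' h).antisymm (key S' S h.symm)
  have hc := Cardinal.mk_le_of_injective inj
  have e1 : #(Fin 5 → D) = κ := by
    rw [← Cardinal.power_def, hDκ, Cardinal.mk_fin]
    exact_mod_cast Cardinal.power_nat_eq hκ (by norm_num : 1 ≤ 5)
  rw [e1, Cardinal.mk_set, Cardinal.mk_nat] at hc
  exact absurd hlt hc.not_gt
end

section
/- Every C*-algebra A admits an injective *-homomorphism into a simple C*-algebra D whose density character is at most the maximum of ℵ₀ and the density character of A; moreover, if A is unital, then D can be chosen unital and the embedding unital. -/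
open Cardinal

section helpers
open scoped ComplexOrder InnerProductSpace


/-- Enough positive functionals. -/
theorem exists_posFunctional {A : Type*} [CStarAlgebra A] [PartialOrder A] [StarOrderedRing A]
    (a : A) (ha : a ≠ 0) : ∃ f : A →ₚ[ℂ] ℂ, f (star a * a) ≠ 0 := by
  have hn : -(star a * a) ∉ ProperCone.positive ℝ A := by
    intro h
    have h1 : 0 ≤ -(star a * a) := h
    have h2 := star_mul_self_nonneg a
    have h3 : star a * a = 0 := le_antisymm (by simpa using h1) h2
    exact ha (CStarRing.star_mul_self_eq_zero_iff a |>.1 h3)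
  obtain ⟨g, hg, hg0⟩ := ProperCone.hyperplane_separation_point _ hn
  let h : A →ₗ[ℂ] ℂ :=
    { toFun := fun x => (g (realPart x : A) : ℂ) + Complex.I * (g (imaginaryPart x : A) : ℂ)
      map_add' := by intro x y; simp; ring
      map_smul' := by
        intro c x
        apply Complex.ext <;>
        simp [realPart_smul, imaginaryPart_smul] }
  have hh : ∀ x : A, 0 ≤ x → h x = (g x : ℂ) := by
    intro x hx
    have hs : IsSelfAdjoint x := .of_nonneg hx
    show (g (realPart x : A) : ℂ) + Complex.I * (g (imaginaryPart x : A) : ℂ) = _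
    rw [hs.coe_realPart, hs.imaginaryPart]; simp
  refine ⟨PositiveLinearMap.mk₀ h ?_, ?_⟩
  · intro x hx
    rw [hh x hx]
    exact_mod_cast hg x hx
  · show h _ ≠ 0
    rw [hh _ (star_mul_self_nonneg a)]
    simp at hg0
    exact_mod_cast hg0.ne'

theorem gns_ne_zero {A : Type*} [CStarAlgebra A] [PartialOrder A] [StarOrderedRing A]
    (f : A →ₚ[ℂ] ℂ) (a : A) (ha : f (star a * a) ≠ 0) : f.gnsStarAlgHom a ≠ 0 := by
  intro h0
  have h1 : f.gnsNonUnitalStarAlgHom a (f.toPreGNS 1 : f.GNS) = 0 := by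
    have : f.gnsNonUnitalStarAlgHom a = 0 := h0
    rw [this]; rfl
  rw [PositiveLinearMap.gnsNonUnitalStarAlgHom_apply_coe] at h1
  have h2 : ‖f.leftMulMapPreGNS a (f.toPreGNS 1)‖ = 0 := by
    rw [← UniformSpace.Completion.norm_coe, h1, norm_zero]
  apply ha
  have h3 := f.preGNS_norm_sq (f.leftMulMapPreGNS a (f.toPreGNS 1))
  rw [h2] at h3
  simpa using h3.symm

section diag
variable {ι : Type*} {G : ι → Type*} [∀ i, NormedAddCommGroup (G i)]
  [∀ i, InnerProductSpace ℂ (G i)] [∀ i, CompleteSpace (G i)]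

/-- Diagonal operator on a Hilbert sum. -/
noncomputable def diagOp (T : ∀ i, G i →L[ℂ] G i) (C : ℝ) (hC : ∀ i, ‖T i‖ ≤ C) :
    lp G 2 →L[ℂ] lp G 2 :=
  LinearMap.mkContinuousOfExistsBound
    { toFun := fun f => ⟨fun i => T i (f i), by
        have hf := lp.memℓp f
        have h2 : Memℓp (fun i => C • f i) 2 := hf.const_smul C
        refine memℓp_gen ?_
        have h3 := h2.summable (by norm_num)
        refine Summable.of_nonneg_of_le (fun i => by positivity) (fun i => ?_) h3
        have : ‖T i (f i)‖ ≤ ‖C • f i‖ := by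
          rw [norm_smul]
          refine ((T i).le_opNorm _).trans ?_
          gcongr
          exact (hC i).trans (le_abs_self C)
        gcongr⟩
      map_add' := by intro f g; ext i; simp; rfl
      map_smul' := by intro c f; ext i; simp } (by
    refine ⟨|C|, fun f => ?_⟩
    have : ‖|C| • f‖ = |C| * ‖f‖ := by rw [norm_smul]; simp
    rw [← this]
    refine lp.norm_mono (by norm_num) fun i => ?_
    show ‖T i (f i)‖ ≤ ‖|C| • f i‖
    rw [norm_smul]
    refine ((T i).le_opNorm _).trans ?_
    gcongr
    simpa using (hC i).trans (le_abs_self C))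

theorem diagOp_apply (T : ∀ i, G i →L[ℂ] G i) (C : ℝ) (hC : ∀ i, ‖T i‖ ≤ C) (f : lp G 2) (i : ι) :
    diagOp T C hC f i = T i (f i) := rfl

theorem diagOp_single [DecidableEq ι] (T : ∀ i, G i →L[ℂ] G i) (C : ℝ) (hC : ∀ i, ‖T i‖ ≤ C)
    (i : ι) (x : G i) :
    diagOp T C hC (lp.single 2 i x) = lp.single 2 i (T i x) := by
  ext j
  rw [diagOp_apply]
  by_cases h : j = i
  · subst h; simp
  · simp [h]

/-- Direct sum of representations. -/
noncomputable def diagHom {A : Type*} [CStarAlgebra A] (π : ∀ i, A →⋆ₐ[ℂ] (G i →L[ℂ] G i)) :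
    A →⋆ₐ[ℂ] (lp G 2 →L[ℂ] lp G 2) where
  toFun a := diagOp (fun i => π i a) ‖a‖ (fun i => NonUnitalStarAlgHom.norm_apply_le (π i) a)
  map_one' := by ext f i; simp [diagOp_apply]
  map_mul' a b := by ext f i; simp [diagOp_apply]
  map_zero' := by ext f i; simp [diagOp_apply]
  map_add' a b := by ext f i; simp [diagOp_apply]
  commutes' r := by ext f i; simp [diagOp_apply, Algebra.algebraMap_eq_smul_one]
  map_star' a := by
    rw [ContinuousLinearMap.star_eq_adjoint, ContinuousLinearMap.eq_adjoint_iff]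
    intro f g
    rw [lp.inner_eq_tsum, lp.inner_eq_tsum]
    congr 1
    ext i
    rw [diagOp_apply, diagOp_apply, map_star, ContinuousLinearMap.star_eq_adjoint,
      ContinuousLinearMap.adjoint_inner_left]

theorem diagHom_single {A : Type*} [CStarAlgebra A] [DecidableEq ι]
    (π : ∀ i, A →⋆ₐ[ℂ] (G i →L[ℂ] G i)) (a : A) (i : ι) (x : G i) :
    diagHom π a (lp.single 2 i x) = lp.single 2 i (π i a x) :=
  diagOp_single (fun i => π i a) ‖a‖ (fun i => NonUnitalStarAlgHom.norm_apply_le (π i) a) i x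

theorem diagHom_injective {A : Type*} [CStarAlgebra A]
    (π : ∀ i, A →⋆ₐ[ℂ] (G i →L[ℂ] G i)) (h : ∀ a, a ≠ 0 → ∃ i, π i a ≠ 0) :
    Function.Injective (diagHom π) := by
  classical
  rw [injective_iff_map_eq_zero]
  intro a ha
  by_contra hne
  obtain ⟨i, hi⟩ := h a hne
  apply hi
  ext x
  have := diagHom_single π a i x
  rw [ha] at this
  have h2 := congrArg (fun f : lp G 2 => f i) this
  simpa using h2.symm
end diag

theorem exists_rep {A : Type u} [CStarAlgebra A] [Nontrivial A] :
    ∃ (H : Type u) (_ : NormedAddCommGroup H) (_ : InnerProductSpace ℂ H) (_ : CompleteSpace H)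
      (π : A →⋆ₐ[ℂ] (H →L[ℂ] H)), Function.Injective π ∧ ¬ FiniteDimensional ℂ H := by
  classical
  let := CStarAlgebra.spectralOrder A
  have := CStarAlgebra.spectralOrderedRing A
  choose f hf using fun a : {a : A // a ≠ 0} => exists_posFunctional a.1 a.2
  let G : ({a : A // a ≠ 0} × ℕ) → Type u := fun p => (f p.1).GNS
  let π : ∀ p, A →⋆ₐ[ℂ] (G p →L[ℂ] G p) := fun p => (f p.1).gnsStarAlgHom
  refine ⟨lp G 2, inferInstance, inferInstance, inferInstance, diagHom π, ?_, ?_⟩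
  · exact diagHom_injective π fun a ha => ⟨(⟨a, ha⟩, 0), gns_ne_zero _ _ (hf ⟨a, ha⟩)⟩
  · intro hfin
    let one : {a : A // a ≠ 0} := ⟨1, one_ne_zero⟩
    have hx : ∃ x : (f one).GNS, x ≠ 0 := by
      by_contra hcon
      push Not at hcon
      apply gns_ne_zero _ _ (hf one)
      ext x
      simp [hcon]
    obtain ⟨x, hx⟩ := hx
    let v : ℕ → lp G 2 := fun n => lp.single (E := G) 2 (one, n) x
    have hv : LinearIndependent ℂ v := by
      refine linearIndependent_of_ne_zero_of_inner_eq_zero (𝕜 := ℂ) (fun n h => ?_) ?_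
      · have h2 := congrArg (fun f : lp G 2 => f (one, n)) h
        simp [v] at h2
        exact hx h2
      · intro m n hmn
        show ⟪v m, v n⟫_ℂ = 0
        simp only [v]
        rw [lp.inner_single_left]
        simp [hmn]
    exact not_finite_iff_infinite.2 (inferInstance : Infinite ℕ) hv.finite

section cuntz
variable {ι H : Type*} [NormedAddCommGroup H] [InnerProductSpace ℂ H] [CompleteSpace H]

theorem hb_ext (b : HilbertBasis ι ℂ H) {K : Type*} [NormedAddCommGroup K] [NormedSpace ℂ K]
    {S T : H →L[ℂ] K} (h : ∀ i, S (b i) = T (b i)) : S = T := by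
  refine ContinuousLinearMap.ext_on (s := Set.range b) ?_ ?_
  · have := b.dense_span
    rw [← Submodule.dense_iff_topologicalClosure_eq_top] at this
    exact this
  · rintro _ ⟨i, rfl⟩; exact h i

theorem exists_iso (b : HilbertBasis ι ℂ H) (v : ι → H) (hv : Orthonormal ℂ v) :
    ∃ Y : H →ₗᵢ[ℂ] H, ∀ i, Y (b i) = v i := by
  classical
  refine ⟨(OrthogonalFamily.linearIsometry hv.orthogonalFamily).comp
    b.repr.toLinearIsometry, fun i => ?_⟩
  simp [b.repr_self, OrthogonalFamily.linearIsometry_apply_single]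

theorem exists_perm_unitary (b : HilbertBasis ι ℂ H) (p : Equiv.Perm ι) :
    ∃ W : H ≃ₗᵢ[ℂ] H, ∀ i, W (b i) = b (p i) := by
  classical
  have ho : Orthonormal ℂ (fun i => b (p i)) := b.orthonormal.comp _ p.injective
  have hr : Set.range (fun i => b (p i)) = Set.range b := p.surjective.range_comp b
  have hsp : ⊤ ≤ (Submodule.span ℂ (Set.range fun i => b (p i))).topologicalClosure := by
    rw [hr, b.dense_span]
  refine ⟨b.repr.trans (HilbertBasis.mk ho hsp).repr.symm, fun i => ?_⟩
  simp only [LinearIsometryEquiv.trans_apply, b.repr_self, HilbertBasis.repr_symm_single,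
    HilbertBasis.coe_mk]

/-- A Cuntz family indexed by `ι`. -/
theorem exists_V (b : HilbertBasis ι ℂ H) (e : ι × ι ≃ ι) :
    ∃ V : ι → H →ₗᵢ[ℂ] H, ∀ i j, V i (b j) = b (e (i, j)) := by
  have : ∀ i, ∃ Y : H →ₗᵢ[ℂ] H, ∀ j, Y (b j) = b (e (i, j)) := fun i =>
    exists_iso b _ (b.orthonormal.comp (fun j => e (i, j))
      (fun j k h => by simpa using h))
  choose V hV using this
  exact ⟨V, hV⟩

theorem V_orth (b : HilbertBasis ι ℂ H) (e : ι × ι ≃ ι) (V : ι → H →ₗᵢ[ℂ] H)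
    (hV : ∀ i j, V i (b j) = b (e (i, j))) {i k : ι} (hik : i ≠ k) (x y : H) :
    ⟪V i x, V k y⟫_ℂ = 0 := by
  have h1 : (innerSL ℂ (V i x)).comp (V k).toContinuousLinearMap = 0 := by
    refine hb_ext b fun l => ?_
    have h2 : (innerSL ℂ (V k (b l))).comp (V i).toContinuousLinearMap = 0 := by
      refine hb_ext b fun m => ?_
      simp only [ContinuousLinearMap.comp_apply, LinearIsometry.coe_toContinuousLinearMap,
        innerSL_apply_apply, zero_apply, hV]
      refine b.orthonormal.2 ?_
      simp [Ne.symm hik]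
    have h3 := congrArg (fun F => F x) h2
    simp only [ContinuousLinearMap.comp_apply, LinearIsometry.coe_toContinuousLinearMap,
        innerSL_apply_apply, zero_apply] at h3 ⊢
    exact inner_eq_zero_symm.1 h3
  simpa using congrArg (fun F => F y) h1

/-- Forget that a star-isomorphism is invertible. -/
noncomputable def starHomOfEquiv {A B : Type*} [CStarAlgebra A] [CStarAlgebra B]
    (e : A ≃⋆ₐ[ℂ] B) : A →⋆ₐ[ℂ] B := (e : A →⋆ₐ[ℂ] B)

theorem exists_alpha (b : HilbertBasis ι ℂ H) (e : ι × ι ≃ ι) (V : ι → H →ₗᵢ[ℂ] H)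
    (hV : ∀ i j, V i (b j) = b (e (i, j))) :
    ∃ α : (H →L[ℂ] H) →⋆ₐ[ℂ] (H →L[ℂ] H), ∀ T i x, α T (V i x) = V i (T x) := by
  classical
  have hs : IsHilbertSum ℂ (fun _ : ι => H) V := by
    refine IsHilbertSum.mk (fun i k hik x y => V_orth b e V hV hik x y) ?_
    rw [← b.dense_span]
    refine Submodule.topologicalClosure_mono ?_
    rw [Submodule.span_le]
    rintro _ ⟨i, rfl⟩
    refine Submodule.mem_iSup_of_mem (e.symm i).1 ⟨b (e.symm i).2, ?_⟩
    simp [hV]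
  let U := hs.linearIsometryEquiv
  refine ⟨(starHomOfEquiv U.symm.conjStarAlgEquiv).comp
    (diagHom (fun _ : ι => StarAlgHom.id ℂ (H →L[ℂ] H))), fun T i x => ?_⟩
  have h1 : U (V i x) = lp.single 2 i x := by
    rw [← hs.linearIsometryEquiv_symm_apply_single]
    exact U.apply_symm_apply _
  show U.symm (diagHom (fun _ : ι => StarAlgHom.id ℂ (H →L[ℂ] H)) T (U (V i x))) = _
  rw [h1, diagHom_single]
  exact hs.linearIsometryEquiv_symm_apply_single _

theorem exists_beta (b : HilbertBasis ι ℂ H) (e : ι × ι ≃ ι) (V : ι → H →ₗᵢ[ℂ] H)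
    (hV : ∀ i j, V i (b j) = b (e (i, j))) (α : (H →L[ℂ] H) →⋆ₐ[ℂ] (H →L[ℂ] H))
    (hα : ∀ T i x, α T (V i x) = V i (T x)) :
    ∃ β : (H →L[ℂ] H) ≃⋆ₐ[ℂ] (H →L[ℂ] H), ∀ T, β (α T) = α (α T) := by
  -- the permutation e(e(i,j),k) ↦ e(i,e(j,k))
  let p : Equiv.Perm ι := e.symm.trans <| (e.symm.prodCongr (Equiv.refl ι)).trans <|
    (Equiv.prodAssoc ι ι ι).trans <| ((Equiv.refl ι).prodCongr e).trans e
  have hp : ∀ i j k, p (e (e (i, j), k)) = e (i, e (j, k)) := by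
    intro i j k; simp [p]
  obtain ⟨W, hW⟩ := exists_perm_unitary b p
  have hWV : ∀ i j x, W (V (e (i, j)) x) = V i (V j x) := by
    intro i j x
    have : (W.toLinearIsometry.comp (V (e (i, j)))).toContinuousLinearMap =
        ((V i).comp (V j)).toContinuousLinearMap := by
      refine hb_ext b fun k => ?_
      simp [hV, hW, hp]
    exact congrArg (fun F => F x) this
  refine ⟨W.conjStarAlgEquiv, fun T => ?_⟩
  have key : W.toContinuousLinearEquiv.toContinuousLinearMap.comp (α T) =
      (α (α T)).comp W.toContinuousLinearEquiv.toContinuousLinearMap := by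
    refine hb_ext b fun m => ?_
    obtain ⟨⟨n, k⟩, rfl⟩ := e.surjective m
    obtain ⟨⟨i, j⟩, rfl⟩ := e.surjective n
    rw [← hV]
    simp only [ContinuousLinearMap.comp_apply]
    show W (α T (V _ _)) = α (α T) (W (V _ _))
    rw [hα, hWV, hWV, hα, hα]
  ext x
  have := congrArg (fun F => F (W.symm x)) key
  simp only [ContinuousLinearMap.comp_apply] at this
  rw [LinearIsometryEquiv.conjStarAlgEquiv_apply_apply]
  refine this.trans ?_
  show α (α T) (W (W.symm x)) = _
  rw [W.apply_symm_apply]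

theorem exists_xy (b : HilbertBasis ι ℂ H) (e : ι × ι ≃ ι) (V : ι → H →ₗᵢ[ℂ] H)
    (hV : ∀ i j, V i (b j) = b (e (i, j))) (α : (H →L[ℂ] H) →⋆ₐ[ℂ] (H →L[ℂ] H))
    (hα : ∀ T i x, α T (V i x) = V i (T x)) (T : H →L[ℂ] H) (hT : T ≠ 0) :
    ∃ x y : H →L[ℂ] H, x * α T * y = 1 ∧ ‖x‖ ≤ 2 / ‖T‖ ∧ ‖y‖ ≤ 1 := by
  have hTn : 0 < ‖T‖ := norm_pos_iff.2 hT
  obtain ⟨ξ, hξ⟩ : ∃ ξ, ‖T‖ / 2 * ‖ξ‖ < ‖T ξ‖ := by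
    by_contra hcon
    push Not at hcon
    have := T.opNorm_le_bound (by positivity) hcon
    linarith
  have hTξ : 0 < ‖T ξ‖ := lt_of_le_of_lt (by positivity) hξ
  have hξ0 : 0 < ‖ξ‖ := by
    rw [norm_pos_iff]; rintro rfl; simp at hTξ
  have orth : ∀ η : H, ‖η‖ = 1 → Orthonormal ℂ (fun j => V j η) := fun η hη =>
    ⟨fun i => by simpa using hη, fun i k hik => V_orth b e V hV hik η η⟩
  let ξ' : H := ((‖ξ‖⁻¹ : ℝ) : ℂ) • ξ
  let η : H := ((‖T ξ‖⁻¹ : ℝ) : ℂ) • T ξ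
  have hξ' : ‖ξ'‖ = 1 := by
    simp [ξ', norm_smul, hξ0.ne']
  have hη : ‖η‖ = 1 := by
    simp [η, norm_smul, hTξ.ne']
  obtain ⟨Y, hY⟩ := exists_iso b _ (orth ξ' hξ')
  obtain ⟨Z, hZ⟩ := exists_iso b _ (orth η hη)
  let c : ℝ := ‖T ξ‖ / ‖ξ‖
  have hc : 0 < c := by positivity
  have hcT : ‖T‖ / 2 < c := by rw [lt_div_iff₀ hξ0]; exact hξ
  have hY1 : α T * Y.toContinuousLinearMap = (c : ℂ) • Z.toContinuousLinearMap := by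
    refine hb_ext b fun j => ?_
    show α T (Y (b j)) = (c : ℂ) • Z (b j)
    rw [hY, hα, hZ, ← map_smul]
    congr 1
    simp only [ξ', η, map_smul, smul_smul]
    congr 1
    norm_cast
    simp only [c]
    field_simp
  have hZZ : star Z.toContinuousLinearMap * Z.toContinuousLinearMap = 1 := by
    rw [ContinuousLinearMap.star_eq_adjoint]
    exact (ContinuousLinearMap.norm_map_iff_adjoint_comp_self _).1 (fun x => Z.norm_map x)
  refine ⟨((c⁻¹ : ℝ) : ℂ) • star Z.toContinuousLinearMap, Y.toContinuousLinearMap, ?_, ?_, ?_⟩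
  · rw [mul_assoc, hY1, smul_mul_smul_comm, hZZ]
    rw [← Complex.ofReal_mul, inv_mul_cancel₀ hc.ne']; simp
  · rw [norm_smul, norm_star]
    have h1 : ‖Z.toContinuousLinearMap‖ ≤ 1 := Z.norm_toContinuousLinearMap_le
    have h2 : ‖((c⁻¹ : ℝ) : ℂ)‖ = c⁻¹ := by simp [abs_of_pos hc]
    rw [h2]
    calc c⁻¹ * ‖Z.toContinuousLinearMap‖ ≤ c⁻¹ * 1 := by gcongr
      _ ≤ (‖T‖ / 2)⁻¹ := by rw [mul_one]; gcongr
      _ = 2 / ‖T‖ := by rw [inv_div]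
  · exact Y.norm_toContinuousLinearMap_le

/-- Iterates of an endomorphism. -/
noncomputable def iterHom {B : Type*} [CStarAlgebra B] (β : B ≃⋆ₐ[ℂ] B) : ℕ → (B →⋆ₐ[ℂ] B)
  | 0 => StarAlgHom.id ℂ B
  | n + 1 => (β : B →⋆ₐ[ℂ] B).comp (iterHom β n)

theorem iterHom_bij {B : Type*} [CStarAlgebra B] (β : B ≃⋆ₐ[ℂ] B) (n : ℕ) :
    Function.Bijective (iterHom β n) := by
  induction n with
  | zero => exact Function.bijective_id
  | succ n ih => exact β.bijective.comp ih

theorem iterHom_mem {B : Type*} [CStarAlgebra B] (β : B ≃⋆ₐ[ℂ] B) (α : B →⋆ₐ[ℂ] B)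
    (h : ∀ T, β (α T) = α (α T)) {n m : ℕ} (hnm : n ≤ m) {a : B}
    (ha : iterHom β n a ∈ α.range) : iterHom β m a ∈ α.range := by
  induction m, hnm using Nat.le_induction with
  | base => exact ha
  | succ m _ ih =>
    obtain ⟨T, hT⟩ := ih
    refine ⟨α T, ?_⟩
    show α (α T) = β (iterHom β m a)
    rw [← h, ← hT]; rfl

/-- The (algebraic) inductive limit inside `B`. -/
noncomputable def limAlg {B : Type*} [CStarAlgebra B] (β : B ≃⋆ₐ[ℂ] B) (α : B →⋆ₐ[ℂ] B)
    (h : ∀ T, β (α T) = α (α T)) : StarSubalgebra ℂ B where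
  carrier := {a | ∃ n, iterHom β n a ∈ α.range}
  mul_mem' := by
    rintro a b ⟨n, hn⟩ ⟨m, hm⟩
    refine ⟨max n m, ?_⟩
    rw [map_mul]
    exact mul_mem (iterHom_mem β α h (le_max_left _ _) hn) (iterHom_mem β α h (le_max_right _ _) hm)
  add_mem' := by
    rintro a b ⟨n, hn⟩ ⟨m, hm⟩
    refine ⟨max n m, ?_⟩
    rw [map_add]
    exact add_mem (iterHom_mem β α h (le_max_left _ _) hn) (iterHom_mem β α h (le_max_right _ _) hm)
  algebraMap_mem' r := ⟨0, by rw [AlgHomClass.commutes]; exact algebraMap_mem _ r⟩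
  star_mem' := by
    rintro a ⟨n, hn⟩
    refine ⟨n, ?_⟩
    rw [map_star]
    exact star_mem hn

/-- Every unital C*-algebra embeds in a purely infinite star-subalgebra. -/
theorem exists_big {A : Type u} [CStarAlgebra A] [Nontrivial A] :
    ∃ (B : Type u) (_ : CStarAlgebra B) (E : StarSubalgebra ℂ B) (ψ : A →⋆ₐ[ℂ] B),
      Nontrivial B ∧
      Function.Injective ψ ∧ (∀ a, ψ a ∈ E) ∧
      ∀ a ∈ E, a ≠ 0 → ∃ x ∈ E, ∃ y ∈ E, x * a * y = 1 ∧ ‖x‖ ≤ 2 / ‖a‖ ∧ ‖y‖ ≤ 1 := by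
  obtain ⟨H, _, _, _, π, hπ, hinf⟩ := exists_rep (A := A)
  obtain ⟨w, b, -⟩ := exists_hilbertBasis ℂ H
  have hw : Infinite w := by
    rw [← not_finite_iff_infinite]
    intro hfin
    have := Fintype.ofFinite w
    exact hinf (Module.Basis.finiteDimensional_of_finite b.toOrthonormalBasis.toBasis)
  obtain ⟨e⟩ : Nonempty (w × w ≃ w) := by
    rw [← Cardinal.eq, Cardinal.mk_prod]
    simpa using Cardinal.mul_eq_self (Cardinal.aleph0_le_mk w)
  obtain ⟨V, hV⟩ := exists_V b e
  obtain ⟨α, hα⟩ := exists_alpha b e V hV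
  obtain ⟨β, hβ⟩ := exists_beta b e V hV α hα
  obtain ⟨i₀⟩ : Nonempty w := inferInstance
  have hαi : Function.Injective α := by
    rw [injective_iff_map_eq_zero]
    intro T hT
    ext x
    have := hα T i₀ x
    rw [hT] at this
    apply (V i₀).injective
    rw [← this]; simp
  have hψ : Function.Injective (α.comp π) := hαi.comp hπ
  refine ⟨H →L[ℂ] H, inferInstance, limAlg β α hβ, α.comp π, hψ.nontrivial, hψ, ?_, ?_⟩
  · intro a
    exact ⟨0, π a, rfl⟩
  · rintro a ⟨n, T, hT⟩ ha
    have hT : α T = iterHom β n a := hT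
    have hni : ∀ n c, ‖iterHom β n c‖ = ‖c‖ := fun n c =>
      NonUnitalStarAlgHom.norm_map _ (iterHom_bij β n).1 c
    have hnα : ∀ c, ‖α c‖ = ‖c‖ := fun c => NonUnitalStarAlgHom.norm_map _ hαi c
    have hTa : ‖T‖ = ‖a‖ := by rw [← hnα, hT, hni]
    have hT0 : T ≠ 0 := by
      rw [← norm_pos_iff, hTa, norm_pos_iff]; exact ha
    obtain ⟨x, y, hxy, hx, hy⟩ := exists_xy b e V hV α hα T hT0
    obtain ⟨x', hx'⟩ := (iterHom_bij β (n + 1)).2 (α x)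
    obtain ⟨y', hy'⟩ := (iterHom_bij β (n + 1)).2 (α y)
    refine ⟨x', ⟨n + 1, x, hx'.symm⟩, y', ⟨n + 1, y, hy'.symm⟩, ?_, ?_, ?_⟩
    · apply (iterHom_bij β (n + 1)).1
      have : iterHom β (n + 1) a = α (α T) := by
        rw [← hβ, hT]; rfl
      rw [map_mul, map_mul, hx', hy', this, ← map_mul, ← map_mul, hxy, map_one, map_one]
    · rw [← hni (n + 1) x', hx', hnα, ← hTa]; exact hx
    · rw [← hni (n + 1) y', hy', hnα]; exact hy
end cuntz

section LS

theorem exists_closed {B : Type u} {I : Type} [Countable I] (f : I → B → B → B) (S0 E : Set B)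
    (h0 : S0 ⊆ E) (hE : ∀ i, ∀ a ∈ E, ∀ b ∈ E, f i a b ∈ E) :
    ∃ S : Set B, S0 ⊆ S ∧ S ⊆ E ∧ (∀ i, ∀ a ∈ S, ∀ b ∈ S, f i a b ∈ S) ∧
      Cardinal.mk S ≤ max Cardinal.aleph0 (Cardinal.mk S0) := by
  let step : Set B → Set B := fun S => S ∪ Set.range (fun p : I × S × S => f p.1 p.2.1 p.2.2)
  let F : ℕ → Set B := fun n => step^[n] S0
  have hF : ∀ n, F (n + 1) = step (F n) := fun n => Function.iterate_succ_apply' _ _ _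
  have hmono : Monotone F := monotone_nat_of_le_succ fun n => by
    rw [hF]; exact Set.subset_union_left
  have hFE : ∀ n, F n ⊆ E := by
    intro n
    induction n with
    | zero => exact h0
    | succ n ih =>
      rw [hF]
      rintro x (hx | ⟨⟨i, a, b⟩, rfl⟩)
      · exact ih hx
      · exact hE i _ (ih a.2) _ (ih b.2)
  set κ := max Cardinal.aleph0 (Cardinal.mk S0) with hκ
  have hκ0 : Cardinal.aleph0 ≤ κ := le_max_left _ _
  have hcard : ∀ n, Cardinal.mk (F n) ≤ κ := by
    intro n
    induction n with
    | zero => exact le_max_right _ _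
    | succ n ih =>
      rw [hF]
      refine (Cardinal.mk_union_le _ _).trans (Cardinal.add_le_of_le hκ0 ih ?_)
      have h1 := Cardinal.mk_range_le (f := fun p : I × F n × F n => f p.1 p.2.1 p.2.2)
      rw [Cardinal.mk_prod, Cardinal.mk_prod] at h1
      simp only [Cardinal.lift_id, Cardinal.lift_uzero] at h1
      refine le_trans (by simpa using h1) ?_
      refine Cardinal.mul_le_of_le hκ0 ?_ (Cardinal.mul_le_of_le hκ0 ih ih)
      refine le_trans ?_ hκ0
      simp
  refine ⟨⋃ n, F n, Set.subset_iUnion F 0, Set.iUnion_subset hFE, ?_, ?_⟩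
  · intro i a ha b hb
    obtain ⟨n, hn⟩ := Set.mem_iUnion.1 ha
    obtain ⟨m, hm⟩ := Set.mem_iUnion.1 hb
    refine Set.mem_iUnion.2 ⟨max n m + 1, ?_⟩
    rw [hF]
    exact Or.inr ⟨(i, ⟨a, hmono (le_max_left _ _) hn⟩, ⟨b, hmono (le_max_right _ _) hm⟩), rfl⟩
  · have h1 := Cardinal.mk_iUnion_le_lift F
    simp only [Cardinal.lift_uzero, Cardinal.mk_nat, Cardinal.lift_aleph0] at h1
    refine h1.trans ?_
    refine Cardinal.mul_le_of_le hκ0 hκ0 ?_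
    exact ciSup_le' hcard

theorem simple_of_dense {D : Type*} [CStarAlgebra D] (S : Set D) (hd : Dense S)
    (hP : ∀ a ∈ S, a ≠ 0 → ∃ x y, x * a * y = 1 ∧ ‖x‖ ≤ 2 / ‖a‖ ∧ ‖y‖ ≤ 1)
    (I : TwoSidedIdeal D) : (I : Set D) = {0} ∨ (I : Set D) = Set.univ := by
  by_cases h : ∀ d ∈ I, d = 0
  · left
    ext d
    simp only [SetLike.mem_coe, Set.mem_singleton_iff]
    exact ⟨h d, fun hd => hd ▸ I.zero_mem⟩
  · right
    push Not at h
    obtain ⟨d, hdI, hd0⟩ := h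
    have hdn : 0 < ‖d‖ := norm_pos_iff.2 hd0
    obtain ⟨s, hs, hds⟩ := Metric.dense_iff.1 hd d (‖d‖ / 4) (by positivity)
    have hds' : ‖s - d‖ < ‖d‖ / 4 := by simpa [dist_eq_norm] using hs
    have hsn : 3 / 4 * ‖d‖ < ‖s‖ := by
      have : ‖d‖ ≤ ‖s‖ + ‖s - d‖ := by
        calc ‖d‖ = ‖s - (s - d)‖ := by simp
          _ ≤ _ := norm_sub_le _ _
      linarith
    have hs0 : 0 < ‖s‖ := lt_trans (by positivity) hsn
    obtain ⟨x, y, hxy, hx, hy⟩ := hP s hds (norm_pos_iff.1 hs0)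
    have hmem : x * d * y ∈ I := I.mul_mem_right _ _ (I.mul_mem_left _ _ hdI)
    have hlt : ‖1 - x * d * y‖ < 1 := by
      have : 1 - x * d * y = x * (s - d) * y := by rw [← hxy]; noncomm_ring
      rw [this]
      calc ‖x * (s - d) * y‖ ≤ ‖x‖ * ‖s - d‖ * ‖y‖ := by
            refine (norm_mul_le _ _).trans ?_
            gcongr
            exact norm_mul_le _ _
        _ ≤ 2 / ‖s‖ * (‖d‖ / 4) * 1 := by gcongr
        _ < 1 := by
          rw [mul_one, div_mul_eq_mul_div, div_lt_one hs0]
          linarith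
    have hu : IsUnit (x * d * y) := by
      have := isUnit_one_sub_of_norm_lt_one hlt
      simpa using this
    obtain ⟨v, hv⟩ := hu
    have h1 : (1 : D) ∈ I := by
      have := I.mul_mem_left (↑v⁻¹ : D) _ hmem
      rw [← hv] at this
      simpa using this
    ext z
    simp only [SetLike.mem_coe, Set.mem_univ, iff_true]
    simpa using I.mul_mem_left z _ h1

theorem core {A : Type u} [NonUnitalCStarAlgebra A] {A1 : Type u} [CStarAlgebra A1] [Nontrivial A1]
    (j : A →⋆ₙₐ[ℂ] A1) (hj : Function.Injective j)
    (hu : ∀ u : A, (∀ a : A, u * a = a ∧ a * u = a) → j u = 1) :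
    ∃ (D : Type u) (_ : NonUnitalCStarAlgebra D),
      (∀ I : TwoSidedIdeal D, IsClosed (I : Set D) →
        (I : Set D) = {0} ∨ (I : Set D) = Set.univ) ∧
      densityCharacter D ≤ max Cardinal.aleph0 (densityCharacter A) ∧
      ∃ φ : A →⋆ₙₐ[ℂ] D, Function.Injective φ ∧
        ∀ u : A, (∀ a : A, u * a = a ∧ a * u = a) →
          ∀ d : D, φ u * d = d ∧ d * φ u = d := by
  obtain ⟨B, _, E, ψ, _, hψ, hψE, hE⟩ := exists_big (A := A1)
  have : ∀ a : B, ∃ x y : B, a ∈ E → x ∈ E ∧ y ∈ E ∧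
      (a ≠ 0 → x * a * y = 1 ∧ ‖x‖ ≤ 2 / ‖a‖ ∧ ‖y‖ ≤ 1) := by
    intro a
    by_cases h : a ∈ E ∧ a ≠ 0
    · obtain ⟨x, hx, y, hy, hxy⟩ := hE a h.1 h.2
      exact ⟨x, y, fun _ => ⟨hx, hy, fun _ => hxy⟩⟩
    · exact ⟨1, 1, fun ha => ⟨one_mem _, one_mem _, fun h0 => absurd ⟨ha, h0⟩ h⟩⟩
  choose X Y hXY using this
  let f : ℕ ⊕ Fin 5 → B → B → B := fun i a b => match i with
    | .inl n => TopologicalSpace.denseSeq ℂ n • a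
    | .inr 0 => a + b
    | .inr 1 => a * b
    | .inr 2 => star a
    | .inr 3 => X a
    | .inr 4 => Y a
  obtain ⟨R, hRd, hRc⟩ : ∃ R : Set A, Dense R ∧ Cardinal.mk R = densityCharacter A :=
    csInf_mem (s := {c : Cardinal | ∃ s : Set A, Dense s ∧ Cardinal.mk s = c})
      ⟨_, Set.univ, dense_univ, rfl⟩
  let θ : A →⋆ₙₐ[ℂ] B := (ψ : A1 →⋆ₙₐ[ℂ] B).comp j
  have hθ : Function.Injective θ := hψ.comp hj
  have hθE : ∀ a, θ a ∈ E := fun a => hψE _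
  obtain ⟨S, hS0, hSE, hSf, hSc⟩ := exists_closed f (insert 1 (θ '' R)) (E : Set B) (by
      rintro x (rfl | ⟨a, _, rfl⟩)
      · exact one_mem E
      · exact hθE a) (by
      intro i a ha b hb
      match i with
      | .inl n => exact E.smul_mem ha _
      | .inr 0 => exact E.add_mem ha hb
      | .inr 1 => exact E.mul_mem ha hb
      | .inr 2 => exact star_mem (S := StarSubalgebra ℂ B) ha
      | .inr 3 => exact (hXY a ha).1
      | .inr 4 => exact (hXY a ha).2.1)
  have hSc' : Cardinal.mk S ≤ max Cardinal.aleph0 (densityCharacter A) := by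
    refine hSc.trans (max_le (le_max_left _ _) ?_)
    refine Cardinal.mk_insert_le.trans ?_
    refine Cardinal.add_le_of_le (le_max_left _ _) ?_
      (Cardinal.one_le_aleph0.trans (le_max_left _ _))
    exact Cardinal.mk_image_le.trans (hRc.le.trans (le_max_right _ _))
  have h1S : (1 : B) ∈ S := hS0 (Set.mem_insert _ _)
  have hadd : ∀ a ∈ closure S, ∀ b ∈ closure S, a + b ∈ closure S := fun a ha b hb =>
    map_mem_closure₂ continuous_add ha hb (fun a ha b hb => hSf (.inr 0) a ha b hb)
  have hmul : ∀ a ∈ closure S, ∀ b ∈ closure S, a * b ∈ closure S := fun a ha b hb =>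
    map_mem_closure₂ continuous_mul ha hb (fun a ha b hb => hSf (.inr 1) a ha b hb)
  have hstar : ∀ a ∈ closure S, star a ∈ closure S := fun a ha =>
    map_mem_closure continuous_star ha (fun a ha => hSf (.inr 2) a ha a ha)
  have hsmul : ∀ c : ℂ, ∀ a ∈ closure S, c • a ∈ closure S := fun c a ha =>
    map_mem_closure₂ (continuous_smul (M := ℂ) (X := B))
      (TopologicalSpace.denseRange_denseSeq ℂ c) ha (by
        rintro _ ⟨n, rfl⟩ a ha
        exact hSf (.inl n) a ha a ha)
  let D : StarSubalgebra ℂ B :=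
    { carrier := closure S
      mul_mem' := fun ha hb => hmul _ ha _ hb
      add_mem' := fun ha hb => hadd _ ha _ hb
      algebraMap_mem' := fun r => by
        rw [Algebra.algebraMap_eq_smul_one]
        exact hsmul r _ (subset_closure h1S)
      star_mem' := fun ha => hstar _ ha }
  have hDc : IsClosed (D : Set B) := isClosed_closure
  let _ : CStarAlgebra D := StarSubalgebra.cstarAlgebra D (h_closed := hDc)
  let S' : Set D := Subtype.val ⁻¹' S
  have hS'd : Dense S' := by
    intro d
    rw [closure_subtype]
    have : (Subtype.val '' S' : Set B) = S := by
      ext x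
      constructor
      · rintro ⟨y, hy, rfl⟩
        exact hy
      · intro hx
        exact ⟨⟨x, subset_closure hx⟩, hx, rfl⟩
    rw [this]
    exact d.2
  have hθD : ∀ a, θ a ∈ D := by
    intro a
    have hc : Continuous θ := (NonUnitalStarAlgHom.isometry θ hθ).continuous
    exact map_mem_closure hc (hRd a) (fun r hr => hS0 (Or.inr ⟨r, hr, rfl⟩))
  refine ⟨D, inferInstance, ?_, ?_, ?_⟩
  · intro I _
    refine simple_of_dense S' hS'd ?_ I
    intro a ha ha0
    have ha' : (a : B) ∈ S := ha
    have ha0' : (a : B) ≠ 0 := fun h => ha0 (Subtype.ext h)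
    obtain ⟨h1, h2, h3⟩ := (hXY a (hSE ha')).2.2 ha0'
    refine ⟨⟨X a, subset_closure (hSf (.inr 3) a ha' a ha')⟩,
      ⟨Y a, subset_closure (hSf (.inr 4) a ha' a ha')⟩, Subtype.ext h1, h2, h3⟩
  · refine le_trans (csInf_le' ⟨S', hS'd, rfl⟩) ?_
    exact (Cardinal.mk_preimage_of_injective _ _ Subtype.val_injective).trans hSc'
  · let φ : A →⋆ₙₐ[ℂ] D :=
      { toFun := fun a => ⟨θ a, hθD a⟩
        map_smul' := fun c a => Subtype.ext (map_smul θ c a)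
        map_zero' := Subtype.ext (map_zero θ)
        map_add' := fun a b => Subtype.ext (map_add θ a b)
        map_mul' := fun a b => Subtype.ext (map_mul θ a b)
        map_star' := fun a => Subtype.ext (map_star θ a) }
    refine ⟨φ, fun a b h => hθ (congrArg Subtype.val h), ?_⟩
    intro u hu' d
    have h1 : φ u = 1 := by
      apply Subtype.ext
      show ψ (j u) = 1
      rw [hu u hu', map_one]
    rw [h1]
    exact ⟨one_mul d, mul_one d⟩

end LS

/-- The unital normed ring structure on a C*-algebra with a unit element. -/
noncomputable abbrev normedRingOfUnit {A : Type u} [inst : NonUnitalCStarAlgebra A] (u : A)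
    (hu : ∀ a : A, u * a = a ∧ a * u = a) : NormedRing A :=
  { inst.toNonUnitalNormedRing with
    one := u
    one_mul := fun a => (hu a).1
    mul_one := fun a => (hu a).2 }

/-- The unital algebra structure on a C*-algebra with a unit element. -/
noncomputable abbrev normedAlgebraOfUnit {A : Type u} [inst : NonUnitalCStarAlgebra A] (u : A)
    (hu : ∀ a : A, u * a = a ∧ a * u = a) :
    @NormedAlgebra ℂ A _ (normedRingOfUnit u hu).toSeminormedRing :=
  letI := normedRingOfUnit u hu
  { inst.toNormedSpace.toModule with
    norm_smul_le := norm_smul_le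
    algebraMap :=
      { toFun := fun c => c • u
        map_one' := one_smul ℂ u
        map_mul' := fun c d => by
          have := smul_mul_smul_comm c u d u
          rw [(hu u).1] at this
          exact this.symm
        map_zero' := zero_smul ℂ u
        map_add' := fun c d => add_smul c d u }
    commutes' := fun c a => by
      have h1 := smul_mul_assoc c u a
      have h2 := mul_smul_comm c a u
      rw [(hu a).1] at h1
      rw [(hu a).2] at h2
      exact h1.trans h2.symm
    smul_def' := fun c a => by
      have h1 := smul_mul_assoc c u a
      rw [(hu a).1] at h1
      exact h1.symm }

/-- Promote a C*-algebra with a unit element to a unital C*-algebra. -/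
noncomputable abbrev unitalOfUnit {A : Type u} [inst : NonUnitalCStarAlgebra A] (u : A)
    (hu : ∀ a : A, u * a = a ∧ a * u = a) : CStarAlgebra A :=
  { normedRingOfUnit u hu, normedAlgebraOfUnit u hu, inst with }

end helpers

/-- Every C*-algebra `A` embeds into a simple C*-algebra `D` (one whose only closed
two-sided ideals are `{0}` and `D`) of density character at most
`max ℵ₀ (densityCharacter A)`; moreover the embedding sends a unit of `A` (if one exists)
to a unit of `D`, so that `D` is unital and the embedding unital whenever `A` is unital. -/
theorem embeds_into_simple_CStarAlgebra
    (A : Type u) [NonUnitalCStarAlgebra A] :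
    ∃ (D : Type u) (_ : NonUnitalCStarAlgebra D),
      (∀ I : TwoSidedIdeal D, IsClosed (I : Set D) →
        (I : Set D) = {0} ∨ (I : Set D) = Set.univ) ∧
      densityCharacter D ≤ max Cardinal.aleph0 (densityCharacter A) ∧
      ∃ φ : A →⋆ₙₐ[ℂ] D, Function.Injective φ ∧
        ∀ u : A, (∀ a : A, u * a = a ∧ a * u = a) →
          ∀ d : D, φ u * d = d ∧ d * φ u = d := by
  rcases subsingleton_or_nontrivial A with hA | hA
  · refine ⟨A, inferInstance, fun I _ => Or.inr ?_, le_max_right _ _,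
      NonUnitalStarAlgHom.id ℂ A, Function.injective_id, fun u hu d => hu d⟩
    ext x
    simp only [SetLike.mem_coe, Set.mem_univ, iff_true]
    rw [Subsingleton.elim x 0]
    exact I.zero_mem
  · by_cases h : ∃ u : A, ∀ a : A, u * a = a ∧ a * u = a
    · obtain ⟨u, hu⟩ := h
      refine @core A _ A (unitalOfUnit u hu) hA (NonUnitalStarAlgHom.id ℂ A)
        Function.injective_id ?_
      intro v hv
      show v = u
      exact ((hu v).2).symm.trans (hv u).1
    · refine core (A1 := Unitization ℂ A) (Unitization.inrNonUnitalStarAlgHom ℂ A)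
        Unitization.inr_injective ?_
      intro u hu
      exact absurd ⟨u, hu⟩ h
end
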